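/- Let q > 1 and p ≥ 0, let f be a positive smooth even function on S^{n−1}, and let Ω_t, t ∈ [0,T), be a smooth solution of the normalized Gauss curvature flow ∂h/∂t = −θ(t) h^p 𝒦 f / Ṽ_{γ,q}(Ω_t, ∇h + hx) + h starting from a smooth, closed, origin-symmetric, strictly convex body. Then there is a constant C > 0 independent of t such that |∇h(x,t)| ≤ C for all (x,t) ∈ S^{n−1} × [0,T) and |∇ρ(ξ,t)| ≤ C for all (ξ,t) ∈ S^{n−1} × [0,T), where ∇ denotes the covariant gradient on S^{n−1}. -/

import Mathlib

open MeasureTheory Filter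
open scoped RealInnerProductSpace Topology

noncomputable section

/-- `n`-dimensional Euclidean space. -/
abbrev Eucl (n : ℕ) := EuclideanSpace ℝ (Fin n)

/-- The support function of `K`, as a `1`-homogeneous function on all of `ℝⁿ`;
its restriction to the unit sphere is the usual support function `h_K`. -/
def suppFun {n : ℕ} (K : Set (Eucl n)) (x : Eucl n) : ℝ :=
  sSup ((fun y => ⟪x, y⟫) '' K)

/-- The radial function `ρ_K(ξ) = max {c > 0 : c • ξ ∈ K}`. -/
def radFun {n : ℕ} (K : Set (Eucl n)) (ξ : Eucl n) : ℝ :=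
  sSup {c : ℝ | 0 < c ∧ c • ξ ∈ K}

/-- `Ṽ_{γ,q}(K, y) = 2 e^{-|y|²/2} ∫_K e^{-|z|²/2} |z - y|^{-(n-q+1)} dz`. -/
def Vtilde {n : ℕ} (q : ℝ) (K : Set (Eucl n)) (y : Eucl n) : ℝ :=
  2 * Real.exp (-‖y‖ ^ 2 / 2) *
    ∫ z in K, Real.exp (-‖z‖ ^ 2 / 2) / ‖z - y‖ ^ ((n : ℝ) - q + 1)

/-- The Gaussian chord integral
`I_{γ,q}(K) = ∫_K ∫_K e^{-(|z|²+|y|²)/2} |z - y|^{-(n-q+1)} dz dy`. -/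
def gaussChord {n : ℕ} (q : ℝ) (K : Set (Eucl n)) : ℝ :=
  ∫ y in K, ∫ z in K,
    Real.exp (-(‖z‖ ^ 2 + ‖y‖ ^ 2) / 2) / ‖z - y‖ ^ ((n : ℝ) - q + 1)

/-- The rank-one map `v ↦ ⟪x, v⟫ • x` (orthogonal projection onto `ℝ x` when `‖x‖ = 1`). -/
def rankOne {n : ℕ} (x : Eucl n) : Eucl n →ₗ[ℝ] Eucl n where
  toFun v := ⟪x, v⟫ • x
  map_add' v w := by simp [inner_add_right, add_smul]
  map_smul' c v := by simp [inner_smul_right, mul_smul]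

/-- For the `1`-homogeneous extension `H` of the support function `h` of a smooth strictly
convex body, `fderiv ℝ (gradient H) x` vanishes on `ℝ x` and restricts on the tangent space
`x^⊥` to the matrix of principal radii of curvature `∇²h + h I`.  Adding the rank-one
projection onto `ℝ x` therefore makes the determinant of the ambient map equal to
`det(∇²h + h I)`, the reciprocal Gauss curvature. -/
def curvDet {n : ℕ} (H : Eucl n → ℝ) (x : Eucl n) : ℝ :=
  LinearMap.det
    ((fderiv ℝ (fun y => gradient H y) x : Eucl n →ₗ[ℝ] Eucl n) + rankOne x)

/-- A convex body in `ℝⁿ` which is origin-symmetric and has smooth, strictly convex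
boundary (encoded via smoothness of its support function away from the origin and
positivity of the curvature determinant on the sphere). -/
def IsSmoothBody {n : ℕ} (Ω : Set (Eucl n)) : Prop :=
  IsCompact Ω ∧ Convex ℝ Ω ∧ (0 : Eucl n) ∈ interior Ω ∧ (∀ x ∈ Ω, -x ∈ Ω) ∧
    ContDiffOn ℝ (⊤ : ℕ∞) (suppFun Ω) {(0 : Eucl n)}ᶜ ∧
    ∀ x ∈ Metric.sphere (0 : Eucl n) 1, 0 < curvDet (suppFun Ω) x

/-- The normalizing factor
`θ(t) = (∫_{S^{n-1}} Ṽ_{γ,q}(Ω, ρ(ξ)ξ) ρ(ξ)ⁿ dξ) / (∫_{S^{n-1}} h(x)^p f(x) dx)`. -/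
def theta {n : ℕ} (q p : ℝ) (f : Eucl n → ℝ) (K : Set (Eucl n)) : ℝ :=
  (∫ ξ in Metric.sphere (0 : Eucl n) 1,
      Vtilde q K (radFun K ξ • ξ) * radFun K ξ ^ n ∂μH[(n : ℝ) - 1]) /
  ∫ x in Metric.sphere (0 : Eucl n) 1, suppFun K x ^ p * f x ∂μH[(n : ℝ) - 1]

/-- The right-hand side `-θ h^p 𝒦 f / Ṽ_{γ,q}(K, ∇h + h x) + h` of the normalized Gauss
curvature flow, expressed through the `1`-homogeneous extension of the support function
(`gradient (suppFun K) x = ∇h(x) + h(x) x` and `𝒦 = (curvDet (suppFun K) x)⁻¹`). -/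
def flowRHS {n : ℕ} (q p : ℝ) (f : Eucl n → ℝ) (K : Set (Eucl n)) (x : Eucl n) : ℝ :=
  -(theta q p f K) * suppFun K x ^ p * (curvDet (suppFun K) x)⁻¹ * f x /
      Vtilde q K (gradient (suppFun K) x) + suppFun K x

/-- `K : ℝ → Set (Eucl n)` solves the normalized Gauss curvature flow
`∂h/∂t = -θ(t) h^p 𝒦 f / Ṽ_{γ,q} + h` on the time set `S`. -/
def IsGaussChordFlow {n : ℕ} (q p : ℝ) (f : Eucl n → ℝ) (S : Set ℝ)
    (K : ℝ → Set (Eucl n)) : Prop :=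
  ∀ t ∈ S, ∀ x ∈ Metric.sphere (0 : Eucl n) 1,
    HasDerivWithinAt (fun s => suppFun (K s) x) (flowRHS q p f (K t) x) S t

/-- The Wulff shape (Aleksandrov body) of a function `φ` on the unit sphere. -/
def wulff {n : ℕ} (φ : Eucl n → ℝ) : Set (Eucl n) :=
  {x | ∀ u ∈ Metric.sphere (0 : Eucl n) 1, ⟪x, u⟫ ≤ φ u}

/-- `ν` is a Gauss map of `∂K`: at every boundary point `y` of `K`, `ν y` is an outer
unit normal, i.e. `y · ν y = h_K(ν y)`. -/
def IsGaussMap {n : ℕ} (K : Set (Eucl n)) (ν : Eucl n → Eucl n) : Prop :=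
  ∀ y ∈ frontier K, ν y ∈ Metric.sphere (0 : Eucl n) 1 ∧ ⟪y, ν y⟫ = suppFun K (ν y)

section

/-- A convex body containing the origin in its interior. -/
structure IsBody {n : ℕ} (K : Set (Eucl n)) : Prop where
  compact : IsCompact K
  convex : Convex ℝ K
  zero_mem : (0 : Eucl n) ∈ interior K

variable {n : ℕ} {K : Set (Eucl n)}

lemma IsSmoothBody.isBody (h : IsSmoothBody K) : IsBody K := ⟨h.1, h.2.1, h.2.2.1⟩

namespace IsBody

lemma bddAbove (hK : IsBody K) (x : Eucl n) : BddAbove ((fun y => ⟪x, y⟫) '' K) :=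
  (hK.compact.image (by fun_prop)).bddAbove

lemma nonempty (hK : IsBody K) : K.Nonempty := ⟨0, interior_subset hK.zero_mem⟩

lemma mem_nhds (hK : IsBody K) : K ∈ 𝓝 (0 : Eucl n) := mem_interior_iff_mem_nhds.1 hK.zero_mem

lemma inner_le (hK : IsBody K) (x : Eucl n) {y : Eucl n} (hy : y ∈ K) : ⟪x, y⟫ ≤ suppFun K x :=
  le_csSup (hK.bddAbove x) ⟨y, hy, rfl⟩

lemma exists_inner_eq (hK : IsBody K) (x : Eucl n) : ∃ y ∈ K, ⟪x, y⟫ = suppFun K x := by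
  obtain ⟨y, hy, h⟩ := (hK.compact.image (f := fun y => ⟪x, y⟫) (by fun_prop)).sSup_mem
    (hK.nonempty.image _)
  exact ⟨y, hy, h⟩

lemma suppFun_le (hK : IsBody K) {x : Eucl n} {c : ℝ} (h : ∀ y ∈ K, ⟪x, y⟫ ≤ c) :
    suppFun K x ≤ c := by
  obtain ⟨y, hy, hxy⟩ := hK.exists_inner_eq x
  exact hxy ▸ h y hy

lemma suppFun_smul (hK : IsBody K) {c : ℝ} (hc : 0 ≤ c) (x : Eucl n) :
    suppFun K (c • x) = c * suppFun K x := by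
  apply le_antisymm
  · refine hK.suppFun_le fun y hy => ?_
    rw [real_inner_smul_left]
    exact mul_le_mul_of_nonneg_left (hK.inner_le x hy) hc
  · obtain ⟨y, hy, hxy⟩ := hK.exists_inner_eq x
    rw [← hxy, ← real_inner_smul_left]
    exact hK.inner_le _ hy

lemma suppFun_zero (hK : IsBody K) : suppFun K 0 = 0 := by
  simpa using hK.suppFun_smul le_rfl 0

lemma suppFun_add_le (hK : IsBody K) (x y : Eucl n) :
    suppFun K (x + y) ≤ suppFun K x + suppFun K y := by
  refine hK.suppFun_le fun z hz => ?_
  rw [inner_add_left]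
  exact add_le_add (hK.inner_le x hz) (hK.inner_le y hz)

lemma suppFun_pos (hK : IsBody K) {x : Eucl n} (hx : x ≠ 0) : 0 < suppFun K x := by
  have h : ∀ᶠ c : ℝ in 𝓝[>] 0, c • x ∈ K := by
    have : Tendsto (fun c : ℝ => c • x) (𝓝 0) (𝓝 0) := by
      have : Continuous fun c : ℝ => c • x := by fun_prop
      simpa using this.tendsto 0
    exact (this.mono_left nhdsWithin_le_nhds).eventually hK.mem_nhds
  obtain ⟨c, hc, hc0⟩ := (h.and self_mem_nhdsWithin).exists
  have hc0 : 0 < c := hc0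
  refine lt_of_lt_of_le ?_ (hK.inner_le x hc)
  rw [real_inner_smul_right, real_inner_self_eq_norm_sq]
  positivity

lemma suppFun_nonneg (hK : IsBody K) (x : Eucl n) : 0 ≤ suppFun K x := by
  rcases eq_or_ne x 0 with rfl | hx
  · exact hK.suppFun_zero.ge
  · exact (hK.suppFun_pos hx).le

lemma suppFun_le_norm (hK : IsBody K) {R : ℝ} (hR : K ⊆ Metric.closedBall 0 R) (x : Eucl n) :
    suppFun K x ≤ R * ‖x‖ := by
  refine hK.suppFun_le fun y hy => (real_inner_le_norm x y).trans ?_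
  rw [mul_comm]
  exact mul_le_mul_of_nonneg_right (by simpa using hR hy) (norm_nonneg _)

lemma abs_suppFun_sub_le (hK : IsBody K) {R : ℝ} (hR : K ⊆ Metric.closedBall 0 R)
    (x y : Eucl n) : |suppFun K x - suppFun K y| ≤ R * ‖x - y‖ := by
  have h1 := hK.suppFun_add_le (x - y) y
  have h2 := hK.suppFun_add_le (y - x) x
  have h3 := hK.suppFun_le_norm hR (x - y)
  have h4 := hK.suppFun_le_norm hR (y - x)
  rw [norm_sub_rev] at h4
  rw [sub_add_cancel] at h1 h2
  rw [abs_le]; constructor <;> linarith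

lemma exists_radius (hK : IsBody K) : ∃ R : ℝ, 0 < R ∧ K ⊆ Metric.closedBall 0 R := by
  obtain ⟨R, hR⟩ := hK.compact.isBounded.subset_closedBall 0
  exact ⟨max R 1, by positivity, hR.trans (Metric.closedBall_subset_closedBall (le_max_left _ _))⟩

lemma continuous_suppFun (hK : IsBody K) : Continuous (suppFun K) := by
  obtain ⟨R, hR0, hR⟩ := hK.exists_radius
  refine LipschitzWith.continuous (K := R.toNNReal) (LipschitzWith.of_dist_le_mul fun x y => ?_)
  rw [Real.dist_eq, dist_eq_norm, Real.coe_toNNReal _ hR0.le]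
  exact hK.abs_suppFun_sub_le hR x y

lemma mem_of_forall_inner_le (hK : IsBody K) {y : Eucl n}
    (h : ∀ x ∈ Metric.sphere (0 : Eucl n) 1, ⟪x, y⟫ ≤ suppFun K x) : y ∈ K := by
  by_contra hy
  obtain ⟨φ, u, hφ, hu⟩ := geometric_hahn_banach_closed_point hK.convex hK.compact.isClosed hy
  set w := (InnerProductSpace.toDual ℝ (Eucl n)).symm φ with hw
  have hφw : ∀ z, φ z = ⟪w, z⟫ := fun z => by simp [hw]
  have hw0 : w ≠ 0 := by
    intro h0
    have h1 := hφ 0 (interior_subset hK.zero_mem)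
    rw [hφw, h0] at h1 hu
    simp only [inner_zero_left] at h1 hu
    linarith
  have h1 := h (‖w‖⁻¹ • w) (by simp [norm_smul, hw0])
  rw [hK.suppFun_smul (by positivity), real_inner_smul_left] at h1
  have h2 := le_of_mul_le_mul_left h1 (by positivity)
  obtain ⟨z, hz, hwz⟩ := hK.exists_inner_eq w
  have h3 := hφ z hz
  rw [hφw] at h3 hu
  linarith

lemma gauge_le_one_iff (hK : IsBody K) {z : Eucl n} : gauge K z ≤ 1 ↔ z ∈ K := by
  rw [gauge_le_one_iff_mem_closure hK.convex hK.mem_nhds, hK.compact.isClosed.closure_eq]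

lemma continuous_gauge (hK : IsBody K) : Continuous (gauge K) :=
  _root_.continuous_gauge hK.convex hK.mem_nhds

lemma gauge_pos (hK : IsBody K) {z : Eucl n} (hz : z ≠ 0) : 0 < gauge K z :=
  (_root_.gauge_pos (absorbent_nhds_zero hK.mem_nhds)
    (NormedSpace.isVonNBounded_of_isBounded _ hK.compact.isBounded)).2 hz

lemma gauge_smul (_hK : IsBody K) {c : ℝ} (hc : 0 ≤ c) (z : Eucl n) :
    gauge K (c • z) = c * gauge K z := by
  rw [gauge_smul_of_nonneg hc, smul_eq_mul]

lemma inv_gauge_smul_mem (hK : IsBody K) {z : Eucl n} (hz : z ≠ 0) : (gauge K z)⁻¹ • z ∈ K := by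
  rw [← hK.gauge_le_one_iff, hK.gauge_smul (by have := hK.gauge_pos hz; positivity),
    inv_mul_cancel₀ (hK.gauge_pos hz).ne']

lemma inner_le_gauge_mul (hK : IsBody K) (x z : Eucl n) : ⟪x, z⟫ ≤ gauge K z * suppFun K x := by
  rcases eq_or_ne z 0 with rfl | hz
  · simp
  have h := hK.inner_le x (hK.inv_gauge_smul_mem hz)
  rw [real_inner_smul_right, inv_mul_le_iff₀ (hK.gauge_pos hz)] at h
  exact h

lemma gauge_le (hK : IsBody K) {z : Eucl n} {c : ℝ} (hc : 0 < c)
    (h : ∀ x ∈ Metric.sphere (0 : Eucl n) 1, ⟪x, z⟫ ≤ c * suppFun K x) : gauge K z ≤ c := by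
  have : c⁻¹ • z ∈ K := hK.mem_of_forall_inner_le fun x hx => by
    rw [real_inner_smul_right, inv_mul_le_iff₀ hc]
    exact h x hx
  rw [← hK.gauge_le_one_iff, hK.gauge_smul (by positivity), inv_mul_le_iff₀ hc, mul_one] at this
  exact this

lemma norm_le_mul_gauge (hK : IsBody K) {R : ℝ} (hR : K ⊆ Metric.closedBall 0 R) (z : Eucl n) :
    ‖z‖ ≤ R * gauge K z := by
  rcases eq_or_ne z 0 with rfl | hz
  · simp
  have := hR (hK.inv_gauge_smul_mem hz)
  have hg := hK.gauge_pos hz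
  rw [mem_closedBall_zero_iff, norm_smul, norm_inv, Real.norm_of_nonneg hg.le,
    inv_mul_le_iff₀ hg] at this
  linarith

lemma radFun_eq (hK : IsBody K) {ξ : Eucl n} (hξ : ξ ≠ 0) : radFun K ξ = (gauge K ξ)⁻¹ := by
  have hg := hK.gauge_pos hξ
  have : {c : ℝ | 0 < c ∧ c • ξ ∈ K} = Set.Ioc 0 (gauge K ξ)⁻¹ := by
    ext c
    simp only [Set.mem_ofPred_eq, Set.mem_Ioc]
    refine and_congr_right fun hc => ?_
    rw [← hK.gauge_le_one_iff, hK.gauge_smul hc.le, le_inv_comm₀ hc hg, ← one_div, le_div_iff₀ hc,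
      mul_comm]
  rw [radFun, this, csSup_Ioc (by positivity)]

lemma radFun_pos (hK : IsBody K) {ξ : Eucl n} (hξ : ξ ≠ 0) : 0 < radFun K ξ := by
  rw [hK.radFun_eq hξ]; have := hK.gauge_pos hξ; positivity

lemma radFun_le (hK : IsBody K) {R : ℝ} (hR : K ⊆ Metric.closedBall 0 R) {ξ : Eucl n}
    (hξ : ξ ∈ Metric.sphere (0 : Eucl n) 1) : radFun K ξ ≤ R := by
  have h0 : ξ ≠ 0 := ne_zero_of_mem_unit_sphere ⟨ξ, hξ⟩
  have hg := hK.gauge_pos h0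
  rw [hK.radFun_eq h0]
  have := hK.norm_le_mul_gauge hR ξ
  rw [mem_sphere_zero_iff_norm.1 hξ] at this
  rwa [inv_le_iff_one_le_mul₀ hg]

lemma measurableSet (hK : IsBody K) : MeasurableSet K := hK.compact.measurableSet

end IsBody

lemma IsSmoothBody.differentiableAt (h : IsSmoothBody K) {x : Eucl n} (hx : x ≠ 0) :
    DifferentiableAt ℝ (suppFun K) x :=
  (h.2.2.2.2.1.contDiffAt (isOpen_compl_singleton.mem_nhds hx)).differentiableAt (by simp)

lemma IsSmoothBody.gradient_eq (h : IsSmoothBody K) {x y : Eucl n} (hx : x ≠ 0) (hy : y ∈ K)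
    (hxy : ⟪x, y⟫ = suppFun K x) : gradient (suppFun K) x = y := by
  have hmin : IsLocalMin (fun z => suppFun K z - ⟪y, z⟫) x := by
    refine Filter.Eventually.of_forall fun z => ?_
    have := h.isBody.inner_le z hy
    simp only [real_inner_comm] at *
    linarith
  have hd := (h.differentiableAt hx).hasGradientAt.hasFDerivAt.sub
    ((InnerProductSpace.toDual ℝ (Eucl n) y).hasFDerivAt (x := x))
  have h0 := hmin.hasFDerivAt_eq_zero hd
  rw [← map_sub, map_eq_zero_iff _ (LinearIsometryEquiv.injective _), sub_eq_zero] at h0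
  exact h0

lemma IsSmoothBody.gradient_mem (h : IsSmoothBody K) {x : Eucl n} (hx : x ≠ 0) :
    gradient (suppFun K) x ∈ K ∧ ⟪x, gradient (suppFun K) x⟫ = suppFun K x := by
  obtain ⟨y, hy, hxy⟩ := h.isBody.exists_inner_eq x
  rw [h.gradient_eq hx hy hxy]
  exact ⟨hy, hxy⟩

lemma IsSmoothBody.gradient_smul (h : IsSmoothBody K) {x : Eucl n} (hx : x ≠ 0) {c : ℝ}
    (hc : 0 < c) : gradient (suppFun K) (c • x) = gradient (suppFun K) x := by
  obtain ⟨h1, h2⟩ := h.gradient_mem hx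
  refine h.gradient_eq (smul_ne_zero hc.ne' hx) h1 ?_
  rw [real_inner_smul_left, h2, h.isBody.suppFun_smul hc.le]

lemma sphere_ne_zero {x : Eucl n} (hx : x ∈ Metric.sphere (0 : Eucl n) 1) : x ≠ 0 :=
  ne_zero_of_mem_unit_sphere ⟨x, hx⟩

end

section

variable {n : ℕ} {K : Set (Eucl n)} {q : ℝ}

lemma integrableOn_kernel (hn : 0 < n) {α : ℝ} (hα : α < n) (R : ℝ) :
    IntegrableOn (fun w : Eucl n => 1 / ‖w‖ ^ α) (Metric.closedBall 0 R) := by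
  have : Nonempty (Fin n) := ⟨⟨0, hn⟩⟩
  refine IntegrableOn.mono_set ?_ (Metric.closedBall_subset_ball (lt_add_one R))
  rw [integrableOn_fun_norm_addHaar volume (f := fun r : ℝ => 1 / r ^ α)]
  have h : IntegrableOn (fun y : ℝ => y ^ ((n : ℝ) - 1 - α)) (Set.Ioo 0 (R + 1)) := by
    rcases le_or_gt (R + 1) 0 with h0 | h0
    · simp [Set.Ioo_eq_empty (not_lt.2 h0)]
    · exact (intervalIntegral.integrableOn_Ioo_rpow_iff h0).2 (by linarith)
  refine h.congr_fun (fun y hy => ?_) measurableSet_Ioo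
  have hy0 : 0 < y := hy.1
  simp only [finrank_euclideanSpace, Fintype.card_fin, smul_eq_mul]
  rw [Real.rpow_sub hy0, ← Real.rpow_natCast, Nat.cast_sub hn]
  simp [div_eq_mul_inv]

/-- The sets `A i` converge to the body `K`, measured by the gauge of `K`. -/
def BodyTendsto {ι : Type*} (A : ι → Set (Eucl n)) (l : Filter ι) (K : Set (Eucl n)) : Prop :=
  ∀ ε : ℝ, 0 < ε → ε < 1 →
    ∀ᶠ i in l, (∀ z, gauge K z ≤ 1 - ε → z ∈ A i) ∧ ∀ z ∈ A i, gauge K z ≤ 1 + ε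

lemma IsBody.bodyTendsto_const {ι : Type*} (hK : IsBody K) (l : Filter ι) :
    BodyTendsto (fun _ : ι => K) l K := fun ε h0 _ =>
  Eventually.of_forall fun _ => ⟨fun _ hz => hK.gauge_le_one_iff.1 (by linarith),
    fun _ hz => (hK.gauge_le_one_iff.2 hz).trans (by linarith)⟩

namespace BodyTendsto

variable {ι : Type*} {A : ι → Set (Eucl n)} {l : Filter ι}

lemma comp (h : BodyTendsto A l K) {κ : Type*} {m : Filter κ} {u : κ → ι} (hu : Tendsto u m l) :
    BodyTendsto (fun k => A (u k)) m K :=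
  fun ε h0 h1 => hu.eventually (h ε h0 h1)

lemma eventually_subset (h : BodyTendsto A l K) (hK : IsBody K) {R : ℝ} (hR0 : 0 ≤ R)
    (hR : K ⊆ Metric.closedBall 0 R) : ∀ᶠ i in l, A i ⊆ Metric.closedBall 0 (2 * R) := by
  filter_upwards [h (1 / 2) (by norm_num) (by norm_num)] with i hi z hz
  have h1 := hK.norm_le_mul_gauge hR z
  have h2 := hi.2 z hz
  rw [mem_closedBall_zero_iff]
  nlinarith

lemma tendsto_indicator (h : BodyTendsto A l K) (hK : IsBody K) {z : ι → Eucl n} {z₀ : Eucl n}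
    (hz : Tendsto z l (𝓝 z₀)) (hz₀ : z₀ ∉ frontier K) :
    ∀ᶠ i in l, (z i ∈ A i ↔ z₀ ∈ K) := by
  have hg : Tendsto (fun i => gauge K (z i)) l (𝓝 (gauge K z₀)) :=
    (hK.continuous_gauge.tendsto z₀).comp hz
  have hne : gauge K z₀ ≠ 1 := fun h1 =>
    hz₀ ((gauge_eq_one_iff_mem_frontier hK.convex hK.mem_nhds).1 h1)
  have hnn := gauge_nonneg (s := K) z₀
  rcases lt_or_gt_of_ne hne with h1 | h1
  · have hmem : z₀ ∈ K := hK.gauge_le_one_iff.1 h1.le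
    filter_upwards [h ((1 - gauge K z₀) / 2) (by linarith) (by linarith),
      hg.eventually (gt_mem_nhds (show gauge K z₀ < 1 - (1 - gauge K z₀) / 2 by linarith))]
      with i hi hgi
    exact iff_of_true (hi.1 _ hgi.le) hmem
  · have hmem : z₀ ∉ K := fun hm => by linarith [hK.gauge_le_one_iff.2 hm]
    obtain ⟨ε, he0, he⟩ := exists_between (show (0 : ℝ) < min (gauge K z₀ - 1) 1 by
      simp [h1])
    filter_upwards [h ε he0 (he.trans_le (min_le_right _ _)),
      hg.eventually (lt_mem_nhds (show 1 + ε < gauge K z₀ by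
        linarith [he.trans_le (min_le_left _ _)]))] with i hi hgi
    exact iff_of_false (fun hm => by linarith [hi.2 _ hm]) hmem

end BodyTendsto

lemma Vtilde_eq (A : Set (Eucl n)) (hA : MeasurableSet A) (y : Eucl n) :
    Vtilde q A y = 2 * Real.exp (-‖y‖ ^ 2 / 2) *
      ∫ w, A.indicator (fun z => Real.exp (-‖z‖ ^ 2 / 2)) (w + y) *
        (1 / ‖w‖ ^ ((n : ℝ) - q + 1)) := by
  rw [Vtilde, ← integral_indicator hA, ← integral_add_right_eq_self _ y]
  congr 2
  ext w
  by_cases h : w + y ∈ A <;> simp [h, div_eq_mul_inv]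

lemma norm_indicator_gauss_le (A : Set (Eucl n)) (z : Eucl n) :
    ‖A.indicator (fun z => Real.exp (-‖z‖ ^ 2 / 2)) z‖ ≤ 1 := by
  by_cases h : z ∈ A
  · simp only [h, Set.indicator_of_mem, Real.norm_eq_abs, Real.abs_exp, Real.exp_le_one_iff]
    nlinarith [sq_nonneg ‖z‖]
  · simp [h]

lemma norm_kernel_integrand_le {A : Set (Eucl n)} {R : ℝ} (hA : A ⊆ Metric.closedBall 0 R)
    {y : Eucl n} {r : ℝ} (hy : ‖y‖ ≤ r) (w : Eucl n) (α : ℝ) :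
    ‖A.indicator (fun z => Real.exp (-‖z‖ ^ 2 / 2)) (w + y) * (1 / ‖w‖ ^ α)‖ ≤
      (Metric.closedBall 0 (R + r)).indicator (fun w : Eucl n => 1 / ‖w‖ ^ α) w := by
  have hk : 0 ≤ 1 / ‖w‖ ^ α := by positivity
  by_cases hw : w ∈ Metric.closedBall (0 : Eucl n) (R + r)
  · rw [Set.indicator_of_mem hw, norm_mul, Real.norm_of_nonneg hk]
    exact mul_le_of_le_one_left hk (norm_indicator_gauss_le A _)
  · have : w + y ∉ A := fun hm => hw <| by
      have h1 := hA hm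
      rw [mem_closedBall_zero_iff] at *
      have h2 := norm_sub_le (w + y) y
      rw [add_sub_cancel_right] at h2
      linarith
    simp [this, hw]

lemma measurable_kernel_integrand {A : Set (Eucl n)} (hA : MeasurableSet A) (y : Eucl n) (α : ℝ) :
    Measurable fun w => A.indicator (fun z => Real.exp (-‖z‖ ^ 2 / 2)) (w + y) *
      (1 / ‖w‖ ^ α) := by
  have h : Measurable (A.indicator fun z : Eucl n => Real.exp (-‖z‖ ^ 2 / 2)) :=
    Measurable.indicator (by fun_prop) hA
  have h2 : Measurable fun w : Eucl n => A.indicator (fun z => Real.exp (-‖z‖ ^ 2 / 2)) (w + y) :=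
    h.comp (measurable_add_const y)
  exact h2.mul (by fun_prop)

lemma exponent_lt (hq : 1 < q) : (n : ℝ) - q + 1 < n := by linarith

lemma tendsto_Vtilde (hn : 0 < n) (hq : 1 < q) {ι : Type*} {l : Filter ι}
    [l.IsCountablyGenerated] {A : ι → Set (Eucl n)} (hA : ∀ i, MeasurableSet (A i))
    (hK : IsBody K) (h : BodyTendsto A l K) {y : ι → Eucl n} {y₀ : Eucl n}
    (hy : Tendsto y l (𝓝 y₀)) :
    Tendsto (fun i => Vtilde q (A i) (y i)) l (𝓝 (Vtilde q K y₀)) := by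
  obtain ⟨R, hR0, hR⟩ := hK.exists_radius
  have hnull : ∀ᵐ w : Eucl n, w + y₀ ∉ frontier K := by
    have h0 : volume ((fun w => w + y₀) ⁻¹' frontier K) = 0 := by
      rw [measure_preimage_add_right]
      exact hK.convex.addHaar_frontier volume
    exact measure_eq_zero_iff_ae_notMem.1 h0
  simp_rw [fun i => Vtilde_eq (q := q) (A i) (hA i) (y i),
    Vtilde_eq (q := q) K hK.measurableSet y₀]
  refine Tendsto.mul ?_ ?_
  · have hc : Continuous fun y : Eucl n => 2 * Real.exp (-‖y‖ ^ 2 / 2) := by fun_prop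
    exact (hc.tendsto y₀).comp hy
  refine tendsto_integral_filter_of_dominated_convergence
    ((Metric.closedBall 0 (2 * R + (‖y₀‖ + 1))).indicator
      (fun w : Eucl n => 1 / ‖w‖ ^ ((n : ℝ) - q + 1))) ?_ ?_ ?_ ?_
  · exact Eventually.of_forall fun i =>
      (measurable_kernel_integrand (hA i) (y i) _).aestronglyMeasurable
  · filter_upwards [h.eventually_subset hK hR0.le hR,
      hy.norm.eventually (gt_mem_nhds (lt_add_one ‖y₀‖))] with i hi hyi
    exact Eventually.of_forall fun w => norm_kernel_integrand_le hi hyi.le w _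
  · rw [integrable_indicator_iff measurableSet_closedBall]
    exact integrableOn_kernel hn (exponent_lt hq) _
  · filter_upwards [hnull] with w hw
    refine Tendsto.mul ?_ tendsto_const_nhds
    have hwy : Tendsto (fun i => w + y i) l (𝓝 (w + y₀)) := hy.const_add w
    have hind := h.tendsto_indicator hK hwy hw
    have hc : Continuous fun z : Eucl n => Real.exp (-‖z‖ ^ 2 / 2) := by fun_prop
    by_cases hm : w + y₀ ∈ K
    · rw [Set.indicator_of_mem hm]
      refine ((hc.tendsto _).comp hwy).congr' ?_
      filter_upwards [hind] with i hi
      simp [hi.2 hm]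
    · rw [Set.indicator_of_notMem hm]
      refine tendsto_const_nhds.congr' ?_
      filter_upwards [hind] with i hi
      exact (Set.indicator_of_notMem (fun h => hm (hi.1 h)) _).symm

lemma continuous_Vtilde (hn : 0 < n) (hq : 1 < q) (hK : IsBody K) :
    Continuous (Vtilde q K) :=
  continuous_iff_continuousAt.2 fun _ =>
    tendsto_Vtilde hn hq (fun _ => hK.measurableSet) hK (hK.bodyTendsto_const _) tendsto_id

lemma Vtilde_nonneg (A : Set (Eucl n)) (y : Eucl n) : 0 ≤ Vtilde q A y := by
  unfold Vtilde
  have : 0 ≤ ∫ z in A, Real.exp (-‖z‖ ^ 2 / 2) / ‖z - y‖ ^ ((n : ℝ) - q + 1) :=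
    integral_nonneg fun z => by positivity
  positivity

lemma integrable_kernel_integrand (hn : 0 < n) (hq : 1 < q) {A : Set (Eucl n)}
    (hA : MeasurableSet A) {R : ℝ} (hR : A ⊆ Metric.closedBall 0 R) (y : Eucl n) :
    Integrable fun w => A.indicator (fun z => Real.exp (-‖z‖ ^ 2 / 2)) (w + y) *
      (1 / ‖w‖ ^ ((n : ℝ) - q + 1)) := by
  refine Integrable.mono' (g := (Metric.closedBall 0 (R + ‖y‖)).indicator
      (fun w : Eucl n => 1 / ‖w‖ ^ ((n : ℝ) - q + 1))) ?_
    (measurable_kernel_integrand hA y _).aestronglyMeasurable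
    (Eventually.of_forall fun w => norm_kernel_integrand_le hR le_rfl w _)
  rw [integrable_indicator_iff measurableSet_closedBall]
  exact integrableOn_kernel hn (exponent_lt hq) _

lemma exists_Vtilde_le (hn : 0 < n) (hq : 1 < q) (R : ℝ) :
    ∃ C : ℝ, 0 < C ∧ ∀ A : Set (Eucl n), MeasurableSet A → A ⊆ Metric.closedBall 0 R →
      ∀ y ∈ Metric.closedBall (0 : Eucl n) R, Vtilde q A y ≤ C := by
  set I := ∫ w in Metric.closedBall (0 : Eucl n) (R + R), 1 / ‖w‖ ^ ((n : ℝ) - q + 1) with hI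
  have hI0 : 0 ≤ I := integral_nonneg fun w => by positivity
  refine ⟨2 * I + 1, by positivity, fun A hA hAR y hy => ?_⟩
  rw [mem_closedBall_zero_iff] at hy
  have h1 : ∫ w, A.indicator (fun z => Real.exp (-‖z‖ ^ 2 / 2)) (w + y) *
        (1 / ‖w‖ ^ ((n : ℝ) - q + 1)) ≤ I := by
    rw [hI, ← integral_indicator measurableSet_closedBall]
    refine integral_mono (integrable_kernel_integrand hn hq hA hAR y) ?_ fun w =>
      (le_abs_self _).trans (norm_kernel_integrand_le hAR hy w _)
    rw [integrable_indicator_iff measurableSet_closedBall]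
    exact integrableOn_kernel hn (exponent_lt hq) _
  have h0 : 0 ≤ ∫ w, A.indicator (fun z => Real.exp (-‖z‖ ^ 2 / 2)) (w + y) *
        (1 / ‖w‖ ^ ((n : ℝ) - q + 1)) := integral_nonneg fun w =>
    mul_nonneg (Set.indicator_nonneg (fun _ _ => (Real.exp_pos _).le) _) (by positivity)
  have he : Real.exp (-‖y‖ ^ 2 / 2) ≤ 1 := by
    rw [Real.exp_le_one_iff]; nlinarith [sq_nonneg ‖y‖]
  rw [Vtilde_eq A hA]
  have := mul_le_mul he h1 h0 zero_le_one
  linarith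

lemma IsBody.volume_pos (hK : IsBody K) : 0 < volume K :=
  (isOpen_interior.measure_pos volume ⟨0, hK.zero_mem⟩).trans_le (measure_mono interior_subset)

lemma Vtilde_pos (hn : 0 < n) (hq : 1 < q) (hK : IsBody K) (y : Eucl n) :
    0 < Vtilde q K y := by
  have : Nonempty (Fin n) := ⟨⟨0, hn⟩⟩
  obtain ⟨R, hR0, hR⟩ := hK.exists_radius
  rw [Vtilde_eq K hK.measurableSet]
  refine mul_pos (by positivity) ?_
  rw [integral_pos_iff_support_of_nonneg (fun w =>
    mul_nonneg (Set.indicator_nonneg (fun _ _ => (Real.exp_pos _).le) _) (by positivity))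
    (integrable_kernel_integrand hn hq hK.measurableSet hR y)]
  have hsub : ((fun w => w + y) ⁻¹' K) \ {0} ⊆ Function.support fun w =>
      K.indicator (fun z => Real.exp (-‖z‖ ^ 2 / 2)) (w + y) *
        (1 / ‖w‖ ^ ((n : ℝ) - q + 1)) := by
    rintro w ⟨hw, hw0⟩
    have hw : w + y ∈ K := hw
    have : 0 < ‖w‖ := norm_pos_iff.2 hw0
    simp only [Function.mem_support, hw, Set.indicator_of_mem]
    positivity
  refine lt_of_lt_of_le ?_ (measure_mono hsub)
  rw [measure_sdiff_null (measure_singleton _), measure_preimage_add_right]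
  exact hK.volume_pos

lemma measurable_Vtilde {A : Set (Eucl n)} : Measurable (Vtilde q A) := by
  unfold Vtilde
  refine Measurable.mul (by fun_prop) ?_
  have h : StronglyMeasurable (Function.uncurry fun y z : Eucl n =>
      Real.exp (-‖z‖ ^ 2 / 2) / ‖z - y‖ ^ ((n : ℝ) - q + 1)) := by
    refine Measurable.stronglyMeasurable ?_
    unfold Function.uncurry
    fun_prop
  exact (h.integral_prod_right (ν := volume.restrict A)).measurable

/-- Twice the Gaussian chord integral. -/
def chordEnergy (q : ℝ) (A : Set (Eucl n)) : ℝ := ∫ y in A, Vtilde q A y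

lemma integrableOn_Vtilde (hn : 0 < n) (hq : 1 < q) {A B : Set (Eucl n)} (hA : MeasurableSet A)
    (hB : MeasurableSet B) {R : ℝ} (hAR : A ⊆ Metric.closedBall 0 R)
    (hBR : B ⊆ Metric.closedBall 0 R) : IntegrableOn (Vtilde q A) B := by
  obtain ⟨C, _, hC⟩ := exists_Vtilde_le (q := q) hn hq R
  refine Measure.integrableOn_of_bounded (M := C)
    ((measure_mono hBR).trans_lt measure_closedBall_lt_top).ne
    measurable_Vtilde.aestronglyMeasurable ?_
  filter_upwards [ae_restrict_mem hB] with y hy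
  rw [Real.norm_of_nonneg (Vtilde_nonneg _ _)]
  exact hC A hA hAR y (hBR hy)

lemma tendsto_chordEnergy (hn : 0 < n) (hq : 1 < q) {ι : Type*} {l : Filter ι}
    [l.IsCountablyGenerated] {A : ι → Set (Eucl n)} (hA : ∀ i, MeasurableSet (A i))
    (hK : IsBody K) (h : BodyTendsto A l K) :
    Tendsto (fun i => chordEnergy q (A i)) l (𝓝 (chordEnergy q K)) := by
  obtain ⟨R, hR0, hR⟩ := hK.exists_radius
  obtain ⟨C, hC0, hC⟩ := exists_Vtilde_le (n := n) (q := q) hn hq (2 * R)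
  unfold chordEnergy
  simp_rw [fun i => (integral_indicator (f := Vtilde q (A i)) (μ := volume) (hA i)).symm,
    (integral_indicator (f := Vtilde q K) (μ := volume) hK.measurableSet).symm]
  refine tendsto_integral_filter_of_dominated_convergence
    ((Metric.closedBall (0 : Eucl n) (2 * R)).indicator fun _ => C) ?_ ?_ ?_ ?_
  · exact Eventually.of_forall fun i => (measurable_Vtilde.indicator (hA i)).aestronglyMeasurable
  · filter_upwards [h.eventually_subset hK hR0.le hR] with i hi
    refine Eventually.of_forall fun y => ?_
    by_cases hy : y ∈ A i
    · rw [Set.indicator_of_mem hy, Set.indicator_of_mem (hi hy),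
        Real.norm_of_nonneg (Vtilde_nonneg _ _)]
      exact hC _ (hA i) hi y (hi hy)
    · rw [Set.indicator_of_notMem hy, norm_zero]
      exact Set.indicator_nonneg (fun _ _ => hC0.le) _
  · rw [integrable_indicator_iff measurableSet_closedBall]
    exact integrableOn_const measure_closedBall_lt_top.ne
  · filter_upwards [measure_eq_zero_iff_ae_notMem.1 (hK.convex.addHaar_frontier volume)] with y hy
    have hind := h.tendsto_indicator hK (tendsto_const_nhds (x := y)) hy
    by_cases hm : y ∈ K
    · rw [Set.indicator_of_mem hm]
      refine (tendsto_Vtilde hn hq hA hK h (tendsto_const_nhds (x := y))).congr' ?_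
      filter_upwards [hind] with i hi
      simp [hi.2 hm]
    · rw [Set.indicator_of_notMem hm]
      refine tendsto_const_nhds.congr' ?_
      filter_upwards [hind] with i hi
      exact (Set.indicator_of_notMem (fun h => hm (hi.1 h)) _).symm

end

section

variable {n : ℕ} {K : Set (Eucl n)} {q : ℝ}

/-- The surface measure of the unit sphere. -/
abbrev sphMeas (n : ℕ) : Measure (Metric.sphere (0 : Eucl n) 1) :=
  (volume : Measure (Eucl n)).toSphere

lemma integrableOn_kernel_gauss (hn : 0 < n) (hq : 1 < q) {A : Set (Eucl n)}
    (hA : MeasurableSet A) {R : ℝ} (hR : A ⊆ Metric.closedBall 0 R) (y : Eucl n) :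
    IntegrableOn (fun z => Real.exp (-‖z‖ ^ 2 / 2) / ‖z - y‖ ^ ((n : ℝ) - q + 1)) A := by
  rw [← integrable_indicator_iff hA]
  refine ((integrable_kernel_integrand hn hq hA hR y).comp_sub_right y).congr
    (Eventually.of_forall fun z => ?_)
  by_cases h : z ∈ A <;> simp [h, div_eq_mul_inv]

lemma setIntegral_Vtilde_comm (hn : 0 < n) (hq : 1 < q) {A B : Set (Eucl n)}
    (hA : MeasurableSet A) (hB : MeasurableSet B) {R : ℝ} (hAR : A ⊆ Metric.closedBall 0 R)
    (hBR : B ⊆ Metric.closedBall 0 R) : ∫ y in A, Vtilde q B y = ∫ y in B, Vtilde q A y := by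
  set F : Eucl n → Eucl n → ℝ := fun y z => 2 * Real.exp (-‖y‖ ^ 2 / 2) *
    (Real.exp (-‖z‖ ^ 2 / 2) / ‖z - y‖ ^ ((n : ℝ) - q + 1)) with hF
  have hV : ∀ (C : Set (Eucl n)) y, Vtilde q C y = ∫ z in C, F y z := fun C y => by
    rw [Vtilde, hF, integral_const_mul]
  have hsymm : ∀ y z, F y z = F z y := fun y z => by
    simp only [hF, norm_sub_rev z y]; ring
  simp_rw [hV]
  rw [integral_integral_swap]
  · simp_rw [hsymm]
  · have hm : Measurable (Function.uncurry F) := by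
      unfold Function.uncurry
      fun_prop
    rw [integrable_prod_iff hm.aestronglyMeasurable]
    refine ⟨Eventually.of_forall fun y =>
      (integrableOn_kernel_gauss hn hq hB hBR y).const_mul (2 * Real.exp (-‖y‖ ^ 2 / 2)), ?_⟩
    refine (integrableOn_Vtilde hn hq hB hA hBR hAR).congr (Eventually.of_forall fun y => ?_)
    simp only [hV]
    refine integral_congr_ae (Eventually.of_forall fun z => ?_)
    exact (Real.norm_of_nonneg (by simp only [hF]; positivity)).symm

lemma chordEnergy_sub (hn : 0 < n) (hq : 1 < q) {A B : Set (Eucl n)}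
    (hA : MeasurableSet A) (hB : MeasurableSet B) {R : ℝ} (hAR : A ⊆ Metric.closedBall 0 R)
    (hBR : B ⊆ Metric.closedBall 0 R) :
    chordEnergy q A - chordEnergy q B =
      (∫ y in A, (Vtilde q A y + Vtilde q B y)) - ∫ y in B, (Vtilde q A y + Vtilde q B y) := by
  rw [integral_add (integrableOn_Vtilde hn hq hA hA hAR hAR)
      (integrableOn_Vtilde hn hq hB hA hBR hAR),
    integral_add (integrableOn_Vtilde hn hq hA hB hAR hBR)
      (integrableOn_Vtilde hn hq hB hB hBR hBR),
    setIntegral_Vtilde_comm hn hq hA hB hAR hBR, chordEnergy, chordEnergy]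
  ring

lemma chordEnergy_mono (hn : 0 < n) (hq : 1 < q) {A B : Set (Eucl n)}
    (hA : MeasurableSet A) (hB : MeasurableSet B) {R : ℝ} (hBR : B ⊆ Metric.closedBall 0 R)
    (hAB : A ⊆ B) : chordEnergy q A ≤ chordEnergy q B := by
  have hi := (integrableOn_Vtilde hn hq hA hB (hAB.trans hBR) hBR).add
    (integrableOn_Vtilde hn hq hB hB hBR hBR)
  have h := chordEnergy_sub hn hq hA hB (hAB.trans hBR) hBR
  have h2 : (∫ y in A, (Vtilde q A y + Vtilde q B y)) ≤ ∫ y in B, (Vtilde q A y + Vtilde q B y) :=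
    setIntegral_mono_set hi (Eventually.of_forall fun y =>
      add_nonneg (Vtilde_nonneg _ _) (Vtilde_nonneg _ _)) (Eventually.of_forall hAB)
  linarith

lemma integral_eq_integral_sphere (hn : 0 < n) {g : Eucl n → ℝ} (hg : Integrable g) :
    ∫ z, g z = ∫ ξ, (∫ r in Set.Ioi (0 : ℝ), r ^ (n - 1) * g (r • (ξ : Eucl n))) ∂(sphMeas n) := by
  have : Nonempty (Fin n) := ⟨⟨0, hn⟩⟩
  have mp := (volume : Measure (Eucl n)).measurePreserving_homeomorphUnitSphereProd
  set Ψ : Metric.sphere (0 : Eucl n) 1 × Set.Ioi (0 : ℝ) → ℝ :=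
    fun p => g ((p.2 : ℝ) • (p.1 : Eucl n)) with hΨ
  have hcomp : ∀ x : ({(0 : Eucl n)}ᶜ : Set (Eucl n)),
      Ψ (homeomorphUnitSphereProd (Eucl n) x) = g x := fun x => by
    have hx : ‖(x : Eucl n)‖ ≠ 0 := norm_ne_zero_iff.2 x.2
    simp [hΨ, smul_smul, hx]
  have hI : Integrable Ψ ((sphMeas n).prod (.volumeIoiPow (Module.finrank ℝ (Eucl n) - 1))) := by
    rw [← mp.integrable_comp_emb (Homeomorph.measurableEmbedding _)]
    have h1 : IntegrableOn g {(0 : Eucl n)}ᶜ := hg.integrableOn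
    rw [integrableOn_iff_comap_subtypeVal (measurableSet_singleton _).compl] at h1
    exact h1.congr (Eventually.of_forall fun x => (hcomp x).symm)
  calc ∫ z, g z = ∫ x : ({(0 : Eucl n)}ᶜ : Set (Eucl n)), g x ∂(Measure.comap Subtype.val volume) := by
        rw [integral_subtype_comap (measurableSet_singleton _).compl g,
          restrict_compl_singleton]
    _ = ∫ p, Ψ p ∂((sphMeas n).prod (.volumeIoiPow (Module.finrank ℝ (Eucl n) - 1))) := by
        rw [← mp.integral_comp (Homeomorph.measurableEmbedding _)]
        exact integral_congr_ae (Eventually.of_forall fun x => (hcomp x).symm)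
    _ = ∫ ξ, (∫ r, Ψ (ξ, r) ∂(Measure.volumeIoiPow (Module.finrank ℝ (Eucl n) - 1))) ∂(sphMeas n) :=
        integral_prod _ hI
    _ = _ := by
        refine integral_congr_ae (Eventually.of_forall fun ξ => ?_)
        simp only [Measure.volumeIoiPow, ENNReal.ofReal, finrank_euclideanSpace, Fintype.card_fin]
        rw [integral_withDensity_eq_integral_smul,
          integral_subtype_comap measurableSet_Ioi
            fun a : ℝ => Real.toNNReal (a ^ (n - 1)) • g (a • (ξ : Eucl n)),
          setIntegral_congr_fun measurableSet_Ioi fun x hx => ?_]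
        · rw [NNReal.smul_def, Real.coe_toNNReal _ (pow_nonneg hx.out.le _), smul_eq_mul]
        · exact (measurable_subtype_coe.pow_const _).real_toNNReal

lemma setIntegral_eq_integral_sphere (hn : 0 < n) {A : Set (Eucl n)} (hA : MeasurableSet A)
    {ρ : Eucl n → ℝ}
    (hρ : ∀ ξ ∈ Metric.sphere (0 : Eucl n) 1, 0 ≤ ρ ξ ∧ ∀ r : ℝ, 0 < r → (r • ξ ∈ A ↔ r ≤ ρ ξ))
    {g : Eucl n → ℝ} (hg : IntegrableOn g A) :
    ∫ z in A, g z = ∫ ξ, (∫ r in (0 : ℝ)..ρ (ξ : Eucl n),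
      r ^ (n - 1) * g (r • (ξ : Eucl n))) ∂(sphMeas n) := by
  rw [← integral_indicator hA, integral_eq_integral_sphere hn ((integrable_indicator_iff hA).2 hg)]
  refine integral_congr_ae (Eventually.of_forall fun ξ => ?_)
  obtain ⟨h0, h1⟩ := hρ ξ ξ.2
  simp only
  rw [intervalIntegral.integral_of_le h0,
    show Set.Ioc 0 (ρ (ξ : Eucl n)) = Set.Ioi 0 ∩ Set.Iic (ρ (ξ : Eucl n)) from rfl,
    ← setIntegral_indicator measurableSet_Iic]
  refine setIntegral_congr_fun measurableSet_Ioi fun r hr => ?_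
  by_cases hrA : r • (ξ : Eucl n) ∈ A
  · simp [hrA, (h1 r hr).1 hrA]
  · have : ¬ r ≤ ρ (ξ : Eucl n) := fun h => hrA ((h1 r hr).2 h)
    simp [hrA, this]

/-- The star-shaped perturbation of the body `K` with radial factor `1 + δ u`. -/
def starPert (K : Set (Eucl n)) (u : Eucl n → ℝ) (δ : ℝ) : Set (Eucl n) :=
  {z | gauge K z ≤ 1 + δ * u z}

section StarPert

variable {u : Eucl n → ℝ} {M : ℝ}

lemma measurableSet_starPert (hK : IsBody K) (hu : Measurable u) (δ : ℝ) :
    MeasurableSet (starPert K u δ) :=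
  measurableSet_le hK.continuous_gauge.measurable (by fun_prop)

lemma starPert_radial (hK : IsBody K) (hhom : ∀ c : ℝ, 0 < c → ∀ z, u (c • z) = u z) {δ : ℝ}
    (hδ : ∀ z, 0 ≤ 1 + δ * u z) {ξ : Eucl n} (hξ : ξ ∈ Metric.sphere (0 : Eucl n) 1) :
    0 ≤ (gauge K ξ)⁻¹ * (1 + δ * u ξ) ∧
      ∀ r : ℝ, 0 < r → (r • ξ ∈ starPert K u δ ↔ r ≤ (gauge K ξ)⁻¹ * (1 + δ * u ξ)) := by
  have hg := hK.gauge_pos (sphere_ne_zero hξ)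
  refine ⟨mul_nonneg (by positivity) (hδ ξ), fun r hr => ?_⟩
  rw [starPert, Set.mem_ofPred_eq, hK.gauge_smul hr.le, hhom r hr, le_inv_mul_iff₀ hg, mul_comm]

lemma eventually_abs_mul_le (M : ℝ) {ε : ℝ} (hε : 0 < ε) (hM : ∀ z, |u z| ≤ M) :
    ∀ᶠ δ : ℝ in 𝓝[>] 0, ∀ z, |δ * u z| ≤ ε := by
  have hM0 : 0 ≤ M := (abs_nonneg _).trans (hM 0)
  filter_upwards [Ioo_mem_nhdsGT (show (0 : ℝ) < ε / (M + 1) by positivity)] with δ hδ z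
  rw [abs_mul, abs_of_pos hδ.1]
  have h1 := (lt_div_iff₀ (by positivity)).1 hδ.2
  have := mul_le_mul_of_nonneg_left (hM z) hδ.1.le
  nlinarith [hδ.1]

lemma bodyTendsto_starPert (hM : ∀ z, |u z| ≤ M) :
    BodyTendsto (starPert K u) (𝓝[>] 0) K := fun ε h0 _ => by
  filter_upwards [eventually_abs_mul_le M h0 hM] with δ hδ
  refine ⟨fun z hz => ?_, fun z hz => ?_⟩
  · exact hz.trans (by have := (abs_le.1 (hδ z)).1; linarith)
  · exact le_trans hz (by have := (abs_le.1 (hδ z)).2; linarith)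

lemma intervalIntegrable_of_bounded {g : ℝ → ℝ} (hg : Measurable g) {a b C : ℝ}
    (h : ∀ x ∈ Set.uIoc a b, ‖g x‖ ≤ C) : IntervalIntegrable g volume a b := by
  rw [intervalIntegrable_iff]
  refine Measure.integrableOn_of_bounded (M := C) ?_ hg.aestronglyMeasurable ?_
  · rw [Set.uIoc]; exact measure_Ioc_lt_top.ne
  · filter_upwards [ae_restrict_mem measurableSet_uIoc] with x hx using h x hx

/-- The integrand of the difference quotient of the chord energy along a star-shaped
perturbation. -/
def pertIntegrand (q : ℝ) (K : Set (Eucl n)) (u : Eucl n → ℝ) (δ : ℝ) (ξ : Eucl n) (s : ℝ) : ℝ :=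
  (gauge K ξ)⁻¹ * u ξ * (((gauge K ξ)⁻¹ * (1 + δ * u ξ * s)) ^ (n - 1) *
    (Vtilde q (starPert K u δ) (((gauge K ξ)⁻¹ * (1 + δ * u ξ * s)) • ξ) +
      Vtilde q K (((gauge K ξ)⁻¹ * (1 + δ * u ξ * s)) • ξ)))

lemma measurable_pertIntegrand (hK : IsBody K) (hu : Measurable u) (δ : ℝ) {α : Type*}
    [MeasurableSpace α] {ξ : α → Eucl n} {s : α → ℝ} (hξ : Measurable ξ) (hs : Measurable s) :
    Measurable fun x => pertIntegrand q K u δ (ξ x) (s x) := by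
  have h1 := hK.continuous_gauge.measurable
  have h2 := measurable_Vtilde (q := q) (A := starPert K u δ)
  have h3 := measurable_Vtilde (q := q) (A := K)
  unfold pertIntegrand
  fun_prop

lemma chordEnergy_starPert_sub (hn : 0 < n) (hq : 1 < q) (hK : IsBody K) (hu : Measurable u)
    (hhom : ∀ c : ℝ, 0 < c → ∀ z, u (c • z) = u z) {R : ℝ} (hR0 : 0 < R)
    (hR : K ⊆ Metric.closedBall 0 R) {δ : ℝ} (hδ : ∀ z, |δ * u z| ≤ 1) :
    chordEnergy q (starPert K u δ) - chordEnergy q K =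
      δ * ∫ ξ, (∫ s in (0 : ℝ)..1, pertIntegrand q K u δ ξ s) ∂(sphMeas n) := by
  have hA := measurableSet_starPert hK hu δ
  have hsub : starPert K u δ ⊆ Metric.closedBall 0 (2 * R) := fun z hz => by
    have h1 := hK.norm_le_mul_gauge hR z
    have h2 : gauge K z ≤ 1 + δ * u z := hz
    have h3 := (abs_le.1 (hδ z)).2
    rw [mem_closedBall_zero_iff]
    nlinarith
  have hKR : K ⊆ Metric.closedBall 0 (2 * R) :=
    hR.trans (Metric.closedBall_subset_closedBall (by linarith))
  obtain ⟨C, hC0, hC⟩ := exists_Vtilde_le (n := n) (q := q) hn hq (2 * R)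
  rw [chordEnergy_sub hn hq hA hK.measurableSet hsub hKR]
  set F : Eucl n → ℝ := fun y => Vtilde q (starPert K u δ) y + Vtilde q K y with hF
  have hFm : Measurable F := measurable_Vtilde.add measurable_Vtilde
  have hFb : ∀ y ∈ Metric.closedBall (0 : Eucl n) (2 * R), ‖F y‖ ≤ C + C := fun y hy => by
    rw [Real.norm_of_nonneg (add_nonneg (Vtilde_nonneg _ _) (Vtilde_nonneg _ _))]
    exact add_le_add (hC _ hA hsub y hy) (hC _ hK.measurableSet hKR y hy)
  have hint : ∀ B : Set (Eucl n), MeasurableSet B → B ⊆ Metric.closedBall 0 (2 * R) →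
      IntegrableOn F B := fun B hB hBR =>
    (integrableOn_Vtilde hn hq hA hB hsub hBR).add
      (integrableOn_Vtilde hn hq hK.measurableSet hB hKR hBR)
  have hρ1 : ∀ ξ ∈ Metric.sphere (0 : Eucl n) 1, _ := fun ξ hξ =>
    starPert_radial (u := u) (δ := δ) hK hhom
      (fun z => by linarith [(abs_le.1 (hδ z)).1]) hξ
  have hρ0 : ∀ ξ ∈ Metric.sphere (0 : Eucl n) 1, 0 ≤ (gauge K ξ)⁻¹ ∧
      ∀ r : ℝ, 0 < r → (r • ξ ∈ K ↔ r ≤ (gauge K ξ)⁻¹) := fun ξ hξ => by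
    have hg := hK.gauge_pos (sphere_ne_zero hξ)
    refine ⟨by positivity, fun r hr => ?_⟩
    rw [← hK.gauge_le_one_iff, hK.gauge_smul hr.le, ← le_div_iff₀ hg, one_div]
  have hgm : ∀ ξ : Eucl n, Measurable fun r : ℝ => r ^ (n - 1) * F (r • ξ) := fun ξ => by
    fun_prop
  have hρle : ∀ ξ ∈ Metric.sphere (0 : Eucl n) 1, (gauge K ξ)⁻¹ ≤ R := fun ξ hξ => by
    rw [← hK.radFun_eq (sphere_ne_zero hξ)]
    exact hK.radFun_le hR hξ
  have hii : ∀ ξ ∈ Metric.sphere (0 : Eucl n) 1, ∀ a b : ℝ, 0 ≤ a → 0 ≤ b → a ≤ 2 * R →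
      b ≤ 2 * R → IntervalIntegrable (fun r : ℝ => r ^ (n - 1) * F (r • ξ)) volume a b := by
    intro ξ hξ a b ha hb haR hbR
    refine intervalIntegrable_of_bounded (C := (2 * R) ^ (n - 1) * (C + C)) (hgm ξ) fun r hr => ?_
    have hr0 : 0 ≤ r := (le_min ha hb).trans hr.1.le
    have hr1 : r ≤ 2 * R := hr.2.trans (max_le haR hbR)
    rw [norm_mul, norm_pow, Real.norm_of_nonneg hr0]
    refine mul_le_mul (pow_le_pow_left₀ hr0 hr1 _) (hFb _ ?_) (norm_nonneg _) (by positivity)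
    rw [mem_closedBall_zero_iff, norm_smul, mem_sphere_zero_iff_norm.1 hξ, mul_one,
      Real.norm_of_nonneg hr0]
    exact hr1
  have hbnd : ∀ ξ ∈ Metric.sphere (0 : Eucl n) 1, ∀ s : ℝ, |s| ≤ 1 →
      0 ≤ (gauge K ξ)⁻¹ * (1 + δ * u ξ * s) ∧ (gauge K ξ)⁻¹ * (1 + δ * u ξ * s) ≤ 2 * R := by
    intro ξ hξ s hs
    have h0 := (hρ0 ξ hξ).1
    have h1 : |δ * u ξ * s| ≤ 1 := by
      rw [abs_mul]; exact mul_le_one₀ (hδ ξ) (abs_nonneg _) hs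
    obtain ⟨h2, h3⟩ := abs_le.1 h1
    refine ⟨mul_nonneg h0 (by linarith), ?_⟩
    have := mul_le_mul (hρle ξ hξ) (show 1 + δ * u ξ * s ≤ 2 by linarith) (by linarith) hR0.le
    linarith
  have hoi : ∀ (ρ : Eucl n → ℝ) (B : Set (Eucl n)), MeasurableSet B →
      B ⊆ Metric.closedBall 0 (2 * R) → Measurable ρ →
      (∀ ξ ∈ Metric.sphere (0 : Eucl n) 1, 0 ≤ ρ ξ ∧ ρ ξ ≤ 2 * R) →
      Integrable (fun ξ : Metric.sphere (0 : Eucl n) 1 =>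
        ∫ r in (0 : ℝ)..ρ ξ, r ^ (n - 1) * F (r • (ξ : Eucl n))) (sphMeas n) := by
    intro ρ B _ _ hρm hρ
    have hm : StronglyMeasurable fun ξ : Metric.sphere (0 : Eucl n) 1 =>
        ∫ r in (0 : ℝ)..ρ ξ, r ^ (n - 1) * F (r • (ξ : Eucl n)) := by
      have hmeas : Measurable (Function.uncurry fun (ξ : Metric.sphere (0 : Eucl n) 1) (r : ℝ) =>
          (Set.Ioc 0 (ρ ξ)).indicator (fun r => r ^ (n - 1) * F (r • (ξ : Eucl n))) r) := by
        have : (Function.uncurry fun (ξ : Metric.sphere (0 : Eucl n) 1) (r : ℝ) =>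
          (Set.Ioc 0 (ρ ξ)).indicator (fun r => r ^ (n - 1) * F (r • (ξ : Eucl n))) r) =
          {p : Metric.sphere (0 : Eucl n) 1 × ℝ | 0 < p.2 ∧ p.2 ≤ ρ p.1}.indicator
            fun p => p.2 ^ (n - 1) * F (p.2 • (p.1 : Eucl n)) := by
          ext ⟨ξ, r⟩
          simp [Set.indicator_apply, Function.uncurry]
        rw [this]
        refine Measurable.indicator (by fun_prop) ?_
        exact (measurableSet_lt measurable_const measurable_snd).inter
          (measurableSet_le measurable_snd (by fun_prop))
      have := hmeas.stronglyMeasurable.integral_prod_right (ν := (volume : Measure ℝ))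
      convert this using 1
      ext ξ
      rw [intervalIntegral.integral_of_le (hρ ξ ξ.2).1, integral_indicator measurableSet_Ioc]
    refine Integrable.mono' (g := fun _ => (2 * R) ^ (n - 1) * (C + C) * (2 * R))
      (integrable_const _) hm.aestronglyMeasurable (Eventually.of_forall fun ξ => ?_)
    obtain ⟨h0, h1⟩ := hρ ξ ξ.2
    refine (intervalIntegral.norm_integral_le_of_norm_le_const
      (C := (2 * R) ^ (n - 1) * (C + C)) fun r hr => ?_).trans ?_
    · rw [Set.uIoc_of_le h0] at hr
      rw [norm_mul, norm_pow, Real.norm_of_nonneg hr.1.le]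
      refine mul_le_mul (pow_le_pow_left₀ hr.1.le (hr.2.trans h1) _) (hFb _ ?_) (norm_nonneg _)
        (by positivity)
      rw [mem_closedBall_zero_iff, norm_smul, mem_sphere_zero_iff_norm.1 ξ.2, mul_one,
        Real.norm_of_nonneg hr.1.le]
      exact hr.2.trans h1
    · rw [sub_zero, abs_of_nonneg h0]
      exact mul_le_mul_of_nonneg_left h1 (by positivity)
  have hgm0 := hK.continuous_gauge.measurable
  rw [setIntegral_eq_integral_sphere hn hA hρ1 (hint _ hA hsub),
    setIntegral_eq_integral_sphere hn hK.measurableSet hρ0 (hint _ hK.measurableSet hKR),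
    ← integral_sub
      (hoi (fun ξ => (gauge K ξ)⁻¹ * (1 + δ * u ξ)) _ hA hsub (by fun_prop) fun ξ hξ => by
        simpa using hbnd ξ hξ 1 (by simp))
      (hoi (fun ξ => (gauge K ξ)⁻¹) _ hA hsub (by fun_prop) fun ξ hξ => by
        simpa using hbnd ξ hξ 0 (by simp)),
    ← integral_const_mul]
  refine integral_congr_ae (Eventually.of_forall fun ξ => ?_)
  have hb1 : 0 ≤ (gauge K (ξ : Eucl n))⁻¹ * (1 + δ * u ξ) ∧
      (gauge K (ξ : Eucl n))⁻¹ * (1 + δ * u ξ) ≤ 2 * R := by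
    simpa using hbnd ξ ξ.2 1 (by simp)
  have hb0 : 0 ≤ (gauge K (ξ : Eucl n))⁻¹ ∧ (gauge K (ξ : Eucl n))⁻¹ ≤ 2 * R := by
    simpa using hbnd ξ ξ.2 0 (by simp)
  simp only
  rw [intervalIntegral.integral_interval_sub_left
    (hii ξ ξ.2 _ _ le_rfl hb1.1 (by positivity) hb1.2)
    (hii ξ ξ.2 _ _ le_rfl hb0.1 (by positivity) hb0.2)]
  have hsubst := intervalIntegral.mul_integral_comp_mul_add (a := 0) (b := 1)
    (f := fun r : ℝ => r ^ (n - 1) * F (r • (ξ : Eucl n))) ((gauge K (ξ : Eucl n))⁻¹ * (δ * u ξ))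
    ((gauge K (ξ : Eucl n))⁻¹)
  simp only [mul_zero, zero_add, mul_one] at hsubst
  rw [show (gauge K (ξ : Eucl n))⁻¹ * (1 + δ * u ξ) =
    (gauge K (ξ : Eucl n))⁻¹ * (δ * u ξ) + (gauge K (ξ : Eucl n))⁻¹ by ring, ← hsubst]
  simp only [pertIntegrand]
  rw [intervalIntegral.integral_const_mul, ← mul_assoc δ,
    show δ * ((gauge K (ξ : Eucl n))⁻¹ * u ξ) = (gauge K (ξ : Eucl n))⁻¹ * (δ * u ξ) by ring]
  congr 1
  refine intervalIntegral.integral_congr fun s _ => ?_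
  simp only [hF]
  rw [show (gauge K (ξ : Eucl n))⁻¹ * (1 + δ * u ξ * s) =
    (gauge K (ξ : Eucl n))⁻¹ * (δ * u ξ) * s + (gauge K (ξ : Eucl n))⁻¹ by ring]

lemma exists_norm_pertIntegrand_le (hn : 0 < n) (hq : 1 < q) (hK : IsBody K)
    (hu : Measurable u) (hM : ∀ z, |u z| ≤ M) :
    ∃ B : ℝ, ∀ᶠ δ : ℝ in 𝓝[>] 0, ∀ ξ ∈ Metric.sphere (0 : Eucl n) 1, ∀ s ∈ Set.uIoc (0 : ℝ) 1,
      ‖pertIntegrand q K u δ ξ s‖ ≤ B := by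
  obtain ⟨R, hR0, hR⟩ := hK.exists_radius
  have hM0 : 0 ≤ M := (abs_nonneg _).trans (hM 0)
  obtain ⟨C, hC0, hC⟩ := exists_Vtilde_le (n := n) (q := q) hn hq (2 * R)
  have hKR : K ⊆ Metric.closedBall 0 (2 * R) :=
    hR.trans (Metric.closedBall_subset_closedBall (by linarith))
  have hρle : ∀ ξ ∈ Metric.sphere (0 : Eucl n) 1, 0 ≤ (gauge K ξ)⁻¹ ∧ (gauge K ξ)⁻¹ ≤ R :=
    fun ξ hξ => by
      have hg := hK.gauge_pos (sphere_ne_zero hξ)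
      refine ⟨by positivity, ?_⟩
      rw [← hK.radFun_eq (sphere_ne_zero hξ)]
      exact hK.radFun_le hR hξ
  have h1 : ∀ᶠ δ : ℝ in 𝓝[>] 0, ∀ z, |δ * u z| ≤ 1 := eventually_abs_mul_le M one_pos hM
  have hsub : ∀ᶠ δ : ℝ in 𝓝[>] 0, starPert K u δ ⊆ Metric.closedBall 0 (2 * R) :=
    (bodyTendsto_starPert (K := K) hM).eventually_subset hK hR0.le hR
  refine ⟨R * M * ((2 * R) ^ (n - 1) * (C + C)), ?_⟩
  filter_upwards [h1, hsub] with δ hδ hs ξ hξ s hs1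
  rw [Set.uIoc_of_le zero_le_one] at hs1
  obtain ⟨h0, hR1⟩ := hρle ξ hξ
  have h3 : |δ * u ξ * s| ≤ 1 := by
    rw [abs_mul, abs_of_pos hs1.1]; exact mul_le_one₀ (hδ ξ) hs1.1.le hs1.2
  obtain ⟨h4, h5⟩ := abs_le.1 h3
  have h6 : 0 ≤ (gauge K ξ)⁻¹ * (1 + δ * u ξ * s) := mul_nonneg h0 (by linarith)
  have h7 : (gauge K ξ)⁻¹ * (1 + δ * u ξ * s) ≤ 2 * R := by
    have := mul_le_mul hR1 (show 1 + δ * u ξ * s ≤ 2 by linarith) (by linarith) hR0.le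
    linarith
  have h8 : ((gauge K ξ)⁻¹ * (1 + δ * u ξ * s)) • ξ ∈ Metric.closedBall (0 : Eucl n) (2 * R) := by
    rw [mem_closedBall_zero_iff, norm_smul, mem_sphere_zero_iff_norm.1 hξ, mul_one,
      Real.norm_of_nonneg h6]
    exact h7
  rw [pertIntegrand, norm_mul, norm_mul, norm_mul, norm_pow, Real.norm_of_nonneg h0,
    Real.norm_of_nonneg h6,
    Real.norm_of_nonneg (add_nonneg (Vtilde_nonneg (q := q) _ _) (Vtilde_nonneg _ _))]
  refine mul_le_mul (mul_le_mul hR1 (hM ξ) (norm_nonneg _) hR0.le)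
    (mul_le_mul (pow_le_pow_left₀ h6 h7 _) (add_le_add
      (hC _ (measurableSet_starPert hK hu δ) hs _ h8) (hC _ hK.measurableSet hKR _ h8))
      (add_nonneg (Vtilde_nonneg _ _) (Vtilde_nonneg _ _)) (by positivity))
    (mul_nonneg (pow_nonneg h6 _) (add_nonneg (Vtilde_nonneg _ _) (Vtilde_nonneg _ _)))
    (by positivity)

lemma tendsto_pertIntegrand (hn : 0 < n) (hq : 1 < q) (hK : IsBody K)
    (hu : Measurable u) (hM : ∀ z, |u z| ≤ M) {ξ : Eucl n} (hξ : ξ ≠ 0) (s : ℝ) :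
    Tendsto (fun δ => pertIntegrand q K u δ ξ s) (𝓝[>] 0)
      (𝓝 (2 * (radFun K ξ ^ n * u ξ * Vtilde q K (radFun K ξ • ξ)))) := by
  rw [hK.radFun_eq hξ]
  have h1 : Tendsto (fun δ : ℝ => (gauge K ξ)⁻¹ * (1 + δ * u ξ * s)) (𝓝[>] 0)
      (𝓝 (gauge K ξ)⁻¹) := by
    have : Tendsto (fun δ : ℝ => (gauge K ξ)⁻¹ * (1 + δ * u ξ * s)) (𝓝 0)
        (𝓝 ((gauge K ξ)⁻¹ * (1 + 0 * u ξ * s))) :=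
      Continuous.tendsto (by fun_prop) 0
    simpa using this.mono_left nhdsWithin_le_nhds
  have h2 := h1.smul_const ξ
  have h3 := tendsto_Vtilde hn hq (fun δ => measurableSet_starPert hK hu δ) hK
    (bodyTendsto_starPert hM) h2
  have h4 := ((continuous_Vtilde hn hq hK).tendsto _).comp h2
  have h5 := ((h1.pow (n - 1)).mul (h3.add h4)).const_mul ((gauge K ξ)⁻¹ * u ξ)
  have h6 : 2 * ((gauge K ξ)⁻¹ ^ n * u ξ * Vtilde q K ((gauge K ξ)⁻¹ • ξ)) =
      (gauge K ξ)⁻¹ * u ξ * ((gauge K ξ)⁻¹ ^ (n - 1) *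
        (Vtilde q K ((gauge K ξ)⁻¹ • ξ) + Vtilde q K ((gauge K ξ)⁻¹ • ξ))) := by
    obtain ⟨m, rfl⟩ : ∃ m, n = m + 1 := ⟨n - 1, by omega⟩
    simp only [Nat.add_sub_cancel, pow_succ]
    ring
  rw [h6]
  exact h5

lemma tendsto_slope_chordEnergy_starPert (hn : 0 < n) (hq : 1 < q) (hK : IsBody K)
    (hu : Measurable u) (hhom : ∀ c : ℝ, 0 < c → ∀ z, u (c • z) = u z) (hM : ∀ z, |u z| ≤ M) :
    Tendsto (fun δ => (chordEnergy q (starPert K u δ) - chordEnergy q K) / δ) (𝓝[>] 0)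
      (𝓝 (∫ ξ, 2 * (radFun K (ξ : Eucl n) ^ n * u ξ * Vtilde q K (radFun K (ξ : Eucl n) • (ξ : Eucl n)))
        ∂(sphMeas n))) := by
  obtain ⟨B, hbound⟩ := exists_norm_pertIntegrand_le (u := u) hn hq hK hu hM
  have h1 : ∀ᶠ δ : ℝ in 𝓝[>] 0, ∀ z, |δ * u z| ≤ 1 := eventually_abs_mul_le M one_pos hM
  obtain ⟨R, hR0, hR⟩ := hK.exists_radius
  have hev : (fun δ => ∫ ξ, (∫ s in (0 : ℝ)..1, pertIntegrand q K u δ ξ s) ∂(sphMeas n))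
      =ᶠ[𝓝[>] 0] fun δ => (chordEnergy q (starPert K u δ) - chordEnergy q K) / δ := by
    filter_upwards [h1, self_mem_nhdsWithin] with δ hδ hδ0
    rw [chordEnergy_starPert_sub hn hq hK hu hhom hR0 hR hδ, mul_div_cancel_left₀ _ (ne_of_gt hδ0)]
  refine Tendsto.congr' hev ?_
  refine tendsto_integral_filter_of_dominated_convergence
    (fun _ => B) (Eventually.of_forall fun δ => ?_) ?_
    (integrable_const _) (Eventually.of_forall fun ξ => ?_)
  · have hm : Measurable fun x : Metric.sphere (0 : Eucl n) 1 × ℝ =>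
        pertIntegrand q K u δ (x.1 : Eucl n) x.2 :=
      measurable_pertIntegrand hK hu δ measurable_fst.subtype_val measurable_snd
    have := hm.stronglyMeasurable.integral_prod_right' (ν := volume.restrict (Set.Ioc (0 : ℝ) 1))
    simp only [intervalIntegral.integral_of_le zero_le_one]
    exact this.aestronglyMeasurable
  · filter_upwards [hbound] with δ hδ
    refine Eventually.of_forall fun ξ => ?_
    have := intervalIntegral.norm_integral_le_of_norm_le_const (hδ ξ ξ.2)
    simpa using this
  · have hξ0 := sphere_ne_zero ξ.2
    have hlim : (∫ s in (0 : ℝ)..1, 2 * (radFun K (ξ : Eucl n) ^ n * u ξ *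
        Vtilde q K (radFun K (ξ : Eucl n) • (ξ : Eucl n)))) = 2 * (radFun K (ξ : Eucl n) ^ n * u ξ *
        Vtilde q K (radFun K (ξ : Eucl n) • (ξ : Eucl n))) := by simp
    rw [← hlim]
    refine intervalIntegral.tendsto_integral_filter_of_dominated_convergence
      (fun _ => B) (Eventually.of_forall fun δ => ?_) ?_
      intervalIntegrable_const (Eventually.of_forall fun s hs => ?_)
    · exact (measurable_pertIntegrand hK hu δ measurable_const measurable_id).aestronglyMeasurable
    · filter_upwards [hbound] with δ hδ
      exact Eventually.of_forall fun s hs => hδ ξ ξ.2 s hs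
    · exact tendsto_pertIntegrand hn hq hK hu hM hξ0 s

end StarPert

end

section

variable {n : ℕ} {K : Set (Eucl n)}

/-- A function which is smooth away from the origin and positively `1`-homogeneous. -/
structure IsSmoothHom (G : Eucl n → ℝ) : Prop where
  contDiffOn : ContDiffOn ℝ (⊤ : ℕ∞) G {(0 : Eucl n)}ᶜ
  smul : ∀ c : ℝ, 0 < c → ∀ x, G (c • x) = c * G x

lemma IsSmoothBody.isSmoothHom (h : IsSmoothBody K) : IsSmoothHom (suppFun K) :=
  ⟨h.2.2.2.2.1, fun _ hc x => h.isBody.suppFun_smul hc.le x⟩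

lemma inner_gradient_eq {G : Eucl n → ℝ} (x v : Eucl n) : ⟪gradient G x, v⟫ = fderiv ℝ G x v :=
  InnerProductSpace.toDual_symm_apply

lemma gradient_eq_sum (G : Eucl n → ℝ) : gradient G = fun x =>
    ∑ i, fderiv ℝ G x (EuclideanSpace.basisFun (Fin n) ℝ i) • EuclideanSpace.basisFun (Fin n) ℝ i := by
  ext1 x
  rw [← (EuclideanSpace.basisFun (Fin n) ℝ).sum_repr' (gradient G x)]
  refine Finset.sum_congr rfl fun i _ => ?_
  rw [real_inner_comm, inner_gradient_eq]

lemma contDiffAt_gradient {G : Eucl n → ℝ} {x : Eucl n} (h : ContDiffAt ℝ (⊤ : ℕ∞) G x) :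
    ContDiffAt ℝ (⊤ : ℕ∞) (gradient G) x := by
  rw [gradient_eq_sum]
  have h1 : ContDiffAt ℝ (⊤ : ℕ∞) (fderiv ℝ G) x := h.fderiv_right (by norm_cast)
  exact ContDiffAt.sum fun i _ => (h1.clm_apply contDiffAt_const).smul contDiffAt_const

lemma fderiv_inner_gradient {G : Eucl n → ℝ} {x : Eucl n} (h : ContDiffAt ℝ (⊤ : ℕ∞) G x)
    (v w : Eucl n) : ⟪fderiv ℝ (gradient G) x v, w⟫ = fderiv ℝ (fderiv ℝ G) x v w := by
  have h1 := ((contDiffAt_gradient h).differentiableAt (by simp)).hasFDerivAt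
  have h2 : HasFDerivAt (fun y => ⟪gradient G y, w⟫) _ x := h1.inner ℝ (hasFDerivAt_const w x)
  have h3 : HasFDerivAt (fderiv ℝ G) _ x :=
    (((h.fderiv_right (m := (⊤ : ℕ∞)) (by norm_cast)).differentiableAt (by simp))).hasFDerivAt
  have h4 : HasFDerivAt (fun y => fderiv ℝ G y w) _ x := h3.clm_apply (hasFDerivAt_const w x)
  have h5 := h2.unique (h4.congr_of_eventuallyEq
    (Eventually.of_forall fun y => inner_gradient_eq y w))
  have := congrArg (fun L : Eucl n →L[ℝ] ℝ => L v) h5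
  simpa using this

lemma inner_fderiv_gradient_comm {G : Eucl n → ℝ} {x : Eucl n} (h : ContDiffAt ℝ (⊤ : ℕ∞) G x)
    (v w : Eucl n) : ⟪fderiv ℝ (gradient G) x v, w⟫ = ⟪fderiv ℝ (gradient G) x w, v⟫ := by
  rw [fderiv_inner_gradient h, fderiv_inner_gradient h]
  exact (h.isSymmSndFDerivAt (by
    rw [minSmoothness_of_isRCLikeNormedField]
    exact WithTop.coe_le_coe.2 (le_top : (2 : ℕ∞) ≤ ⊤))) v w

/-- The second derivative is nonnegative at a local minimum. -/
lemma inner_fderiv_gradient_nonneg {G : Eucl n → ℝ} {x : Eucl n} (h : ContDiffAt ℝ (⊤ : ℕ∞) G x)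
    (hmin : IsLocalMin G x) (v : Eucl n) : 0 ≤ ⟪fderiv ℝ (gradient G) x v, v⟫ := by
  by_contra! hneg
  set φ : ℝ → ℝ := fun s => G (x + s • v) with hφ
  have hl : ∀ s : ℝ, HasDerivAt (fun s : ℝ => x + s • v) v s := fun s => by
    simpa using ((hasDerivAt_id s).smul_const v).const_add x
  have hc : Tendsto (fun s : ℝ => x + s • v) (𝓝 0) (𝓝 x) := by
    simpa using (hl 0).continuousAt.tendsto
  have hd : ∀ᶠ y in 𝓝 x, DifferentiableAt ℝ G y := by
    filter_upwards [(h.of_le (m := 1) (by norm_cast)).eventually (by simp)] with y hy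
      using hy.differentiableAt (by simp)
  have h1 : deriv φ =ᶠ[𝓝 0] fun s => ⟪gradient G (x + s • v), v⟫ := by
    filter_upwards [hc.eventually hd] with s hs
    rw [inner_gradient_eq]
    exact (hs.hasFDerivAt.comp_hasDerivAt s (hl s)).deriv
  have h2 : HasDerivAt (fun s : ℝ => ⟪gradient G (x + s • v), v⟫)
      ⟪fderiv ℝ (gradient G) x v, v⟫ 0 := by
    have h3 : HasFDerivAt (gradient G) (fderiv ℝ (gradient G) x) (x + (0 : ℝ) • v) := by
      simpa using ((contDiffAt_gradient h).differentiableAt (by simp)).hasFDerivAt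
    have := (h3.comp_hasDerivAt (0 : ℝ) (hl 0)).inner ℝ (hasDerivAt_const (0 : ℝ) v)
    simpa using this
  have h3 : deriv (deriv φ) 0 < 0 := by rw [h1.deriv_eq, h2.deriv]; exact hneg
  have hmin0 : IsLocalMin φ 0 := by
    have := hc.eventually hmin
    filter_upwards [this] with s hs
    simpa [hφ] using hs
  have hmax0 : IsLocalMax φ 0 := by
    refine isLocalMax_of_deriv_deriv_neg h3 hmin0.deriv_eq_zero ?_
    have : ContinuousAt G (x + (0 : ℝ) • v) := by simpa using h.continuousAt
    exact ContinuousAt.comp (f := fun s : ℝ => x + s • v) this (hl 0).continuousAt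
  have hconst : φ =ᶠ[𝓝 0] fun _ => φ 0 := by
    filter_upwards [hmin0, hmax0] with s h1 h2 using le_antisymm h2 h1
  have : deriv (deriv φ) 0 = 0 := by
    have h4 : deriv φ =ᶠ[𝓝 0] fun _ => 0 := by
      simpa using hconst.deriv
    rw [h4.deriv_eq, deriv_const]
  exact h3.ne this

namespace IsSmoothHom

variable {G : Eucl n → ℝ} {x : Eucl n}

lemma contDiffAt (hG : IsSmoothHom G) (hx : x ≠ 0) : ContDiffAt ℝ (⊤ : ℕ∞) G x :=
  hG.contDiffOn.contDiffAt (isOpen_compl_singleton.mem_nhds hx)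

lemma differentiableAt (hG : IsSmoothHom G) (hx : x ≠ 0) : DifferentiableAt ℝ G x :=
  (hG.contDiffAt hx).differentiableAt (by simp)

lemma differentiableAt_gradient (hG : IsSmoothHom G) (hx : x ≠ 0) :
    DifferentiableAt ℝ (gradient G) x :=
  (contDiffAt_gradient (hG.contDiffAt hx)).differentiableAt (by simp)

lemma gradient_smul (hG : IsSmoothHom G) (hx : x ≠ 0) {c : ℝ} (hc : 0 < c) :
    gradient G (c • x) = gradient G x := by
  refine ext_inner_right ℝ fun v => ?_
  rw [inner_gradient_eq, inner_gradient_eq]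
  have h1 : HasFDerivAt (fun y => G (c • y)) _ x :=
    (hG.differentiableAt (smul_ne_zero hc.ne' hx)).hasFDerivAt.comp x
      ((hasFDerivAt_id x).const_smul c)
  have h2 : HasFDerivAt (fun y => G (c • y)) _ x :=
    ((hG.differentiableAt hx).hasFDerivAt.const_mul c).congr_of_eventuallyEq
      (Eventually.of_forall fun y => hG.smul c hc y)
  have h3 := congrArg (fun L : Eucl n →L[ℝ] ℝ => L v) (h1.unique h2)
  simp only [ContinuousLinearMap.comp_apply, smul_apply,
    ContinuousLinearMap.id_apply, map_smul, smul_eq_mul] at h3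
  exact mul_left_cancel₀ hc.ne' h3

lemma fderiv_gradient_self (hG : IsSmoothHom G) (hx : x ≠ 0) :
    fderiv ℝ (gradient G) x x = 0 := by
  have hl : HasDerivAt (fun s : ℝ => s • x) x 1 := by simpa using (hasDerivAt_id (1 : ℝ)).smul_const x
  have h0 : HasFDerivAt (gradient G) (fderiv ℝ (gradient G) x) ((1 : ℝ) • x) := by
    simpa using (hG.differentiableAt_gradient hx).hasFDerivAt
  have h1 : HasDerivAt (fun s : ℝ => gradient G (s • x)) (fderiv ℝ (gradient G) x x) 1 :=
    HasFDerivAt.comp_hasDerivAt (f := fun s : ℝ => s • x) 1 h0 hl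
  have h2 : HasDerivAt (fun s : ℝ => gradient G (s • x)) 0 1 := by
    refine (hasDerivAt_const (1 : ℝ) (gradient G x)).congr_of_eventuallyEq ?_
    filter_upwards [lt_mem_nhds one_pos] with s hs using hG.gradient_smul hx hs
  exact h1.unique h2

lemma inner_fderiv_gradient_self (hG : IsSmoothHom G) (hx : x ≠ 0) (v : Eucl n) :
    ⟪fderiv ℝ (gradient G) x v, x⟫ = 0 := by
  rw [inner_fderiv_gradient_comm (hG.contDiffAt hx), hG.fderiv_gradient_self hx, inner_zero_left]

end IsSmoothHom

/-- The endomorphism whose determinant is `curvDet`. -/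
def curvMap (G : Eucl n → ℝ) (x : Eucl n) : Eucl n →ₗ[ℝ] Eucl n :=
  (fderiv ℝ (fun y => gradient G y) x : Eucl n →ₗ[ℝ] Eucl n) + rankOne x

lemma curvMap_apply (G : Eucl n → ℝ) (x v : Eucl n) :
    curvMap G x v = fderiv ℝ (gradient G) x v + ⟪x, v⟫ • x := rfl

lemma curvDet_eq (G : Eucl n → ℝ) (x : Eucl n) : curvDet G x = LinearMap.det (curvMap G x) := rfl

lemma IsSmoothHom.isSymmetric_curvMap {G : Eucl n → ℝ} (hG : IsSmoothHom G) {x : Eucl n}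
    (hx : x ≠ 0) : (curvMap G x).IsSymmetric := fun v w => by
  rw [curvMap_apply, curvMap_apply, inner_add_left, inner_add_right,
    inner_fderiv_gradient_comm (hG.contDiffAt hx), real_inner_smul_left, real_inner_smul_right,
    real_inner_comm v, real_inner_comm v x]
  ring

namespace IsSmoothBody

lemma inner_fderiv_gradient_nonneg (h : IsSmoothBody K) {x : Eucl n} (hx : x ≠ 0) (v : Eucl n) :
    0 ≤ ⟪fderiv ℝ (gradient (suppFun K)) x v, v⟫ := by
  obtain ⟨h1, h2⟩ := h.gradient_mem hx
  set y := gradient (suppFun K) x with hy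
  have hlin : ∀ z, HasFDerivAt (fun z : Eucl n => ⟪y, z⟫) (innerSL ℝ y) z :=
    fun z => (innerSL ℝ y).hasFDerivAt
  have hc : ContDiffAt ℝ (⊤ : ℕ∞) (fun z => suppFun K z - ⟪y, z⟫) x :=
    (h.isSmoothHom.contDiffAt hx).sub (innerSL ℝ y).contDiff.contDiffAt
  have hmin : IsLocalMin (fun z => suppFun K z - ⟪y, z⟫) x := by
    refine Eventually.of_forall fun z => ?_
    have := h.isBody.inner_le z h1
    rw [real_inner_comm] at this h2
    simp only [h2, sub_self]
    linarith
  have hgr : gradient (fun z => suppFun K z - ⟪y, z⟫) =ᶠ[𝓝 x]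
      fun z => gradient (suppFun K) z - y := by
    filter_upwards [isOpen_compl_singleton.mem_nhds hx] with z hz
    refine ext_inner_right ℝ fun w => ?_
    rw [inner_gradient_eq, inner_sub_left, inner_gradient_eq,
      ((h.differentiableAt hz).hasFDerivAt.fun_sub (hlin z)).fderiv]
    rfl
  have := _root_.inner_fderiv_gradient_nonneg hc hmin v
  rwa [hgr.fderiv_eq, fderiv_sub_const] at this

lemma curvMap_injective (h : IsSmoothBody K) {x : Eucl n} (hx : x ∈ Metric.sphere (0 : Eucl n) 1) :
    Function.Injective (curvMap (suppFun K) x) := by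
  have h1 := h.2.2.2.2.2 x hx
  rw [curvDet_eq] at h1
  have h2 : IsUnit (LinearMap.det (curvMap (suppFun K) x)) := isUnit_iff_ne_zero.2 h1.ne'
  exact ((Module.End.isUnit_iff _).1 ((LinearMap.isUnit_iff_isUnit_det _).2 h2)).injective

end IsSmoothBody

end

section

variable {n : ℕ} {K : Set (Eucl n)}

namespace IsSmoothBody

lemma eq_of_gradient_eq (h : IsSmoothBody K) {x x' : Eucl n}
    (hx : x ∈ Metric.sphere (0 : Eucl n) 1) (hx' : x' ∈ Metric.sphere (0 : Eucl n) 1)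
    (he : gradient (suppFun K) x = gradient (suppFun K) x') : x = x' := by
  have hx0 := sphere_ne_zero hx
  obtain ⟨hy, h1⟩ := h.gradient_mem hx0
  obtain ⟨-, h2⟩ := h.gradient_mem (sphere_ne_zero hx')
  rw [← he] at h2
  set y := gradient (suppFun K) x with hydef
  have hl : HasDerivAt (fun s : ℝ => x + s • (x' - x)) (x' - x) 0 := by
    simpa using ((hasDerivAt_id (0 : ℝ)).smul_const (x' - x)).const_add x
  have hc : Tendsto (fun s : ℝ => x + s • (x' - x)) (𝓝 0) (𝓝 x) := by
    simpa using hl.continuousAt.tendsto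
  have hconst : (fun s : ℝ => gradient (suppFun K) (x + s • (x' - x))) =ᶠ[𝓝[>] 0] fun _ => y := by
    filter_upwards [(hc.eventually (isOpen_compl_singleton.mem_nhds hx0)).filter_mono
      nhdsWithin_le_nhds, Ioo_mem_nhdsGT one_pos] with s hs hs1
    refine h.gradient_eq hs hy (le_antisymm (h.isBody.inner_le _ hy) ?_)
    have e : x + s • (x' - x) = (1 - s) • x + s • x' := by module
    rw [e, inner_add_left, real_inner_smul_left, real_inner_smul_left, h1, h2]
    refine (h.isBody.suppFun_add_le _ _).trans (le_of_eq ?_)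
    rw [h.isBody.suppFun_smul (by linarith [hs1.2]), h.isBody.suppFun_smul hs1.1.le]
  have h0 : HasFDerivAt (gradient (suppFun K)) (fderiv ℝ (gradient (suppFun K)) x)
      (x + (0 : ℝ) • (x' - x)) := by
    simpa using (h.isSmoothHom.differentiableAt_gradient hx0).hasFDerivAt
  have hd : HasDerivAt (fun s : ℝ => gradient (suppFun K) (x + s • (x' - x)))
      (fderiv ℝ (gradient (suppFun K)) x (x' - x)) 0 :=
    HasFDerivAt.comp_hasDerivAt (f := fun s : ℝ => x + s • (x' - x)) 0 h0 hl
  have hd2 : HasDerivWithinAt (fun s : ℝ => gradient (suppFun K) (x + s • (x' - x))) 0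
      (Set.Ioi 0) 0 :=
    (hasDerivWithinAt_const (0 : ℝ) _ y).congr_of_eventuallyEq hconst (by simp [hydef])
  have hD : fderiv ℝ (gradient (suppFun K)) x (x' - x) = 0 :=
    (uniqueDiffWithinAt_Ioi (0 : ℝ)).eq_deriv _ hd.hasDerivWithinAt hd2
  rw [map_sub, h.isSmoothHom.fderiv_gradient_self hx0, sub_zero] at hD
  have hxx : ⟪x, x⟫ = 1 := by
    rw [real_inner_self_eq_norm_sq, mem_sphere_zero_iff_norm.1 hx]; norm_num
  have hM : curvMap (suppFun K) x (x' - ⟪x, x'⟫ • x) = curvMap (suppFun K) x 0 := by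
    rw [map_zero, curvMap_apply, map_sub, hD, map_smul, h.isSmoothHom.fderiv_gradient_self hx0,
      inner_sub_right, real_inner_smul_right, hxx]
    simp
  have hw := sub_eq_zero.1 (h.curvMap_injective hx hM)
  have habs : |⟪x, x'⟫| = 1 := by
    have := congrArg norm hw
    rw [norm_smul, mem_sphere_zero_iff_norm.1 hx, mem_sphere_zero_iff_norm.1 hx', mul_one] at this
    rw [← Real.norm_eq_abs, ← this]
  rcases abs_eq (zero_le_one) |>.1 habs with h3 | h3
  · rw [h3, one_smul] at hw; exact hw.symm
  · rw [h3, neg_one_smul] at hw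
    have h4 := h.isBody.suppFun_pos hx0
    have h5 := h.isBody.suppFun_pos (sphere_ne_zero hx')
    rw [hw, inner_neg_left, h1] at h2
    rw [hw] at h5
    linarith

lemma gauge_eq_one_of_inner_eq (h : IsSmoothBody K) {x y : Eucl n} (hx : x ≠ 0) (hy : y ∈ K)
    (hxy : ⟪x, y⟫ = suppFun K x) : gauge K y = 1 := by
  have h1 := h.isBody.inner_le_gauge_mul x y
  rw [hxy] at h1
  exact le_antisymm (h.isBody.gauge_le_one_iff.2 hy)
    (le_of_mul_le_mul_right (by simpa using h1) (h.isBody.suppFun_pos hx))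

lemma exists_normal (h : IsSmoothBody K) {z : Eucl n} (hz : z ≠ 0) :
    ∃ x ∈ Metric.sphere (0 : Eucl n) 1, ⟪x, z⟫ = gauge K z * suppFun K x := by
  have hb := h.isBody
  have hg := hb.gauge_pos hz
  have : Nontrivial (Eucl n) := ⟨z, 0, hz⟩
  obtain ⟨x, hx, hmin⟩ := (isCompact_sphere (0 : Eucl n) 1).exists_isMinOn
    (NormedSpace.sphere_nonempty.2 zero_le_one)
    (f := fun x => gauge K z * suppFun K x - ⟪x, z⟫)
    (by have := hb.continuous_suppFun; fun_prop)
  refine ⟨x, hx, le_antisymm (hb.inner_le_gauge_mul x z) ?_⟩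
  by_contra! hlt
  set m := gauge K z * suppFun K x - ⟪x, z⟫ with hm
  have hm0 : 0 < m := by linarith
  have hzn : 0 < ‖z‖ := norm_pos_iff.2 hz
  have hlt2 : gauge K ((1 + m / ‖z‖) • z) ≤ gauge K z := by
    refine hb.gauge_le hg fun w _ => ?_
    rcases eq_or_ne w 0 with rfl | hw
    · simp [hb.suppFun_zero]
    have hwn : 0 < ‖w‖ := norm_pos_iff.2 hw
    have h1 : m ≤ gauge K z * suppFun K (‖w‖⁻¹ • w) - ⟪‖w‖⁻¹ • w, z⟫ :=
      hmin (by simp [norm_smul, hwn.ne'])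
    have h2 : ⟪‖w‖⁻¹ • w, z⟫ ≤ ‖z‖ := by
      refine (real_inner_le_norm _ _).trans (le_of_eq ?_)
      rw [norm_smul, norm_inv, norm_norm, inv_mul_cancel₀ hwn.ne', one_mul]
    rw [real_inner_smul_left] at h1 h2
    rw [hb.suppFun_smul (by positivity)] at h1
    rw [real_inner_smul_right]
    have h3 : m / ‖z‖ * (‖w‖⁻¹ * ⟪w, z⟫) ≤ m := by
      refine (mul_le_mul_of_nonneg_left h2 (by positivity)).trans (le_of_eq ?_)
      field_simp
    have h4 : ‖w‖⁻¹ * ((1 + m / ‖z‖) * ⟪w, z⟫) ≤ ‖w‖⁻¹ * (gauge K z * suppFun K w) := by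
      linarith
    exact le_of_mul_le_mul_left h4 (by positivity)
  rw [hb.gauge_smul (by positivity)] at hlt2
  have : 0 < m / ‖z‖ * gauge K z := by positivity
  linarith

open Classical in
/-- The outer unit normal of `K` at the boundary point in direction `z`. -/
def normalAt (K : Set (Eucl n)) (z : Eucl n) : Eucl n :=
  if h : ∃ x ∈ Metric.sphere (0 : Eucl n) 1, ⟪x, z⟫ = gauge K z * suppFun K x then h.choose else 0

lemma normalAt_mem (h : IsSmoothBody K) {z : Eucl n} (hz : z ≠ 0) :
    normalAt K z ∈ Metric.sphere (0 : Eucl n) 1 := by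
  rw [normalAt, dif_pos (h.exists_normal hz)]
  exact (h.exists_normal hz).choose_spec.1

lemma inner_normalAt (h : IsSmoothBody K) {z : Eucl n} (hz : z ≠ 0) :
    ⟪normalAt K z, z⟫ = gauge K z * suppFun K (normalAt K z) := by
  rw [normalAt, dif_pos (h.exists_normal hz)]
  exact (h.exists_normal hz).choose_spec.2

lemma gradient_of_inner_eq (h : IsSmoothBody K) {x z : Eucl n} (hx : x ≠ 0) (hz : z ≠ 0)
    (hxz : ⟪x, z⟫ = gauge K z * suppFun K x) :
    gradient (suppFun K) x = (gauge K z)⁻¹ • z := by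
  refine h.gradient_eq hx (h.isBody.inv_gauge_smul_mem hz) ?_
  rw [real_inner_smul_right, hxz, inv_mul_cancel_left₀ (h.isBody.gauge_pos hz).ne']

lemma gradient_normalAt (h : IsSmoothBody K) {z : Eucl n} (hz : z ≠ 0) :
    gradient (suppFun K) (normalAt K z) = (gauge K z)⁻¹ • z :=
  h.gradient_of_inner_eq (sphere_ne_zero (h.normalAt_mem hz)) hz (h.inner_normalAt hz)

lemma eq_normalAt (h : IsSmoothBody K) {x z : Eucl n} (hx : x ∈ Metric.sphere (0 : Eucl n) 1)
    (hz : z ≠ 0) (hxz : ⟪x, z⟫ = gauge K z * suppFun K x) : x = normalAt K z :=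
  h.eq_of_gradient_eq hx (h.normalAt_mem hz) <| by
    rw [h.gradient_normalAt hz, h.gradient_of_inner_eq (sphere_ne_zero hx) hz hxz]

lemma normalAt_smul (h : IsSmoothBody K) {c : ℝ} (hc : 0 < c) (z : Eucl n) :
    normalAt K (c • z) = normalAt K z := by
  rcases eq_or_ne z 0 with rfl | hz
  · rw [smul_zero]
  refine (h.eq_normalAt (h.normalAt_mem hz) (smul_ne_zero hc.ne' hz) ?_).symm
  rw [real_inner_smul_right, h.inner_normalAt hz, h.isBody.gauge_smul hc.le, mul_assoc]

lemma continuousOn_normalAt (h : IsSmoothBody K) : ContinuousOn (normalAt K) {(0 : Eucl n)}ᶜ := by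
  intro z hz
  refine ContinuousAt.continuousWithinAt ?_
  have hev : ∀ᶠ w in 𝓝 z, w ≠ (0 : Eucl n) := isOpen_compl_singleton.mem_nhds hz
  refine (isCompact_sphere (0 : Eucl n) 1).tendsto_nhds_of_unique_mapClusterPt
    (hev.mono fun w hw => h.normalAt_mem hw) fun x hx hcl => h.eq_normalAt hx hz ?_
  have hF : Continuous fun p : Eucl n × Eucl n => ⟪p.1, p.2⟫ - gauge K p.2 * suppFun K p.1 := by
    have := h.isBody.continuous_suppFun
    have := h.isBody.continuous_gauge
    fun_prop
  refine sub_eq_zero.1 (?_ : ⟪x, z⟫ - gauge K z * suppFun K x = 0)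
  by_contra hne
  have h1 : ∀ᶠ p in 𝓝 (x, z), ⟪p.1, p.2⟫ - gauge K p.2 * suppFun K p.1 ≠ 0 :=
    hF.continuousAt.eventually_ne hne
  obtain ⟨U, hU, V, hV, hUV⟩ := mem_nhds_prod_iff.1 h1
  obtain ⟨w, hw1, hwV, hw2⟩ :=
    ((mapClusterPt_iff_frequently.1 hcl U hU).and_eventually
      ((show ∀ᶠ w in 𝓝 z, w ∈ V from hV).and hev)).exists
  exact hUV (Set.mk_mem_prod hw1 hwV) (sub_eq_zero.2 (h.inner_normalAt hw2))

lemma measurable_comp_normalAt (h : IsSmoothBody K) {v : Eucl n → ℝ}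
    (hv : ContinuousOn v (Metric.sphere 0 1)) : Measurable fun z => v (normalAt K z) :=
  measurable_of_continuousOn_compl_singleton 0
    (hv.comp h.continuousOn_normalAt fun _ hz => h.normalAt_mem hz)

/-- The map from the punctured unit ball onto `K` sending the ray in direction `x` to the ray
through the boundary point with outer normal `x`. -/
def rayMap (K : Set (Eucl n)) (y : Eucl n) : Eucl n := ‖y‖ • gradient (suppFun K) y

lemma gauge_rayMap (h : IsSmoothBody K) {y : Eucl n} (hy : y ≠ 0) :
    gauge K (rayMap K y) = ‖y‖ := by
  obtain ⟨h1, h2⟩ := h.gradient_mem hy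
  rw [rayMap, h.isBody.gauge_smul (norm_nonneg y), h.gauge_eq_one_of_inner_eq hy h1 h2, mul_one]

lemma rayMap_ne_zero (h : IsSmoothBody K) {y : Eucl n} (hy : y ≠ 0) : rayMap K y ≠ 0 := by
  intro h0
  have := h.gauge_rayMap hy
  rw [h0, gauge_zero] at this
  exact hy (norm_eq_zero.1 this.symm)

lemma normalAt_rayMap (h : IsSmoothBody K) {y : Eucl n} (hy : y ≠ 0) :
    normalAt K (rayMap K y) = ‖y‖⁻¹ • y := by
  have hyn : 0 < ‖y‖ := norm_pos_iff.2 hy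
  refine (h.eq_normalAt (by simp [norm_smul, hyn.ne']) (h.rayMap_ne_zero hy) ?_).symm
  rw [h.gauge_rayMap hy, rayMap, h.isBody.suppFun_smul (by positivity), real_inner_smul_left,
    real_inner_smul_right, (h.gradient_mem hy).2]
  ring

lemma image_rayMap (h : IsSmoothBody K) :
    rayMap K '' (Metric.closedBall 0 1 \ {0}) = K \ {0} := by
  ext z
  constructor
  · rintro ⟨y, ⟨hy, hy0⟩, rfl⟩
    refine ⟨h.isBody.gauge_le_one_iff.1 ?_, h.rayMap_ne_zero hy0⟩
    rw [h.gauge_rayMap hy0]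
    simpa using hy
  · rintro ⟨hz, hz0⟩
    have hz0 : z ≠ 0 := hz0
    have hg := h.isBody.gauge_pos hz0
    have hν := h.normalAt_mem hz0
    have hn : ‖gauge K z • normalAt K z‖ = gauge K z := by
      rw [norm_smul, mem_sphere_zero_iff_norm.1 hν, mul_one, Real.norm_of_nonneg hg.le]
    refine ⟨gauge K z • normalAt K z, ⟨?_, smul_ne_zero hg.ne' (sphere_ne_zero hν)⟩, ?_⟩
    · rw [mem_closedBall_zero_iff, hn]; exact h.isBody.gauge_le_one_iff.2 hz
    · rw [rayMap, hn, h.gradient_smul (sphere_ne_zero hν) hg, h.gradient_normalAt hz0,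
        smul_inv_smul₀ hg.ne']

lemma injOn_rayMap (h : IsSmoothBody K) :
    Set.InjOn (rayMap K) (Metric.closedBall 0 1 \ {0}) := by
  rintro y ⟨-, hy⟩ y' ⟨-, hy'⟩ he
  have h1 := h.gauge_rayMap hy
  have h2 := h.normalAt_rayMap hy
  rw [he, h.normalAt_rayMap hy'] at h2
  rw [he, h.gauge_rayMap hy'] at h1
  rw [h1] at h2
  have hy0 : ‖y‖ ≠ 0 := norm_ne_zero_iff.2 hy
  exact (smul_right_injective _ (inv_ne_zero hy0) h2).symm

end IsSmoothBody

lemma IsSmoothHom.fderiv_gradient_smul {G : Eucl n → ℝ} (hG : IsSmoothHom G) {x : Eucl n}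
    (hx : x ≠ 0) {c : ℝ} (hc : 0 < c) :
    c • fderiv ℝ (gradient G) (c • x) = fderiv ℝ (gradient G) x := by
  have h1 : HasFDerivAt (fun y => gradient G (c • y)) _ x :=
    (hG.differentiableAt_gradient (smul_ne_zero hc.ne' hx)).hasFDerivAt.comp x
      ((hasFDerivAt_id x).const_smul c)
  have h2 : HasFDerivAt (fun y => gradient G (c • y)) (fderiv ℝ (gradient G) x) x := by
    refine (hG.differentiableAt_gradient hx).hasFDerivAt.congr_of_eventuallyEq ?_
    filter_upwards [isOpen_compl_singleton.mem_nhds hx] with y hy using hG.gradient_smul hy hc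
  rw [← h1.unique h2]
  ext1 v
  simp

namespace IsSmoothBody

lemma exists_hasFDerivAt_rayMap (h : IsSmoothBody K) {y : Eucl n} (hy : y ≠ 0) :
    ∃ L : Eucl n →L[ℝ] Eucl n, HasFDerivAt (rayMap K) L y ∧
      L.det = suppFun K (‖y‖⁻¹ • y) * curvDet (suppFun K) (‖y‖⁻¹ • y) := by
  have hyn : 0 < ‖y‖ := norm_pos_iff.2 hy
  set x := ‖y‖⁻¹ • y with hx
  have hxS : x ∈ Metric.sphere (0 : Eucl n) 1 := by simp [hx, norm_smul, hyn.ne']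
  have hx0 := sphere_ne_zero hxS
  have hyx : y = ‖y‖ • x := by rw [hx, smul_inv_smul₀ hyn.ne']
  have hxx : ⟪x, x⟫ = 1 := by
    rw [real_inner_self_eq_norm_sq, mem_sphere_zero_iff_norm.1 hxS]; norm_num
  have hnorm : HasFDerivAt (fun z : Eucl n => ‖z‖) (innerSL ℝ x) y := by
    have := (hasStrictFDerivAt_norm_sq y).hasFDerivAt.sqrt (by positivity)
    simp only [Real.sqrt_sq (norm_nonneg _)] at this
    refine this.congr_fderiv (ContinuousLinearMap.ext fun v => ?_)
    simp [hx]
    field_simp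
  have hgy : gradient (suppFun K) y = gradient (suppFun K) x := by
    conv_lhs => rw [hyx]
    exact h.gradient_smul hx0 hyn
  have hL := hnorm.smul (h.isSmoothHom.differentiableAt_gradient hy).hasFDerivAt
  refine ⟨_, hL, ?_⟩
  obtain ⟨u, hu⟩ := (LinearMap.injective_iff_surjective.1 (h.curvMap_injective hxS))
    (gradient (suppFun K) x - x)
  have hxu : ⟪x, u⟫ = suppFun K x - 1 := by
    have := congrArg (fun z => ⟪x, z⟫) hu
    simp only [curvMap_apply, inner_add_right, inner_sub_right, real_inner_smul_right, hxx,
      (h.gradient_mem hx0).2] at this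
    rw [real_inner_comm, h.isSmoothHom.inner_fderiv_gradient_self hx0] at this
    linarith
  have hcomp : ((‖y‖ • fderiv ℝ (gradient (suppFun K)) y +
      (innerSL ℝ x).smulRight (gradient (suppFun K) y) : Eucl n →L[ℝ] Eucl n) :
      Eucl n →ₗ[ℝ] Eucl n) = (curvMap (suppFun K) x).comp
        (LinearMap.transvection ((innerSL ℝ x : Eucl n →L[ℝ] ℝ) : Eucl n →ₗ[ℝ] ℝ) u) := by
    have hD : ‖y‖ • fderiv ℝ (gradient (suppFun K)) y = fderiv ℝ (gradient (suppFun K)) x := by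
      conv_lhs => rw [hyx, norm_smul, mem_sphere_zero_iff_norm.1 hxS, norm_norm, mul_one]
      exact h.isSmoothHom.fderiv_gradient_smul hx0 hyn
    refine LinearMap.ext fun v => ?_
    rw [hD, hgy]
    simp only [LinearMap.comp_apply, LinearMap.transvection.apply, map_add, map_smul, hu]
    simp [curvMap_apply, smul_sub]
  rw [ContinuousLinearMap.det, hcomp, LinearMap.det_comp, LinearMap.transvection.det, curvDet_eq]
  simp only [ContinuousLinearMap.coe_coe, innerSL_apply_apply, hxu]
  ring

end IsSmoothBody

end

section

variable {n : ℕ} {K : Set (Eucl n)}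

/-- The determinant of `D + rankOne x`, as a function of a continuous linear map. -/
def detRankOne (p : (Eucl n →L[ℝ] Eucl n) × Eucl n) : ℝ :=
  (p.1 + (innerSL ℝ p.2).smulRight p.2).det

lemma continuous_detRankOne : Continuous (detRankOne (n := n)) := by
  refine ContinuousLinearMap.continuous_det.comp ?_
  refine continuous_fst.add ?_
  have h : Continuous fun x : Eucl n =>
      ContinuousLinearMap.smulRightL ℝ (Eucl n) (Eucl n) (innerSL ℝ x) x := by fun_prop
  exact h.comp continuous_snd

lemma curvDet_eq_detRankOne (H : Eucl n → ℝ) (x : Eucl n) :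
    curvDet H x = detRankOne (fderiv ℝ (gradient H) x, x) := by
  rw [curvDet, detRankOne, ContinuousLinearMap.det]
  congr 1

lemma IsSmoothHom.continuousOn_fderiv_gradient {G : Eucl n → ℝ} (hG : IsSmoothHom G) :
    ContinuousOn (fderiv ℝ (gradient G)) {0}ᶜ := fun x hx =>
  ((contDiffAt_gradient (hG.contDiffAt hx)).fderiv_right (m := 0) (by simp)).continuousAt.continuousWithinAt

lemma IsSmoothHom.continuousOn_gradient {G : Eucl n → ℝ} (hG : IsSmoothHom G) :
    ContinuousOn (gradient G) {0}ᶜ := fun _ hx =>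
  (hG.differentiableAt_gradient hx).continuousAt.continuousWithinAt

lemma IsSmoothHom.continuousOn_curvDet {G : Eucl n → ℝ} (hG : IsSmoothHom G) :
    ContinuousOn (curvDet G) {0}ᶜ := by
  simp_rw [show curvDet G = fun x => detRankOne (fderiv ℝ (gradient G) x, x) from
    funext (curvDet_eq_detRankOne G)]
  exact continuous_detRankOne.comp_continuousOn
    (hG.continuousOn_fderiv_gradient.prodMk continuousOn_id)

namespace IsSmoothBody

lemma integral_radFun_pow_normalAt (hn : 0 < n) (h : IsSmoothBody K) {Φ : Eucl n → ℝ}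
    (hΦ : ContinuousOn Φ (Metric.sphere 0 1)) :
    ∫ ξ, radFun K (ξ : Eucl n) ^ n * Φ (normalAt K ξ) ∂(sphMeas n) =
      ∫ x, Φ (x : Eucl n) * (suppFun K x * curvDet (suppFun K) x) ∂(sphMeas n) := by
  have hb := h.isBody
  set s : Set (Eucl n) := Metric.closedBall 0 1 \ {0} with hs
  have hsm : MeasurableSet s := measurableSet_closedBall.diff (measurableSet_singleton 0)
  have hKm : MeasurableSet (K \ {0}) := hb.measurableSet.diff (measurableSet_singleton 0)
  set g : Eucl n → ℝ := fun z => Φ (normalAt K z) with hg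
  have hgm : Measurable g := h.measurable_comp_normalAt hΦ
  obtain ⟨M, hM⟩ := (isCompact_sphere (0 : Eucl n) 1).exists_bound_of_continuousOn hΦ
  have hgi : IntegrableOn g (K \ {0}) := by
    refine IntegrableOn.of_bound ((measure_mono Set.sdiff_subset).trans_lt
      hb.compact.measure_lt_top) hgm.aestronglyMeasurable M ?_
    exact (ae_restrict_iff' hKm).2 (Eventually.of_forall fun z hz => hM _ (h.normalAt_mem hz.2))
  have hder : ∀ y ∈ s, HasFDerivWithinAt (rayMap K) (fderiv ℝ (rayMap K) y) s y := fun y hy => by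
    obtain ⟨L, hL, -⟩ := h.exists_hasFDerivAt_rayMap hy.2
    exact hL.differentiableAt.hasFDerivAt.hasFDerivWithinAt
  have hdet : ∀ y ∈ s, |(fderiv ℝ (rayMap K) y).det| =
      suppFun K (‖y‖⁻¹ • y) * curvDet (suppFun K) (‖y‖⁻¹ • y) := fun y hy => by
    obtain ⟨L, hL, hd⟩ := h.exists_hasFDerivAt_rayMap hy.2
    have hy0 : ‖y‖ ≠ 0 := norm_ne_zero_iff.2 hy.2
    have hx : ‖y‖⁻¹ • y ∈ Metric.sphere (0 : Eucl n) 1 := by simp [norm_smul, hy0]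
    rw [hL.fderiv, hd, abs_of_pos (mul_pos (hb.suppFun_pos (sphere_ne_zero hx)) (h.2.2.2.2.2 _ hx))]
  set g' : Eucl n → ℝ := fun y =>
    Φ (‖y‖⁻¹ • y) * (suppFun K (‖y‖⁻¹ • y) * curvDet (suppFun K) (‖y‖⁻¹ • y)) with hg'
  have hgg' : ∀ y ∈ s, |(fderiv ℝ (rayMap K) y).det| • g (rayMap K y) = g' y := fun y hy => by
    rw [hdet y hy, hg, hg', smul_eq_mul, mul_comm]
    simp only [h.normalAt_rayMap hy.2]
  have hcv := integral_image_eq_integral_abs_det_fderiv_smul volume hsm hder h.injOn_rayMap g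
  rw [h.image_rayMap, setIntegral_congr_fun hsm hgg'] at hcv
  have hgi' : IntegrableOn g' s := by
    refine IntegrableOn.congr_fun ?_ hgg' hsm
    exact (integrableOn_image_iff_integrableOn_abs_det_fderiv_smul volume hsm hder
      h.injOn_rayMap g).1 (by rwa [h.image_rayMap])
  have hl := setIntegral_eq_integral_sphere hn hKm (ρ := radFun K) (fun ξ hξ => by
    refine ⟨(hb.radFun_pos (sphere_ne_zero hξ)).le, fun r hr => ?_⟩
    rw [Set.mem_sdiff, Set.mem_singleton_iff, ← hb.gauge_le_one_iff, hb.gauge_smul hr.le,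
      hb.radFun_eq (sphere_ne_zero hξ)]
    have := smul_ne_zero hr.ne' (sphere_ne_zero hξ)
    rw [le_inv_comm₀ hr (hb.gauge_pos (sphere_ne_zero hξ)), ← one_div, le_div_iff₀ hr]
    simp [mul_comm, hr.ne', (sphere_ne_zero hξ)]) hgi
  have hr := setIntegral_eq_integral_sphere hn hsm (ρ := fun _ => 1) (fun ξ hξ => by
    refine ⟨zero_le_one, fun r hr => ?_⟩
    rw [hs, Set.mem_sdiff, mem_closedBall_zero_iff, norm_smul, mem_sphere_zero_iff_norm.1 hξ,
      Real.norm_of_nonneg hr.le]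
    simp [hr.ne', (sphere_ne_zero hξ)]) hgi'
  have hn' : (n : ℝ) ≠ 0 := by positivity
  have hpow : ∀ (c a : ℝ), (∫ r in (0 : ℝ)..a, r ^ (n - 1) * c) = (n : ℝ)⁻¹ * (a ^ n * c) := by
    intro c a
    rw [intervalIntegral.integral_mul_const, integral_pow, Nat.sub_add_cancel hn, zero_pow hn.ne',
      Nat.cast_sub hn]
    simp
    field_simp
  have hl' : ∀ ξ : Metric.sphere (0 : Eucl n) 1,
      (∫ r in (0 : ℝ)..radFun K (ξ : Eucl n), r ^ (n - 1) * g (r • (ξ : Eucl n))) =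
        (n : ℝ)⁻¹ * (radFun K (ξ : Eucl n) ^ n * Φ (normalAt K ξ)) := fun ξ => by
    rw [← hpow]
    refine intervalIntegral.integral_congr_ae (Eventually.of_forall fun r hr => ?_)
    rw [Set.uIoc_of_le (hb.radFun_pos (sphere_ne_zero ξ.2)).le] at hr
    rw [hg]
    simp only [h.normalAt_smul hr.1]
  have hr' : ∀ ξ : Metric.sphere (0 : Eucl n) 1,
      (∫ r in (0 : ℝ)..1, r ^ (n - 1) * g' (r • (ξ : Eucl n))) =
        (n : ℝ)⁻¹ * (Φ (ξ : Eucl n) * (suppFun K ξ * curvDet (suppFun K) ξ)) := fun ξ => by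
    have := hpow (Φ (ξ : Eucl n) * (suppFun K ξ * curvDet (suppFun K) ξ)) 1
    rw [one_pow, one_mul] at this
    rw [← this]
    refine intervalIntegral.integral_congr_ae (Eventually.of_forall fun r hr => ?_)
    rw [Set.uIoc_of_le zero_le_one] at hr
    have e : ‖r • (ξ : Eucl n)‖⁻¹ • r • (ξ : Eucl n) = ξ := by
      rw [norm_smul, mem_sphere_zero_iff_norm.1 ξ.2, mul_one, Real.norm_of_nonneg hr.1.le,
        inv_smul_smul₀ hr.1.ne']
    simp only [hg', e]
  rw [hl, hr] at hcv
  simp_rw [hl', hr', integral_const_mul] at hcv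
  exact mul_left_cancel₀ (inv_ne_zero hn') hcv

end IsSmoothBody

end

section

section
variable {E : Type*} [NormedAddCommGroup E] [InnerProductSpace ℝ E] [FiniteDimensional ℝ E]

lemma one_le_det_of_inner_self_le {C : E →ₗ[ℝ] E} (hC : C.IsSymmetric)
    (h : ∀ v, ⟪v, v⟫ ≤ ⟪v, C v⟫) : 1 ≤ LinearMap.det C := by
  rw [hC.det_eq_prod_eigenvalues rfl]
  refine Finset.one_le_prod fun i _ => ?_
  have h1 := h (hC.eigenvectorBasis rfl i)
  rw [hC.apply_eigenvectorBasis, real_inner_smul_right, real_inner_self_eq_norm_sq,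
    (hC.eigenvectorBasis rfl).norm_eq_one] at h1
  simpa using h1

lemma det_le_det_of_inner_le {A B : E →ₗ[ℝ] E} (hA : A.IsSymmetric) (hB : B.IsSymmetric)
    (hA0 : ∀ v, 0 ≤ ⟪v, A v⟫) (hAi : Function.Injective A) (hAB : ∀ v, ⟪v, A v⟫ ≤ ⟪v, B v⟫) :
    LinearMap.det A ≤ LinearMap.det B := by
  set b := hA.eigenvectorBasis rfl with hb
  set e := hA.eigenvalues rfl with he
  have hAb : ∀ i, A (b i) = e i • b i := fun i => hA.apply_eigenvectorBasis rfl i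
  have he0 : ∀ i, 0 < e i := fun i => by
    have h1 := hA0 (b i)
    rw [hAb, real_inner_smul_right, real_inner_self_eq_norm_sq, b.norm_eq_one] at h1
    refine lt_of_le_of_ne (by simpa using h1) fun h0 => ?_
    have h2 := hAb i
    rw [← h0, zero_smul, ← map_zero A] at h2
    exact b.toBasis.ne_zero i (by simpa using hAi h2)
  set S : E →ₗ[ℝ] E := ∑ i, (√(e i))⁻¹ • (innerₛₗ ℝ (b i)).smulRight (b i) with hS
  have hSv : ∀ v, S v = ∑ i, ((√(e i))⁻¹ * ⟪b i, v⟫) • b i := fun v => by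
    simp [hS, LinearMap.sum_apply, smul_smul]
  have hSsymm : S.IsSymmetric := fun v w => by
    rw [hSv, hSv, sum_inner, inner_sum]
    refine Finset.sum_congr rfl fun i _ => ?_
    rw [real_inner_smul_left, real_inner_smul_right, real_inner_comm (b i) v]
    ring
  have hSb : ∀ j, S (b j) = (√(e j))⁻¹ • b j := fun j => by
    classical
    rw [hSv, Finset.sum_eq_single j]
    · rw [real_inner_self_eq_norm_sq, b.norm_eq_one]; simp
    · intro i _ hij
      rw [b.inner_eq_zero hij]; simp
    · simp
  have hSAS : S ∘ₗ A ∘ₗ S = LinearMap.id := by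
    refine b.toBasis.ext fun j => ?_
    simp only [OrthonormalBasis.coe_toBasis, LinearMap.comp_apply, hSb, hAb, map_smul, smul_smul,
      LinearMap.id_apply]
    have h1 : √(e j) * √(e j) = e j := Real.mul_self_sqrt (he0 j).le
    have h2 : 0 < √(e j) := Real.sqrt_pos.2 (he0 j)
    rw [show (√(e j))⁻¹ * e j * (√(e j))⁻¹ = 1 by field_simp; nlinarith, one_smul]
  have hdet := congrArg LinearMap.det hSAS
  rw [LinearMap.det_comp, LinearMap.det_comp, LinearMap.det_id] at hdet
  have hdB : 1 ≤ LinearMap.det (S ∘ₗ B ∘ₗ S) := by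
    refine one_le_det_of_inner_self_le (fun v w => ?_) fun v => ?_
    · simp only [LinearMap.comp_apply]
      rw [hSsymm, hB, hSsymm]
    · have h1 : ⟪v, v⟫ = ⟪S v, A (S v)⟫ := by
        rw [hSsymm, ← LinearMap.comp_apply, ← LinearMap.comp_apply, LinearMap.comp_assoc, hSAS, LinearMap.id_apply]
      rw [h1, LinearMap.comp_apply, LinearMap.comp_apply, ← hSsymm]
      exact hAB _
  rw [LinearMap.det_comp, LinearMap.det_comp, ← hdet] at hdB
  have hs : 0 < LinearMap.det S * LinearMap.det S := by
    refine lt_of_le_of_ne (mul_self_nonneg _) fun h0 => ?_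
    rw [show LinearMap.det S * (LinearMap.det A * LinearMap.det S) =
      (LinearMap.det S * LinearMap.det S) * LinearMap.det A by ring, ← h0] at hdet
    simp at hdet
  refine le_of_mul_le_mul_left ?_ hs
  linarith

end

variable {n : ℕ} {K : Set (Eucl n)}

lemma IsSmoothBody.eventually_starPert_subset (h : IsSmoothBody K) {v : Eucl n → ℝ}
    (hv : ContinuousOn v (Metric.sphere 0 1)) {η : ℝ} (hη : 0 < η) :
    ∀ᶠ δ : ℝ in 𝓝[>] 0, ∀ K' : Set (Eucl n), IsBody K' →
      (∀ x ∈ Metric.sphere (0 : Eucl n) 1, suppFun K x * (1 + δ * v x) ≤ suppFun K' x) →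
      starPert K (fun z => v (normalAt K z) - η) δ ⊆ K' := by
  have hb := h.isBody
  obtain ⟨R, hR0, hR⟩ := hb.exists_radius
  obtain ⟨M, hM⟩ := (isCompact_sphere (0 : Eucl n) 1).exists_bound_of_continuousOn hv
  have hgrad : ContinuousOn (gradient (suppFun K)) (Metric.sphere 0 1) :=
    h.isSmoothHom.continuousOn_gradient.mono fun x hx => sphere_ne_zero hx
  set SS : Set (Eucl n × Eucl n) := Metric.sphere 0 1 ×ˢ Metric.sphere 0 1 with hSS
  have hSSc : IsCompact SS := (isCompact_sphere _ _).prod (isCompact_sphere _ _)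
  set Z : Set (Eucl n × Eucl n) := SS ∩ (fun p => v p.2 - v p.1) ⁻¹' Set.Ici η with hZ
  have hZc : IsCompact Z := by
    refine hSSc.of_isClosed_subset (ContinuousOn.preimage_isClosed_of_isClosed ?_
      hSSc.isClosed isClosed_Ici) Set.inter_subset_left
    exact (hv.comp continuousOn_snd fun p hp => hp.2).sub
      (hv.comp continuousOn_fst fun p hp => hp.1)
  have hF : ContinuousOn (fun p : Eucl n × Eucl n =>
      suppFun K p.1 - ⟪p.1, gradient (suppFun K) p.2⟫) Z := by
    refine ContinuousOn.mono ?_ (Set.inter_subset_left : Z ⊆ SS)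
    have := hb.continuous_suppFun
    refine ContinuousOn.sub (by fun_prop) (continuousOn_fst.inner
      (hgrad.comp continuousOn_snd fun p hp => hp.2))
  obtain ⟨c, hc0, hc⟩ : ∃ c : ℝ, 0 < c ∧ ∀ p ∈ Z,
      c ≤ suppFun K p.1 - ⟪p.1, gradient (suppFun K) p.2⟫ := by
    rcases Z.eq_empty_or_nonempty with h0 | h0
    · exact ⟨1, one_pos, by simp [h0]⟩
    obtain ⟨p, hp, hmin⟩ := hZc.exists_isMinOn h0 hF
    refine ⟨_, ?_, fun p' hp' => hmin hp'⟩
    obtain ⟨hg, hg2⟩ := h.gradient_mem (sphere_ne_zero hp.1.2)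
    refine lt_of_le_of_ne (sub_nonneg.2 (hb.inner_le _ hg)) fun h0 => ?_
    have he : p.1 = p.2 := h.eq_of_gradient_eq hp.1.1 hp.1.2
      (h.gradient_eq (sphere_ne_zero hp.1.1) hg (sub_eq_zero.1 h0.symm).symm)
    have := hp.2
    simp only [Set.mem_preimage, Set.mem_Ici, he, sub_self] at this
    linarith
  set B := |M| + 1 with hB
  have hB0 : 0 < B := by positivity
  have e1 : ∀ᶠ δ : ℝ in 𝓝[>] 0, δ * B ≤ 1 / 2 := by
    filter_upwards [Ioo_mem_nhdsGT (show (0 : ℝ) < 1 / 2 / B by positivity)] with δ hδ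
    exact ((lt_div_iff₀ hB0).1 hδ.2).le
  have e2 : ∀ᶠ δ : ℝ in 𝓝[>] 0, δ * (2 * B * (R + 1)) ≤ c := by
    filter_upwards [Ioo_mem_nhdsGT (show (0 : ℝ) < c / (2 * B * (R + 1)) by positivity)] with δ hδ
    exact ((lt_div_iff₀ (by positivity)).1 hδ.2).le
  filter_upwards [e1, e2, self_mem_nhdsWithin] with δ h1 h2 hδ0 K' hK' hle z hz
  have hδ0 : 0 < δ := hδ0
  have hvB : ∀ x ∈ Metric.sphere (0 : Eucl n) 1, |v x| ≤ B := fun x hx =>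
    (hM x hx).trans (by have := le_abs_self M; linarith)
  refine hK'.mem_of_forall_inner_le fun x hx => le_trans ?_ (hle x hx)
  have hx0 := hb.suppFun_pos (sphere_ne_zero hx)
  have hxR : suppFun K x ≤ R := by
    have := hb.suppFun_le_norm hR x
    rwa [mem_sphere_zero_iff_norm.1 hx, mul_one] at this
  have hvx := abs_le.1 (hvB x hx)
  have hpos : 0 < 1 + δ * v x := by nlinarith
  rcases eq_or_ne z 0 with rfl | hz0
  · rw [inner_zero_right]; positivity
  have hν := h.normalAt_mem hz0
  have hvν := abs_le.1 (hvB _ hν)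
  have hg0 := hb.gauge_pos hz0
  have hz : gauge K z ≤ 1 + δ * (v (normalAt K z) - η) := hz
  have hgw := h.gradient_normalAt hz0
  by_cases hcase : (x, normalAt K z) ∈ Z
  · have h3 := hc _ hcase
    simp only [hgw, real_inner_smul_right] at h3
    have h4 : ⟪x, z⟫ ≤ gauge K z * (suppFun K x - c) := by
      have : ⟪x, z⟫ = gauge K z * ((gauge K z)⁻¹ * ⟪x, z⟫) := by
        rw [mul_inv_cancel_left₀ hg0.ne']
      rw [this]
      exact mul_le_mul_of_nonneg_left (by linarith) hg0.le
    refine h4.trans ?_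
    rcases le_or_gt (suppFun K x - c) 0 with h5 | h5
    · exact (mul_nonpos_of_nonneg_of_nonpos hg0.le h5).trans (by positivity)
    · have h6 : gauge K z ≤ 1 + δ * B := hz.trans (by nlinarith)
      refine (mul_le_mul_of_nonneg_right h6 h5.le).trans ?_
      have h7 : δ * v x ≥ -(δ * B) := by nlinarith
      have h8 : suppFun K x * (δ * v x) ≥ suppFun K x * (-(δ * B)) :=
        mul_le_mul_of_nonneg_left h7 hx0.le
      have h9 : (δ * B) * (2 * suppFun K x) ≤ (δ * B) * (2 * (R + 1)) :=
        mul_le_mul_of_nonneg_left (by linarith) (by positivity)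
      have h10 : 0 ≤ δ * B * c := by positivity
      nlinarith
  · have h3 : v (normalAt K z) - v x < η := by
      by_contra! h4
      exact hcase ⟨⟨hx, hν⟩, h4⟩
    refine (hb.inner_le_gauge_mul x z).trans ?_
    rw [mul_comm]
    refine mul_le_mul_of_nonneg_left (hz.trans ?_) hx0.le
    have := mul_le_mul_of_nonneg_left (show v (normalAt K z) - η ≤ v x by linarith) hδ0.le
    linarith

end

section

section
variable {X : Type*} [MetricSpace X] [CompactSpace X] [MeasurableSpace X] [BorelSpace X]
  [SecondCountableTopology X]

lemma measureReal_ball_mul_integral (μ σ : Measure X) [IsFiniteMeasure μ] [IsFiniteMeasure σ]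
    (hσ : ∀ x y r, σ (Metric.ball x r) = σ (Metric.ball y r)) (x₀ : X) (r : ℝ) {g : X → ℝ}
    (hg : Continuous g) :
    Integrable (fun y => ∫ x in Metric.ball y r, g x ∂μ) σ ∧
      σ.real (Metric.ball x₀ r) * ∫ x, g x ∂μ = ∫ y, (∫ x in Metric.ball y r, g x ∂μ) ∂σ := by
  set D : Set (X × X) := {p | dist p.1 p.2 < r} with hD
  have hDm : MeasurableSet D := (isOpen_lt (by fun_prop) continuous_const).measurableSet
  set F : X × X → ℝ := D.indicator (fun p => g p.1) with hF
  have hgi : Integrable (fun p : X × X => g p.1) (μ.prod σ) := by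
    obtain ⟨C, hC⟩ := isCompact_univ.exists_bound_of_continuousOn
      (hg.comp continuous_fst : Continuous fun p : X × X => g p.1).continuousOn
    exact Integrable.of_bound (hg.comp continuous_fst).aestronglyMeasurable C
      (Eventually.of_forall fun p => hC p trivial)
  have hFi : Integrable F (μ.prod σ) := hgi.indicator hDm
  have hswap := integral_integral_swap (f := fun x y => F (x, y)) hFi
  have h1 : ∀ x, ∫ y, F (x, y) ∂σ = σ.real (Metric.ball x₀ r) * g x := fun x => by
    have : (fun y => F (x, y)) = (Metric.ball x r).indicator fun _ => g x := by
      ext y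
      by_cases h : y ∈ Metric.ball x r
      · rw [Set.indicator_of_mem h, hF, Set.indicator_of_mem]
        rw [Metric.mem_ball'] at h; exact h
      · rw [Set.indicator_of_notMem h, hF, Set.indicator_of_notMem]
        rw [Metric.mem_ball'] at h; exact h
    rw [this, integral_indicator Metric.isOpen_ball.measurableSet, setIntegral_const, smul_eq_mul,
      measureReal_def, measureReal_def, hσ x x₀]
  have h2 : ∀ y, ∫ x, F (x, y) ∂μ = ∫ x in Metric.ball y r, g x ∂μ := fun y => by
    have : (fun x => F (x, y)) = (Metric.ball y r).indicator g := by
      ext x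
      by_cases h : x ∈ Metric.ball y r
      · rw [Set.indicator_of_mem h, hF, Set.indicator_of_mem]
        exact h
      · rw [Set.indicator_of_notMem h, hF, Set.indicator_of_notMem]
        exact h
    rw [this, integral_indicator Metric.isOpen_ball.measurableSet]
  simp_rw [h1, h2, integral_const_mul] at hswap
  refine ⟨?_, hswap⟩
  have := hFi.integral_prod_right
  simp_rw [h2] at this
  exact this

/-- Two finite measures on a compact metric space whose balls have measure depending only on the
radius are proportional, in the sense of integrals of continuous functions. -/
lemma exists_integral_eq_mul_of_ball (μ σ : Measure X) [IsFiniteMeasure μ] [IsFiniteMeasure σ]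
    [σ.IsOpenPosMeasure] (hμ : ∀ x y r, μ (Metric.ball x r) = μ (Metric.ball y r))
    (hσ : ∀ x y r, σ (Metric.ball x r) = σ (Metric.ball y r)) :
    ∃ c : ℝ, 0 ≤ c ∧ ∀ g : X → ℝ, Continuous g → ∫ x, g x ∂μ = c * ∫ x, g x ∂σ := by
  rcases isEmpty_or_nonempty X with h | ⟨⟨x₀⟩⟩
  · exact ⟨0, le_rfl, fun g _ => by rw [integral_of_isEmpty, integral_of_isEmpty, mul_zero]⟩
  have hpos : ∀ r, 0 < r → 0 < σ.real (Metric.ball x₀ r) := fun r hr =>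
    ENNReal.toReal_pos (Metric.measure_ball_pos σ x₀ hr).ne' (measure_lt_top _ _).ne
  have hσ0 : 0 < σ.real Set.univ := (hpos 1 one_pos).trans_le (measureReal_mono (Set.subset_univ _))
  refine ⟨μ.real Set.univ / σ.real Set.univ, by positivity, fun g hg => ?_⟩
  refine eq_of_abs_sub_le_all fun ε hε => ?_
  set ε' := ε / (μ.real Set.univ + 1) with hε'
  have hε0 : 0 < ε' := by positivity
  obtain ⟨r, hr0, hr⟩ := Metric.uniformContinuous_iff.1
    (CompactSpace.uniformContinuous_of_continuous hg) ε' hε0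
  set s := σ.real (Metric.ball x₀ r) with hs
  set m := μ.real (Metric.ball x₀ r) with hm
  have hs0 : 0 < s := hpos r hr0
  have hgi : Integrable g μ := by
    obtain ⟨C, hC⟩ := isCompact_univ.exists_bound_of_continuousOn hg.continuousOn
    exact Integrable.of_bound hg.aestronglyMeasurable C (Eventually.of_forall fun p => hC p trivial)
  have hgi' : Integrable g σ := by
    obtain ⟨C, hC⟩ := isCompact_univ.exists_bound_of_continuousOn hg.continuousOn
    exact Integrable.of_bound hg.aestronglyMeasurable C (Eventually.of_forall fun p => hC p trivial)
  obtain ⟨-, hone⟩ := measureReal_ball_mul_integral μ σ hσ x₀ r (g := fun _ => (1 : ℝ)) continuous_const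
  have hmy : ∀ y, μ.real (Metric.ball y r) = m := fun y => by
    rw [hm, measureReal_def, measureReal_def, hμ y x₀]
  simp only [integral_const, smul_eq_mul, mul_one, measureReal_restrict_apply_univ, hmy] at hone
  rw [← hs] at hone
  obtain ⟨hint, hfub⟩ := measureReal_ball_mul_integral μ σ hσ x₀ r hg
  rw [← hs] at hfub
  have hloc : ∀ y, |(∫ x in Metric.ball y r, g x ∂μ) - m * g y| ≤ ε' * m := fun y => by
    have h1 : (∫ x in Metric.ball y r, g x ∂μ) - m * g y =
        ∫ x in Metric.ball y r, (g x - g y) ∂μ := by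
      rw [integral_sub hgi.integrableOn (integrable_const _), setIntegral_const, hmy, smul_eq_mul]
    rw [h1, ← hmy y, ← Real.norm_eq_abs]
    refine norm_setIntegral_le_of_norm_le_const (measure_lt_top _ _) fun x hx => ?_
    rw [← dist_eq_norm]
    exact (hr hx).le
  have hglob : |s * ∫ x, g x ∂μ - m * ∫ x, g x ∂σ| ≤ ε' * m * σ.real Set.univ := by
    rw [hfub, ← integral_const_mul, ← integral_sub hint (hgi'.const_mul m), ← Real.norm_eq_abs]
    exact norm_integral_le_of_norm_le_const (Eventually.of_forall fun y => hloc y)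
  have hm' : m = s * (μ.real Set.univ / σ.real Set.univ) := by
    field_simp
    linarith
  rw [show s * ∫ x, g x ∂μ - m * ∫ x, g x ∂σ = s * (∫ x, g x ∂μ -
    μ.real Set.univ / σ.real Set.univ * ∫ x, g x ∂σ) by rw [hm']; ring, abs_mul, abs_of_pos hs0,
    mul_assoc, mul_comm m, ← hone] at hglob
  refine (le_of_mul_le_mul_left (hglob.trans_eq (show _ = s * (ε' * μ.real Set.univ) by ring))
    hs0).trans ?_
  rw [hε', div_mul_eq_mul_div, div_le_iff₀ (by positivity)]
  nlinarith [measureReal_nonneg (μ := μ) (s := Set.univ)]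

end

end

section

section
variable {n : ℕ}

lemma exists_linearIsometryEquiv_map {x y : Eucl n} (hx : x ∈ Metric.sphere (0 : Eucl n) 1)
    (hy : y ∈ Metric.sphere (0 : Eucl n) 1) : ∃ L : Eucl n ≃ₗᵢ[ℝ] Eucl n, L x = y :=
  ⟨_, Submodule.reflection_sub (by
    rw [mem_sphere_zero_iff_norm.1 hx, mem_sphere_zero_iff_norm.1 hy])⟩

lemma image_coe_ball (x : Metric.sphere (0 : Eucl n) 1) (r : ℝ) :
    ((↑) '' Metric.ball x r : Set (Eucl n)) = Metric.sphere 0 1 ∩ Metric.ball (x : Eucl n) r := by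
  ext z
  constructor
  · rintro ⟨w, hw, rfl⟩
    exact ⟨w.2, hw⟩
  · rintro ⟨h1, h2⟩
    exact ⟨⟨z, h1⟩, h2, rfl⟩

lemma image_linearIsometryEquiv_ball (L : Eucl n ≃ₗᵢ[ℝ] Eucl n)
    {x y : Metric.sphere (0 : Eucl n) 1} (h : L x = y) (r : ℝ) :
    L '' ((↑) '' Metric.ball x r : Set (Eucl n)) = ((↑) '' Metric.ball y r : Set (Eucl n)) := by
  rw [image_coe_ball, image_coe_ball, Set.image_inter L.injective,
    LinearIsometryEquiv.image_ball, LinearIsometryEquiv.image_sphere, map_zero, h]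

open scoped Pointwise in
lemma toSphere_ball_eq (x y : Metric.sphere (0 : Eucl n) 1) (r : ℝ) :
    sphMeas n (Metric.ball x r) = sphMeas n (Metric.ball y r) := by
  obtain ⟨L, hL⟩ := exists_linearIsometryEquiv_map x.2 y.2
  rw [Measure.toSphere_apply' _ Metric.isOpen_ball.measurableSet,
    Measure.toSphere_apply' _ Metric.isOpen_ball.measurableSet,
    ← image_linearIsometryEquiv_ball L hL r]
  congr 1
  have h1 : Set.Ioo (0 : ℝ) 1 • (L '' ((↑) '' Metric.ball x r : Set (Eucl n))) =
      L '' (Set.Ioo (0 : ℝ) 1 • ((↑) '' Metric.ball x r : Set (Eucl n))) := by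
    ext z
    simp only [Set.mem_smul, Set.mem_image]
    constructor
    · rintro ⟨a, ha, _, ⟨w, hw, rfl⟩, rfl⟩
      exact ⟨a • w, ⟨a, ha, w, hw, rfl⟩, map_smul L a w⟩
    · rintro ⟨_, ⟨a, ha, w, hw, rfl⟩, rfl⟩
      exact ⟨a, ha, L w, ⟨w, hw, rfl⟩, (map_smul L a w).symm⟩
  rw [h1, L.image_eq_preimage_symm]
  exact (L.symm.measurePreserving.measure_preimage_emb
    L.symm.toHomeomorph.measurableEmbedding _).symm

lemma comap_hausdorffMeasure_ball_eq (d : ℝ) (x y : Metric.sphere (0 : Eucl n) 1) (r : ℝ) :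
    (Measure.comap Subtype.val μH[d] : Measure (Metric.sphere (0 : Eucl n) 1)) (Metric.ball x r) =
      (Measure.comap Subtype.val μH[d] : Measure (Metric.sphere (0 : Eucl n) 1))
        (Metric.ball y r) := by
  obtain ⟨L, hL⟩ := exists_linearIsometryEquiv_map x.2 y.2
  have hm : MeasurableEmbedding (Subtype.val : Metric.sphere (0 : Eucl n) 1 → Eucl n) :=
    MeasurableEmbedding.subtype_coe Metric.isClosed_sphere.measurableSet
  rw [hm.comap_apply, hm.comap_apply, ← image_linearIsometryEquiv_ball L hL r]
  exact (L.toIsometryEquiv.hausdorffMeasure_image d _).symm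

variable {K : Set (Eucl n)}

lemma IsBody.continuousOn_radFun (hK : IsBody K) :
    ContinuousOn (radFun K) {0}ᶜ := by
  refine ContinuousOn.congr (f := fun x => (gauge K x)⁻¹) ?_ fun x hx => hK.radFun_eq hx
  exact hK.continuous_gauge.continuousOn.inv₀ fun x hx => (hK.gauge_pos hx).ne'

/-- `theta`, computed with the surface measure of the sphere instead of the Hausdorff measure. -/
def sphTheta (q p : ℝ) (f : Eucl n → ℝ) (K : Set (Eucl n)) : ℝ :=
  (∫ ξ, Vtilde q K (radFun K (ξ : Eucl n) • (ξ : Eucl n)) * radFun K (ξ : Eucl n) ^ n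
    ∂(sphMeas n)) / ∫ x, suppFun K (x : Eucl n) ^ p * f (x : Eucl n) ∂(sphMeas n)

variable {q p : ℝ} {f : Eucl n → ℝ}

lemma IsBody.continuous_chord_integrand (hn : 0 < n) (hq : 1 < q) (hK : IsBody K) :
    Continuous fun ξ : Metric.sphere (0 : Eucl n) 1 =>
      Vtilde q K (radFun K (ξ : Eucl n) • (ξ : Eucl n)) * radFun K (ξ : Eucl n) ^ n := by
  have h1 : Continuous fun ξ : Metric.sphere (0 : Eucl n) 1 => radFun K (ξ : Eucl n) :=
    hK.continuousOn_radFun.comp_continuous continuous_subtype_val fun ξ => sphere_ne_zero ξ.2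
  exact ((continuous_Vtilde hn hq hK).comp (h1.smul continuous_subtype_val)).mul (h1.pow n)

lemma IsBody.continuous_suppFun_rpow_mul (hf : Continuous f) (hK : IsBody K) :
    Continuous fun x : Metric.sphere (0 : Eucl n) 1 =>
      suppFun K (x : Eucl n) ^ p * f (x : Eucl n) := by
  refine Continuous.mul ?_ (hf.comp continuous_subtype_val)
  exact (hK.continuous_suppFun.comp continuous_subtype_val).rpow_const fun x =>
    Or.inl (hK.suppFun_pos (sphere_ne_zero x.2)).ne'

lemma IsBody.integral_suppFun_rpow_mul_pos (hn : 0 < n) (p : ℝ) (hf : Continuous f)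
    (hfpos : ∀ x ∈ Metric.sphere (0 : Eucl n) 1, 0 < f x) (hK : IsBody K) :
    0 < ∫ x, suppFun K (x : Eucl n) ^ p * f (x : Eucl n) ∂(sphMeas n) := by
  have hpos : ∀ x : Metric.sphere (0 : Eucl n) 1,
      0 < suppFun K (x : Eucl n) ^ p * f (x : Eucl n) := fun x =>
    mul_pos (Real.rpow_pos_of_pos (hK.suppFun_pos (sphere_ne_zero x.2)) p) (hfpos x x.2)
  have : Nonempty (Fin n) := ⟨⟨0, hn⟩⟩
  obtain ⟨x⟩ : Nonempty (Metric.sphere (0 : Eucl n) 1) :=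
    (NormedSpace.sphere_nonempty.2 zero_le_one).to_subtype
  exact (hK.continuous_suppFun_rpow_mul hf).integral_pos_of_hasCompactSupport_nonneg_nonzero
    (HasCompactSupport.of_compactSpace _) (fun x => (hpos x).le) (hpos x).ne'

lemma sphTheta_nonneg (hfpos : ∀ x ∈ Metric.sphere (0 : Eucl n) 1, 0 < f x) (hK : IsBody K) :
    0 ≤ sphTheta q p f K := by
  refine div_nonneg (integral_nonneg fun ξ => mul_nonneg (Vtilde_nonneg _ _)
    (pow_nonneg (hK.radFun_pos (sphere_ne_zero ξ.2)).le n)) (integral_nonneg fun x => ?_)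
  exact mul_nonneg (Real.rpow_nonneg (hK.suppFun_nonneg _) p) (hfpos x x.2).le

lemma theta_eq_zero_or_eq_sphTheta (hn : 0 < n) (hq : 1 < q) (p : ℝ) (hf : Continuous f)
    (hfpos : ∀ x ∈ Metric.sphere (0 : Eucl n) 1, 0 < f x) :
    (∀ K : Set (Eucl n), IsBody K → theta q p f K = 0) ∨
      ∀ K : Set (Eucl n), IsBody K → theta q p f K = sphTheta q p f K := by
  have hSm : MeasurableSet (Metric.sphere (0 : Eucl n) 1) := Metric.isClosed_sphere.measurableSet
  by_cases hfin : μH[(n : ℝ) - 1] (Metric.sphere (0 : Eucl n) 1) < ⊤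
  · set μ : Measure (Metric.sphere (0 : Eucl n) 1) := Measure.comap Subtype.val μH[(n : ℝ) - 1]
      with hμ
    have : IsFiniteMeasure μ := ⟨by
      rw [hμ, (MeasurableEmbedding.subtype_coe hSm).comap_apply]
      rwa [Set.image_univ, Subtype.range_coe]⟩
    obtain ⟨c, -, hc⟩ := exists_integral_eq_mul_of_ball μ (sphMeas n)
      (comap_hausdorffMeasure_ball_eq _) toSphere_ball_eq
    have hth : ∀ K : Set (Eucl n), IsBody K → theta q p f K =
        (c * ∫ ξ, Vtilde q K (radFun K (ξ : Eucl n) • (ξ : Eucl n)) * radFun K (ξ : Eucl n) ^ n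
          ∂(sphMeas n)) /
          (c * ∫ x, suppFun K (x : Eucl n) ^ p * f (x : Eucl n) ∂(sphMeas n)) := fun K hK => by
      rw [theta, ← integral_subtype_comap hSm, ← integral_subtype_comap hSm,
        ← hc _ (hK.continuous_chord_integrand hn hq), ← hc _ (hK.continuous_suppFun_rpow_mul hf)]
    rcases eq_or_ne c 0 with h0 | h0
    · left
      intro K hK
      rw [hth K hK, h0, zero_mul, zero_div]
    · right
      intro K hK
      rw [hth K hK, mul_div_mul_left _ _ h0, sphTheta]
  · left
    intro K hK
    rw [theta, integral_undef (f := fun x => suppFun K x ^ p * f x), div_zero]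
    intro hint
    have hcont : ContinuousOn (fun x : Eucl n => suppFun K x ^ p * f x) (Metric.sphere 0 1) :=
      continuousOn_iff_continuous_domRestrict.2 (hK.continuous_suppFun_rpow_mul hf)
    have hpos : ∀ x ∈ Metric.sphere (0 : Eucl n) 1, 0 < suppFun K x ^ p * f x := fun x hx =>
      mul_pos (Real.rpow_pos_of_pos (hK.suppFun_pos (sphere_ne_zero hx)) p) (hfpos x hx)
    obtain ⟨c, hc0, hc⟩ : ∃ c : ℝ, 0 < c ∧
        ∀ x ∈ Metric.sphere (0 : Eucl n) 1, c ≤ suppFun K x ^ p * f x :=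
      (isCompact_sphere _ _).exists_forall_le' hcont hpos
    have h1 : IntegrableOn (fun _ : Eucl n => c) (Metric.sphere 0 1) μH[(n : ℝ) - 1] := by
      refine Integrable.mono' hint aestronglyMeasurable_const
        ((ae_restrict_iff' hSm).2 (Eventually.of_forall fun x hx => ?_))
      rw [Real.norm_of_nonneg hc0.le]
      exact hc x hx
    rw [integrableOn_const_iff] at h1
    rcases h1 with h1 | h1
    · simp [hc0.ne'] at h1
    · exact hfin h1

lemma theta_nonneg (hn : 0 < n) (hq : 1 < q) (hf : Continuous f)
    (hfpos : ∀ x ∈ Metric.sphere (0 : Eucl n) 1, 0 < f x) (hK : IsBody K) :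
    0 ≤ theta q p f K := by
  rcases theta_eq_zero_or_eq_sphTheta hn hq p hf hfpos with h | h
  · rw [h K hK]
  · rw [h K hK]; exact sphTheta_nonneg hfpos hK

lemma theta_mul_integral_le (hn : 0 < n) (hq : 1 < q) (hf : Continuous f)
    (hfpos : ∀ x ∈ Metric.sphere (0 : Eucl n) 1, 0 < f x) (hK : IsBody K) :
    theta q p f K * ∫ x, suppFun K (x : Eucl n) ^ p * f (x : Eucl n) ∂(sphMeas n) ≤
      ∫ ξ, Vtilde q K (radFun K (ξ : Eucl n) • (ξ : Eucl n)) * radFun K (ξ : Eucl n) ^ n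
        ∂(sphMeas n) := by
  rcases theta_eq_zero_or_eq_sphTheta hn hq p hf hfpos with h | h
  · rw [h K hK, zero_mul]
    exact integral_nonneg fun ξ => mul_nonneg (Vtilde_nonneg _ _)
      (pow_nonneg (hK.radFun_pos (sphere_ne_zero ξ.2)).le n)
  · rw [h K hK, sphTheta,
      div_mul_cancel₀ _ (hK.integral_suppFun_rpow_mul_pos hn p hf hfpos).ne']

end

end

section

lemma IsCompact.eventually_forall_of_ultrafilter {ι X : Type*} [TopologicalSpace X] {l : Filter ι}
    {s : Set X} (hs : IsCompact s) {P : ι → X → Prop}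
    (h : ∀ U : Ultrafilter ι, ↑U ≤ l → ∀ y : ι → X, (∀ i, y i ∈ s) → ∀ x ∈ s,
      Tendsto y U (𝓝 x) → ∀ᶠ i in (U : Filter ι), P i (y i)) :
    ∀ᶠ i in l, ∀ x ∈ s, P i x := by
  classical
  by_contra hc
  rw [Filter.not_eventually] at hc
  rcases s.eq_empty_or_nonempty with rfl | ⟨x₀, hx₀⟩
  · simp at hc
  set S : Set ι := {i | ¬ ∀ x ∈ s, P i x} with hS
  have hne : NeBot (l ⊓ 𝓟 S) := frequently_mem_iff_neBot.1 hc
  set U := Ultrafilter.of (l ⊓ 𝓟 S) with hU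
  have hUl : (U : Filter ι) ≤ l ⊓ 𝓟 S := Ultrafilter.of_le _
  have hex : ∀ i, ∃ x ∈ s, i ∈ S → ¬ P i x := fun i => by
    by_cases hi : i ∈ S
    · have hi' : ¬ ∀ x ∈ s, P i x := hi
      push Not at hi'
      obtain ⟨x, hx, hP⟩ := hi'
      exact ⟨x, hx, fun _ => hP⟩
    · exact ⟨x₀, hx₀, fun h => absurd h hi⟩
  choose y hy hyP using hex
  obtain ⟨x, hx, hyx⟩ := hs.ultrafilter_le_nhds' (U.map y)
    (Filter.mem_map.2 (Filter.univ_mem' hy))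
  have h1 := h U (hUl.trans inf_le_left) y hy x hx hyx
  have h2 : ∀ᶠ i in (U : Filter ι), i ∈ S := hUl.trans inf_le_right (mem_principal_self S)
  obtain ⟨i, hi1, hi2⟩ := (h1.and h2).exists
  exact hyP i hi2 hi1

variable {n : ℕ} {ι : Type*} {A : ι → Set (Eucl n)} {l : Filter ι} {K : Set (Eucl n)} {R : ℝ}

/-- A uniformly bounded family of smooth bodies whose support functions converge pointwise. -/
structure SuppTendsto (A : ι → Set (Eucl n)) (l : Filter ι) (K : Set (Eucl n)) (R : ℝ) :
    Prop where
  body : ∀ i, IsSmoothBody (A i)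
  lim : IsSmoothBody K
  bound_nonneg : 0 ≤ R
  subset : ∀ i, A i ⊆ Metric.closedBall 0 R
  subset_lim : K ⊆ Metric.closedBall 0 R
  tendsto : ∀ x, Tendsto (fun i => suppFun (A i) x) l (𝓝 (suppFun K x))

namespace SuppTendsto

lemma comp (h : SuppTendsto A l K R) {κ : Type*} {m : Filter κ} {u : κ → ι}
    (hu : Tendsto u m l) : SuppTendsto (fun j => A (u j)) m K R :=
  ⟨fun _ => h.body _, h.lim, h.bound_nonneg, fun _ => h.subset _, h.subset_lim,
    fun x => (h.tendsto x).comp hu⟩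

lemma mono (h : SuppTendsto A l K R) {m : Filter ι} (hm : m ≤ l) : SuppTendsto A m K R :=
  h.comp (u := id) (tendsto_id.mono_left hm)

lemma suppFun (h : SuppTendsto A l K R) {y : ι → Eucl n} {x : Eucl n} (hy : Tendsto y l (𝓝 x)) :
    Tendsto (fun i => _root_.suppFun (A i) (y i)) l (𝓝 (_root_.suppFun K x)) := by
  have h1 : Tendsto (fun i => _root_.suppFun (A i) (y i) - _root_.suppFun (A i) x) l (𝓝 0) := by
    have h2 : Tendsto (fun i => R * ‖y i - x‖) l (𝓝 0) := by
      have := (tendsto_iff_norm_sub_tendsto_zero.1 hy).const_mul R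
      simpa using this
    exact squeeze_zero_norm (fun i => (h.body i).isBody.abs_suppFun_sub_le (h.subset i) _ _) h2
  simpa using h1.add (h.tendsto x)

lemma eventually_abs_sub_le (h : SuppTendsto A l K R) {ε : ℝ} (hε : 0 < ε) :
    ∀ᶠ i in l, ∀ x ∈ Metric.sphere (0 : Eucl n) 1,
      |_root_.suppFun (A i) x - _root_.suppFun K x| ≤ ε := by
  refine (isCompact_sphere _ _).eventually_forall_of_ultrafilter fun U hU y hy x hx hyx => ?_
  have h1 := (h.mono hU).suppFun hyx
  have h2 := (h.lim.isBody.continuous_suppFun.tendsto x).comp hyx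
  have h3 := (h1.sub h2).abs
  rw [sub_self, abs_zero] at h3
  exact (h3.eventually (gt_mem_nhds hε)).mono fun i hi => hi.le

lemma bodyTendsto (h : SuppTendsto A l K R) : BodyTendsto A l K := by
  intro ε hε0 hε1
  obtain ⟨c, hc0, hc⟩ : ∃ c : ℝ, 0 < c ∧
      ∀ x ∈ Metric.sphere (0 : Eucl n) 1, c ≤ _root_.suppFun K x :=
    (isCompact_sphere _ _).exists_forall_le' h.lim.isBody.continuous_suppFun.continuousOn
      fun x hx => h.lim.isBody.suppFun_pos (sphere_ne_zero hx)
  filter_upwards [h.eventually_abs_sub_le (show 0 < ε * c by positivity)] with i hi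
  refine ⟨fun z hz => (h.body i).isBody.mem_of_forall_inner_le fun x hx => ?_, fun z hz =>
    h.lim.isBody.gauge_le (by linarith) fun x hx => ?_⟩
  · have h1 := abs_le.1 (hi x hx)
    have h2 := h.lim.isBody.inner_le_gauge_mul x z
    have h3 := hc x hx
    nlinarith
  · have h1 := abs_le.1 (hi x hx)
    have h2 := (h.body i).isBody.inner_le x hz
    have h3 := hc x hx
    nlinarith

lemma gradient (h : SuppTendsto A l K R) {y : ι → Eucl n} {x : Eucl n} (hx : x ≠ 0)
    (hy : Tendsto y l (𝓝 x)) :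
    Tendsto (fun i => _root_.gradient (_root_.suppFun (A i)) (y i)) l
      (𝓝 (_root_.gradient (_root_.suppFun K) x)) := by
  have hev : ∀ᶠ i in l, y i ≠ 0 := hy.eventually_ne hx
  refine (isCompact_closedBall (0 : Eucl n) R).tendsto_nhds_of_unique_mapClusterPt
    (hev.mono fun i hi => h.subset i ((h.body i).gradient_mem hi).1) fun g _ hcl => ?_
  obtain ⟨U, hU, hg⟩ := mapClusterPt_iff_ultrafilter.1 hcl
  have hU' := h.mono hU
  have hevU : ∀ᶠ i in (U : Filter ι), y i ≠ 0 := hU hev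
  refine (h.lim.gradient_eq hx (h.lim.isBody.mem_of_forall_inner_le fun w hw => ?_) ?_).symm
  · refine le_of_tendsto_of_tendsto (tendsto_const_nhds.inner hg) (hU'.tendsto w)
      (hevU.mono fun i hi => (h.body i).isBody.inner_le w ((h.body i).gradient_mem hi).1)
  · refine tendsto_nhds_unique ((hy.mono_left hU).inner hg) ((hU'.suppFun (hy.mono_left hU)).congr'
      (hevU.mono fun i hi => ((h.body i).gradient_mem hi).2.symm))

lemma tendsto_gauge (h : SuppTendsto A l K R) (z : Eucl n) :
    Tendsto (fun i => gauge (A i) z) l (𝓝 (gauge K z)) := by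
  rcases eq_or_ne z 0 with rfl | hz
  · simp only [gauge_zero]
    exact tendsto_const_nhds
  have hb := h.lim.isBody
  have hg := hb.gauge_pos hz
  have hlow : ∀ ε : ℝ, 0 < ε → ε < 1 → ∀ᶠ i in l, gauge K z / (1 + ε) ≤ gauge (A i) z ∧
      gauge (A i) z ≤ gauge K z / (1 - ε) := fun ε h0 h1 => by
    filter_upwards [h.bodyTendsto ε h0 h1] with i ⟨hi1, hi2⟩
    have hbi := (h.body i).isBody
    have hgi := hbi.gauge_pos hz
    constructor
    · have := hi2 _ (hbi.inv_gauge_smul_mem hz)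
      rw [hb.gauge_smul (by positivity), inv_mul_le_iff₀ hgi] at this
      rw [div_le_iff₀ (by linarith)]
      linarith
    · have h1' : (0 : ℝ) < 1 - ε := by linarith
      have := hi1 (((1 - ε) / gauge K z) • z)
        (by rw [hb.gauge_smul (by positivity), div_mul_cancel₀ _ hg.ne'])
      rw [← hbi.gauge_le_one_iff, hbi.gauge_smul (by positivity)] at this
      rw [le_div_iff₀ h1']
      rw [div_mul_eq_mul_div, div_le_one hg] at this
      linarith
  have hc1 : Tendsto (fun ε : ℝ => gauge K z / (1 + ε)) (𝓝[>] 0) (𝓝 (gauge K z)) := by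
    have : ContinuousAt (fun ε : ℝ => gauge K z / (1 + ε)) 0 :=
      continuousAt_const.div (by fun_prop) (by norm_num)
    simpa [ContinuousAt] using this.tendsto.mono_left (nhdsWithin_le_nhds (s := Set.Ioi 0))
  have hc2 : Tendsto (fun ε : ℝ => gauge K z / (1 - ε)) (𝓝[>] 0) (𝓝 (gauge K z)) := by
    have : ContinuousAt (fun ε : ℝ => gauge K z / (1 - ε)) 0 :=
      continuousAt_const.div (by fun_prop) (by norm_num)
    simpa [ContinuousAt] using this.tendsto.mono_left (nhdsWithin_le_nhds (s := Set.Ioi 0))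
  refine tendsto_order.2 ⟨fun a ha => ?_, fun a ha => ?_⟩
  · obtain ⟨ε, h1, h2⟩ := ((hc1.eventually (lt_mem_nhds ha)).and (Ioo_mem_nhdsGT one_pos)).exists
    exact (hlow ε h2.1 h2.2).mono fun i hi => h1.trans_le hi.1
  · obtain ⟨ε, h1, h2⟩ := ((hc2.eventually (gt_mem_nhds ha)).and (Ioo_mem_nhdsGT one_pos)).exists
    exact (hlow ε h2.1 h2.2).mono fun i hi => hi.2.trans_lt h1

variable {q p : ℝ} {f : Eucl n → ℝ}

lemma tendsto_Vtilde_prod [l.IsCountablyGenerated] (hn : 0 < n) (hq : 1 < q)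
    (h : SuppTendsto A l K R) (y₀ : Eucl n) :
    Tendsto (fun p : ι × Eucl n => Vtilde q (A p.1) p.2) (l ×ˢ 𝓝 y₀) (𝓝 (Vtilde q K y₀)) :=
  tendsto_Vtilde (ι := ι × Eucl n) (l := l ×ˢ 𝓝 y₀) (A := fun p => A p.1)
    (y := fun p : ι × Eucl n => p.2) hn hq
    (fun p => (h.body p.1).isBody.measurableSet) h.lim.isBody
    (h.bodyTendsto.comp tendsto_fst) tendsto_snd

lemma tendsto_sphTheta [l.IsCountablyGenerated] (hn : 0 < n) (hq : 1 < q) (hp : 0 ≤ p)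
    (hf : Continuous f) (hfpos : ∀ x ∈ Metric.sphere (0 : Eucl n) 1, 0 < f x)
    (h : SuppTendsto A l K R) :
    Tendsto (fun i => sphTheta q p f (A i)) l (𝓝 (sphTheta q p f K)) := by
  have hb := h.lim.isBody
  obtain ⟨C, hC0, hC⟩ := exists_Vtilde_le (n := n) (q := q) hn hq R
  obtain ⟨M, hM⟩ := (isCompact_sphere (0 : Eucl n) 1).exists_bound_of_continuousOn hf.continuousOn
  have hR := h.bound_nonneg
  refine Tendsto.div ?_ ?_ ?_
  · refine tendsto_integral_filter_of_dominated_convergence (fun _ => C * R ^ n)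
      (Eventually.of_forall fun i =>
        ((h.body i).isBody.continuous_chord_integrand hn hq).aestronglyMeasurable)
      (Eventually.of_forall fun i => Eventually.of_forall fun ξ => ?_) (integrable_const _)
      (Eventually.of_forall fun ξ => ?_)
    · have hbi := (h.body i).isBody
      have h1 := (hbi.radFun_pos (sphere_ne_zero ξ.2)).le
      have h2 : radFun (A i) (ξ : Eucl n) ≤ R := hbi.radFun_le (h.subset i) ξ.2
      rw [Real.norm_of_nonneg (mul_nonneg (Vtilde_nonneg _ _) (by positivity))]
      refine mul_le_mul (hC _ hbi.measurableSet (h.subset i) _ ?_) (pow_le_pow_left₀ h1 h2 n)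
        (by positivity) hC0.le
      rw [mem_closedBall_zero_iff, norm_smul, mem_sphere_zero_iff_norm.1 ξ.2, mul_one,
        Real.norm_of_nonneg h1]
      exact h2
    · have hρ : Tendsto (fun i => radFun (A i) (ξ : Eucl n)) l (𝓝 (radFun K (ξ : Eucl n))) := by
        simp_rw [fun i => (h.body i).isBody.radFun_eq (sphere_ne_zero ξ.2),
          hb.radFun_eq (sphere_ne_zero ξ.2)]
        exact (h.tendsto_gauge _).inv₀ (hb.gauge_pos (sphere_ne_zero ξ.2)).ne'
      exact (tendsto_Vtilde hn hq (fun i => (h.body i).isBody.measurableSet) hb h.bodyTendsto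
        (hρ.smul_const _)).mul (hρ.pow n)
  · refine tendsto_integral_filter_of_dominated_convergence (fun _ => R ^ p * M)
      (Eventually.of_forall fun i =>
        ((h.body i).isBody.continuous_suppFun_rpow_mul hf).aestronglyMeasurable)
      (Eventually.of_forall fun i => Eventually.of_forall fun x => ?_) (integrable_const _)
      (Eventually.of_forall fun x => ?_)
    · have hbi := (h.body i).isBody
      have h1 := (hbi.suppFun_pos (sphere_ne_zero x.2)).le
      have h2 : _root_.suppFun (A i) (x : Eucl n) ≤ R := by
        have := hbi.suppFun_le_norm (h.subset i) (x : Eucl n)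
        rwa [mem_sphere_zero_iff_norm.1 x.2, mul_one] at this
      rw [norm_mul, Real.norm_of_nonneg (Real.rpow_nonneg h1 p)]
      exact mul_le_mul (Real.rpow_le_rpow h1 h2 hp) (hM _ x.2) (norm_nonneg _) (by positivity)
    · exact ((h.tendsto _).rpow_const (Or.inr hp)).mul_const _
  · exact (hb.integral_suppFun_rpow_mul_pos hn p hf hfpos).ne'

lemma tendsto_theta [l.IsCountablyGenerated] (hn : 0 < n) (hq : 1 < q) (hp : 0 ≤ p)
    (hf : Continuous f) (hfpos : ∀ x ∈ Metric.sphere (0 : Eucl n) 1, 0 < f x)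
    (h : SuppTendsto A l K R) :
    Tendsto (fun i => theta q p f (A i)) l (𝓝 (theta q p f K)) := by
  rcases theta_eq_zero_or_eq_sphTheta hn hq p hf hfpos with h1 | h1
  · simp_rw [fun i => h1 _ (h.body i).isBody, h1 _ h.lim.isBody]
    exact tendsto_const_nhds
  · simp_rw [fun i => h1 _ (h.body i).isBody, h1 _ h.lim.isBody]
    exact h.tendsto_sphTheta hn hq hp hf hfpos

end SuppTendsto

end

section

variable {n : ℕ} {q p T : ℝ} {f : Eucl n → ℝ}

/-- The standing assumptions on a solution of the flow, in positive dimension. -/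
structure FlowSolution (q p T : ℝ) (f : Eucl n → ℝ) (K : ℝ → Set (Eucl n)) : Prop where
  dim_pos : 0 < n
  one_lt : 1 < q
  nonneg : 0 ≤ p
  time_pos : 0 < T
  continuous : Continuous f
  pos : ∀ x ∈ Metric.sphere (0 : Eucl n) 1, 0 < f x
  smooth : ∀ t ∈ Set.Ico (0 : ℝ) T, IsSmoothBody (K t)
  flow : IsGaussChordFlow q p f (Set.Ico 0 T) K

lemma IsSmoothBody.flowRHS_le {K : Set (Eucl n)} (h : IsSmoothBody K) (hn : 0 < n) (hq : 1 < q)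
    (hf : Continuous f) (hfpos : ∀ x ∈ Metric.sphere (0 : Eucl n) 1, 0 < f x) {x : Eucl n}
    (hx : x ∈ Metric.sphere (0 : Eucl n) 1) : flowRHS q p f K x ≤ suppFun K x := by
  have h1 := theta_nonneg (q := q) (p := p) hn hq hf hfpos h.isBody
  have h2 := (Real.rpow_pos_of_pos (h.isBody.suppFun_pos (sphere_ne_zero hx)) p).le
  have h3 := (inv_pos.2 (h.2.2.2.2.2 x hx)).le
  have h4 := (hfpos x hx).le
  have h5 := Vtilde_nonneg (q := q) K (gradient (suppFun K) x)
  have : 0 ≤ theta q p f K * suppFun K x ^ p * (curvDet (suppFun K) x)⁻¹ * f x /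
      Vtilde q K (gradient (suppFun K) x) := by positivity
  rw [flowRHS, neg_mul, neg_mul, neg_mul, neg_div]
  linarith

namespace FlowSolution

variable {K : ℝ → Set (Eucl n)}

lemma suppFun_le_exp (F : FlowSolution q p T f K) {t : ℝ} (ht : t ∈ Set.Ico 0 T) {x : Eucl n}
    (hx : x ∈ Metric.sphere (0 : Eucl n) 1) :
    suppFun (K t) x ≤ Real.exp t * suppFun (K 0) x := by
  have hd : ∀ s ∈ Set.Ico 0 T, HasDerivWithinAt (fun s => Real.exp (-s) * suppFun (K s) x)
      (Real.exp (-s) * (-1) * suppFun (K s) x + Real.exp (-s) * flowRHS q p f (K s) x)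
      (Set.Ico 0 T) s := fun s hs =>
    ((hasDerivAt_neg s).exp.hasDerivWithinAt).mul (F.flow s hs x hx)
  have hanti : AntitoneOn (fun s => Real.exp (-s) * suppFun (K s) x) (Set.Ico 0 T) := by
    refine antitoneOn_of_hasDerivWithinAt_nonpos (convex_Ico 0 T)
      (fun s hs => (hd s hs).continuousWithinAt)
      (fun s hs => (hd s (interior_subset hs)).mono interior_subset) fun s hs => ?_
    have h1 := (F.smooth s (interior_subset hs)).flowRHS_le (p := p) F.dim_pos F.one_lt
      F.continuous F.pos hx
    have h2 := Real.exp_pos (-s)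
    nlinarith
  have h1 := hanti ⟨le_rfl, F.time_pos⟩ ht ht.1
  simp only [neg_zero, Real.exp_zero, one_mul] at h1
  rw [Real.exp_neg, inv_mul_le_iff₀ (Real.exp_pos t)] at h1
  exact h1

lemma exists_bound (F : FlowSolution q p T f K) :
    ∃ R : ℝ, 0 < R ∧ ∀ t ∈ Set.Ico 0 T, K t ⊆ Metric.closedBall 0 R := by
  obtain ⟨R₀, hR₀, hK₀⟩ := (F.smooth 0 ⟨le_rfl, F.time_pos⟩).isBody.exists_radius
  refine ⟨Real.exp T * R₀, by positivity, fun t ht z hz => ?_⟩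
  rw [mem_closedBall_zero_iff]
  rcases eq_or_ne z 0 with rfl | hz0
  · rw [norm_zero]; positivity
  have hzn : 0 < ‖z‖ := norm_pos_iff.2 hz0
  have hx : ‖z‖⁻¹ • z ∈ Metric.sphere (0 : Eucl n) 1 := by
    rw [mem_sphere_zero_iff_norm, norm_smul, norm_inv, norm_norm, inv_mul_cancel₀ hzn.ne']
  have h1 := (F.smooth t ht).isBody.inner_le (‖z‖⁻¹ • z) hz
  rw [real_inner_smul_left, real_inner_self_eq_norm_sq, pow_two, ← mul_assoc,
    inv_mul_cancel₀ hzn.ne', one_mul] at h1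
  have h2 := F.suppFun_le_exp ht hx
  have h3 := (F.smooth 0 ⟨le_rfl, F.time_pos⟩).isBody.suppFun_le_norm hK₀ (‖z‖⁻¹ • z)
  rw [mem_sphere_zero_iff_norm.1 hx, mul_one] at h3
  calc ‖z‖ ≤ Real.exp t * suppFun (K 0) (‖z‖⁻¹ • z) := h1.trans h2
    _ ≤ Real.exp t * R₀ := by gcongr
    _ ≤ Real.exp T * R₀ := by gcongr; exact ht.2.le

lemma suppTendsto (F : FlowSolution q p T f K) {R : ℝ} (hR : 0 < R)
    (hKR : ∀ t ∈ Set.Ico 0 T, K t ⊆ Metric.closedBall 0 R) (t₀ : Set.Ico (0 : ℝ) T) :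
    SuppTendsto (fun t : Set.Ico (0 : ℝ) T => K t) (𝓝 t₀) (K t₀) R := by
  refine ⟨fun t => F.smooth t t.2, F.smooth t₀ t₀.2, hR.le, fun t => hKR t t.2, hKR t₀ t₀.2,
    fun x => ?_⟩
  rcases eq_or_ne x 0 with rfl | hx0
  · simp_rw [fun t : Set.Ico (0 : ℝ) T => (F.smooth t t.2).isBody.suppFun_zero]
    exact tendsto_const_nhds
  have hxn : 0 < ‖x‖ := norm_pos_iff.2 hx0
  have hx : ‖x‖⁻¹ • x ∈ Metric.sphere (0 : Eucl n) 1 := by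
    rw [mem_sphere_zero_iff_norm, norm_smul, norm_inv, norm_norm, inv_mul_cancel₀ hxn.ne']
  have hs : ∀ t : Set.Ico (0 : ℝ) T, suppFun (K t) x = ‖x‖ * suppFun (K t) (‖x‖⁻¹ • x) := fun t => by
    rw [← (F.smooth t t.2).isBody.suppFun_smul hxn.le, smul_inv_smul₀ hxn.ne']
  simp_rw [hs]
  refine Tendsto.const_mul _ ?_
  have := (F.flow t₀ t₀.2 _ hx).continuousWithinAt.tendsto
  rw [← map_nhds_subtype_val] at this
  exact this

end FlowSolution

end

section

section LinearAlgebra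

variable {E : Type*} [NormedAddCommGroup E] [InnerProductSpace ℝ E]

lemma inner_self_pos_of_injective {A : E →ₗ[ℝ] E} (hA : A.IsSymmetric)
    (hA0 : ∀ v, 0 ≤ ⟪v, A v⟫) (hAi : Function.Injective A) {v : E} (hv : v ≠ 0) :
    0 < ⟪v, A v⟫ := by
  refine (hA0 v).lt_of_ne' fun h0 => hv (hAi ?_)
  rw [map_zero]
  set b := ⟪A v, A (A v)⟫ with hb
  have hb0 : 0 ≤ b := hA0 _
  set a := ⟪A v, A v⟫ with ha
  have key : ∀ t : ℝ, 0 ≤ -(2 * t * a) + t ^ 2 * b := fun t => by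
    have h1 := hA0 (v - t • A v)
    have h2 : ⟪v, A (A v)⟫ = a := (hA v (A v)).symm
    rw [map_sub, map_smul, inner_sub_left, inner_sub_right, inner_sub_right, real_inner_smul_left,
      real_inner_smul_left, real_inner_smul_right, real_inner_smul_right, h0, h2, ← ha, ← hb] at h1
    linarith
  have h1 := key (a / (b + 1))
  have h2 : -(2 * (a / (b + 1)) * a) + (a / (b + 1)) ^ 2 * b =
      -(a ^ 2 * (b + 2) / (b + 1) ^ 2) := by
    field_simp
    ring
  rw [h2] at h1
  have h3 : a ^ 2 * (b + 2) / (b + 1) ^ 2 ≤ 0 := by linarith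
  have h4 : a = 0 := by
    by_contra h
    have : 0 < a ^ 2 * (b + 2) / (b + 1) ^ 2 := by positivity
    linarith
  exact inner_self_eq_zero.1 h4

variable [FiniteDimensional ℝ E]

/-- Lower semicontinuity of the determinant with respect to one-sided perturbations of a
positive definite quadratic form. -/
lemma exists_lt_det {A : E →ₗ[ℝ] E} (hA : A.IsSymmetric)
    (hA0 : ∀ v, 0 ≤ ⟪v, A v⟫) (hAi : Function.Injective A) {c : ℝ} (hc : c < LinearMap.det A) :
    ∃ η : ℝ, 0 < η ∧ ∀ B : E →ₗ[ℝ] E, B.IsSymmetric →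
      (∀ v, ⟪v, A v⟫ - η * ‖v‖ ^ 2 ≤ ⟪v, B v⟫) → c < LinearMap.det B := by
  have : ProperSpace E := FiniteDimensional.proper ℝ E
  obtain ⟨m, hm0, hm⟩ : ∃ m : ℝ, 0 < m ∧ ∀ v ∈ Metric.sphere (0 : E) 1, m ≤ ⟪v, A v⟫ := by
    refine (isCompact_sphere (0 : E) 1).exists_forall_le' (a := (0 : ℝ)) ?_ fun v hv => ?_
    · exact (continuous_id.inner A.continuous_of_finiteDimensional).continuousOn
    · exact inner_self_pos_of_injective hA hA0 hAi (by rintro rfl; simp at hv)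
  have hm' : ∀ v : E, m * ‖v‖ ^ 2 ≤ ⟪v, A v⟫ := fun v => by
    rcases eq_or_ne v 0 with rfl | hv
    · simp
    have hvn : 0 < ‖v‖ := norm_pos_iff.2 hv
    have h1 := hm (‖v‖⁻¹ • v) (by
      rw [mem_sphere_zero_iff_norm, norm_smul, norm_inv, norm_norm, inv_mul_cancel₀ hvn.ne'])
    rw [map_smul, real_inner_smul_left, real_inner_smul_right, ← mul_assoc, ← mul_inv,
      ← pow_two, inv_mul_eq_div, le_div_iff₀ (by positivity)] at h1
    exact h1
  obtain ⟨κ, hκc, hκ0, hκ1⟩ : ∃ κ : ℝ, c < (1 - κ) ^ Module.finrank ℝ E * LinearMap.det A ∧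
      κ ∈ Set.Ioo (0 : ℝ) 1 := by
    have h1 : Tendsto (fun κ : ℝ => (1 - κ) ^ Module.finrank ℝ E * LinearMap.det A) (𝓝[>] 0)
        (𝓝 ((1 - 0) ^ Module.finrank ℝ E * LinearMap.det A)) :=
      (Continuous.tendsto (by fun_prop) 0).mono_left nhdsWithin_le_nhds
    rw [sub_zero, one_pow, one_mul] at h1
    exact ((h1.eventually (lt_mem_nhds hc)).and (Ioo_mem_nhdsGT one_pos)).exists
  refine ⟨κ * m, by positivity, fun B hB hAB => ?_⟩
  rw [← LinearMap.det_smul] at hκc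
  refine hκc.trans_le (det_le_det_of_inner_le (fun v w => ?_) hB (fun v => ?_) (fun v w h => ?_)
    fun v => ?_)
  · rw [LinearMap.smul_apply, LinearMap.smul_apply, real_inner_smul_left, real_inner_smul_right,
      hA v w]
  · rw [LinearMap.smul_apply, real_inner_smul_right]
    exact mul_nonneg (by linarith) (hA0 v)
  · exact hAi (smul_right_injective E (show 1 - κ ≠ 0 by linarith) h)
  · have h1 := hAB v
    have h2 := hm' v
    rw [LinearMap.smul_apply, real_inner_smul_right]
    nlinarith

end LinearAlgebra

section Homogeneous

variable {n : ℕ} {G G₁ G₂ : Eucl n → ℝ} {x : Eucl n}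

lemma isSmoothHom_norm : IsSmoothHom (fun x : Eucl n => ‖x‖) :=
  ⟨fun _ hx => (contDiffAt_norm ℝ hx).contDiffWithinAt, fun c hc x => by
    rw [norm_smul, Real.norm_of_nonneg hc.le]⟩

lemma gradient_add (h₁ : DifferentiableAt ℝ G₁ x) (h₂ : DifferentiableAt ℝ G₂ x) :
    gradient (fun y => G₁ y + G₂ y) x = gradient G₁ x + gradient G₂ x :=
  ext_inner_right ℝ fun v => by
    rw [inner_add_left, inner_gradient_eq, inner_gradient_eq, inner_gradient_eq,
      fderiv_fun_add h₁ h₂, add_apply]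

lemma gradient_const_mul (c : ℝ) (h : DifferentiableAt ℝ G x) :
    gradient (fun y => c * G y) x = c • gradient G x :=
  ext_inner_right ℝ fun v => by
    rw [real_inner_smul_left, inner_gradient_eq, inner_gradient_eq, fderiv_const_mul h]
    rfl

namespace IsSmoothHom

lemma add (h₁ : IsSmoothHom G₁) (h₂ : IsSmoothHom G₂) : IsSmoothHom fun y => G₁ y + G₂ y :=
  ⟨h₁.contDiffOn.add h₂.contDiffOn, fun c hc x => by rw [h₁.smul c hc, h₂.smul c hc]; ring⟩

lemma const_mul (h : IsSmoothHom G) (a : ℝ) : IsSmoothHom fun y => a * G y :=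
  ⟨contDiffOn_const.mul h.contDiffOn, fun c hc x => by rw [h.smul c hc]; ring⟩

lemma fderiv_gradient_add (h₁ : IsSmoothHom G₁) (h₂ : IsSmoothHom G₂) (hx : x ≠ 0) :
    fderiv ℝ (gradient fun y => G₁ y + G₂ y) x =
      fderiv ℝ (gradient G₁) x + fderiv ℝ (gradient G₂) x := by
  have hev : gradient (fun y => G₁ y + G₂ y) =ᶠ[𝓝 x] fun y => gradient G₁ y + gradient G₂ y := by
    filter_upwards [isOpen_ne.mem_nhds hx] with y hy
    exact gradient_add (h₁.differentiableAt hy) (h₂.differentiableAt hy)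
  rw [hev.fderiv_eq, fderiv_fun_add (h₁.differentiableAt_gradient hx)
    (h₂.differentiableAt_gradient hx)]

lemma fderiv_gradient_const_mul (h : IsSmoothHom G) (a : ℝ) (hx : x ≠ 0) :
    fderiv ℝ (gradient fun y => a * G y) x = a • fderiv ℝ (gradient G) x := by
  have hev : gradient (fun y => a * G y) =ᶠ[𝓝 x] fun y => a • gradient G y := by
    filter_upwards [isOpen_ne.mem_nhds hx] with y hy
    exact gradient_const_mul a (h.differentiableAt hy)
  rw [hev.fderiv_eq, fderiv_fun_const_smul (h.differentiableAt_gradient hx)]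

/-- A smooth homogeneous function which is uniformly close to a given continuous function
on the sphere. -/
lemma exists_approx {g : Eucl n → ℝ} (hg : ContinuousOn g (Metric.sphere 0 1)) {ε : ℝ}
    (hε : 0 < ε) : ∃ W : Eucl n → ℝ, IsSmoothHom W ∧
      ∀ x ∈ Metric.sphere (0 : Eucl n) 1, |W x - g x| < ε := by
  obtain ⟨g', hg'⟩ := ContinuousMap.exists_restrict_eq (s := Metric.sphere (0 : Eucl n) 1)
    Metric.isClosed_sphere ⟨_, continuousOn_iff_continuous_domRestrict.1 hg⟩
  obtain ⟨w, hw, hwg, -⟩ := g'.continuous.exists_contDiff_approx ⊤ (ε := fun _ => ε)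
    continuous_const fun _ => hε
  refine ⟨fun y => ‖y‖ * w (‖y‖⁻¹ • y), ⟨?_, fun c hc x => ?_⟩, fun x hx => ?_⟩
  · intro y hy
    have hy0 : y ≠ 0 := hy
    have h1 : ContDiffAt ℝ (⊤ : ℕ∞) (fun y : Eucl n => ‖y‖) y := contDiffAt_norm ℝ hy0
    have h2 : ContDiffAt ℝ (⊤ : ℕ∞) (fun y : Eucl n => ‖y‖⁻¹ • y) y :=
      (h1.inv (norm_ne_zero_iff.2 hy0)).smul contDiffAt_id
    exact (h1.mul (hw.contDiffAt.comp y h2)).contDiffWithinAt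
  · rw [norm_smul, Real.norm_of_nonneg hc.le, smul_smul,
      show (c * ‖x‖)⁻¹ * c = ‖x‖⁻¹ by rw [mul_comm c, mul_inv, inv_mul_cancel_right₀ hc.ne'],
      mul_assoc]
  · have h1 : g' x = g x := congrArg (fun φ : C(Metric.sphere (0 : Eucl n) 1, ℝ) => φ ⟨x, hx⟩) hg'
    have h2 := hwg x
    rw [Real.dist_eq, h1] at h2
    simpa [mem_sphere_zero_iff_norm.1 hx] using h2

end IsSmoothHom

end Homogeneous

end

section

variable {n : ℕ} {ι : Type*} {A : ι → Set (Eucl n)} {l : Filter ι} {K : Set (Eucl n)} {R : ℝ}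

/-- Semicontinuity of the curvature determinant at points where the perturbed difference of the
support functions is minimal. -/
lemma SuppTendsto.eventually_lt_curvDet (h : SuppTendsto A l K R) {W : Eucl n → ℝ}
    (hW : IsSmoothHom W) {y : ι → Eucl n} (hy : ∀ i, y i ∈ Metric.sphere (0 : Eucl n) 1)
    {x : Eucl n} (hx : x ∈ Metric.sphere (0 : Eucl n) 1) (hyx : Tendsto y l (𝓝 x))
    {s : ι → ℝ} (hs : Tendsto s l (𝓝 0)) {c : ℝ} (hc : c < curvDet (_root_.suppFun K) x) :
    ∀ᶠ i in l, (∀ z ∈ Metric.sphere (0 : Eucl n) 1,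
      _root_.suppFun (A i) (y i) - _root_.suppFun K (y i) - s i * W (y i) ≤
        _root_.suppFun (A i) z - _root_.suppFun K z - s i * W z) →
      c < curvDet (_root_.suppFun (A i)) (y i) := by
  have hx0 := sphere_ne_zero hx
  have hy0 := fun i => sphere_ne_zero (hy i)
  have hK := h.lim.isSmoothHom
  set N : Eucl n → ℝ := fun z => ‖z‖ with hNdef
  have hN : IsSmoothHom N := isSmoothHom_norm
  set m : ι → ℝ := fun i => _root_.suppFun (A i) (y i) - _root_.suppFun K (y i) - s i * W (y i)
    with hm
  have hWy : Tendsto (fun i => W (y i)) l (𝓝 (W x)) :=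
    (hW.differentiableAt hx0).continuousAt.tendsto.comp hyx
  have hm0 : Tendsto m l (𝓝 0) := by
    have := ((h.suppFun hyx).sub ((h.lim.isBody.continuous_suppFun.tendsto x).comp hyx)).sub
      (hs.mul hWy)
    simpa using this
  set L : ι → Eucl n →L[ℝ] Eucl n := fun i => fderiv ℝ (_root_.gradient (_root_.suppFun K)) (y i) +
    (s i • fderiv ℝ (_root_.gradient W) (y i) + m i • fderiv ℝ (_root_.gradient N) (y i)) with hL
  have hlim : ∀ {G : Eucl n → ℝ}, IsSmoothHom G → Tendsto
      (fun i => fderiv ℝ (_root_.gradient G) (y i)) l (𝓝 (fderiv ℝ (_root_.gradient G) x)) :=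
    fun hG => (hG.continuousOn_fderiv_gradient.continuousAt
      (isOpen_compl_singleton.mem_nhds hx0)).tendsto.comp hyx
  have hLlim : Tendsto L l (𝓝 (fderiv ℝ (_root_.gradient (_root_.suppFun K)) x)) := by
    have : Tendsto L l (𝓝 (fderiv ℝ (_root_.gradient (_root_.suppFun K)) x +
        ((0 : ℝ) • fderiv ℝ (_root_.gradient W) x + (0 : ℝ) • fderiv ℝ (_root_.gradient N) x))) :=
      (hlim hK).add ((hs.smul (hlim hW)).add (hm0.smul (hlim hN)))
    refine this.trans_eq (congrArg 𝓝 (ContinuousLinearMap.ext fun v => ?_))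
    rw [add_apply, add_apply, smul_apply, smul_apply, zero_smul, zero_smul, add_zero, add_zero]
  rw [curvDet_eq] at hc
  have hpsd : ∀ v, 0 ≤ ⟪v, curvMap (_root_.suppFun K) x v⟫ := fun v => by
    rw [curvMap_apply, inner_add_right, real_inner_smul_right, real_inner_comm v x]
    have h1 := h.lim.inner_fderiv_gradient_nonneg hx0 v
    rw [real_inner_comm] at h1
    nlinarith [mul_self_nonneg ⟪v, x⟫]
  obtain ⟨η, hη0, hη⟩ := exists_lt_det (hK.isSymmetric_curvMap hx0) hpsd
    (h.lim.curvMap_injective hx) hc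
  have e1 : ∀ᶠ i in l, ‖L i - fderiv ℝ (_root_.gradient (_root_.suppFun K)) x‖ < η / 2 :=
    (tendsto_iff_norm_sub_tendsto_zero.1 hLlim).eventually (gt_mem_nhds (by positivity))
  have e2 : ∀ᶠ i in l, ‖y i - x‖ < η / 4 :=
    (tendsto_iff_norm_sub_tendsto_zero.1 hyx).eventually (gt_mem_nhds (by positivity))
  filter_upwards [e1, e2] with i hi1 hi2 hmin
  have hAi := (h.body i).isSmoothHom
  have hP : IsSmoothHom fun z => _root_.suppFun K z + (s i * W z + m i * N z) :=
    hK.add ((hW.const_mul _).add (hN.const_mul _))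
  have hG := hAi.add (hP.const_mul (-1))
  have hPd : fderiv ℝ (_root_.gradient fun z => _root_.suppFun K z + (s i * W z + m i * N z)) (y i) =
      L i := by
    rw [hK.fderiv_gradient_add ((hW.const_mul _).add (hN.const_mul _)) (hy0 i),
      (hW.const_mul _).fderiv_gradient_add (hN.const_mul _) (hy0 i),
      hW.fderiv_gradient_const_mul _ (hy0 i), hN.fderiv_gradient_const_mul _ (hy0 i)]
  have hGd := hAi.fderiv_gradient_add (hP.const_mul (-1)) (hy0 i)
  rw [hP.fderiv_gradient_const_mul _ (hy0 i), hPd] at hGd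
  have hloc : IsLocalMin (fun z => _root_.suppFun (A i) z +
      (-1) * (_root_.suppFun K z + (s i * W z + m i * N z))) (y i) := by
    filter_upwards [isOpen_ne.mem_nhds (hy0 i)] with z hz
    have hzn : 0 < ‖z‖ := norm_pos_iff.2 hz
    have hz1 : ‖z‖⁻¹ • z ∈ Metric.sphere (0 : Eucl n) 1 := by
      rw [mem_sphere_zero_iff_norm, norm_smul, norm_inv, norm_norm, inv_mul_cancel₀ hzn.ne']
    have h1 := hmin _ hz1
    have h2 := hG.smul ‖z‖ hzn (‖z‖⁻¹ • z)
    have hNz : N (‖z‖⁻¹ • z) = 1 := mem_sphere_zero_iff_norm.1 hz1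
    have hNy : N (y i) = 1 := mem_sphere_zero_iff_norm.1 (hy i)
    simp only [smul_inv_smul₀ hzn.ne', hNz] at h2
    rw [h2, hNy]
    have h3 : m i = _root_.suppFun (A i) (y i) - _root_.suppFun K (y i) - s i * W (y i) := rfl
    refine (show _ = (0 : ℝ) by rw [h3]; ring).trans_le (mul_nonneg hzn.le ?_)
    linarith
  rw [curvDet_eq]
  refine hη _ (hAi.isSymmetric_curvMap (hy0 i)) fun v => ?_
  have h1 := _root_.inner_fderiv_gradient_nonneg (hG.contDiffAt (hy0 i)) hloc v
  rw [hGd, add_apply, smul_apply, inner_add_left,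
    real_inner_smul_left] at h1
  have h2 : |⟪(L i - fderiv ℝ (_root_.gradient (_root_.suppFun K)) x) v, v⟫| ≤ η / 2 * ‖v‖ ^ 2 := by
    refine (abs_real_inner_le_norm _ _).trans ?_
    have := (L i - fderiv ℝ (_root_.gradient (_root_.suppFun K)) x).le_of_opNorm_le hi1.le v
    nlinarith [norm_nonneg v]
  have h3 : |⟪y i, v⟫ ^ 2 - ⟪x, v⟫ ^ 2| ≤ η / 2 * ‖v‖ ^ 2 := by
    rw [show ⟪y i, v⟫ ^ 2 - ⟪x, v⟫ ^ 2 = ⟪y i + x, v⟫ * ⟪y i - x, v⟫ by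
      rw [inner_add_left, inner_sub_left]; ring, abs_mul]
    have h4 : |⟪y i + x, v⟫| ≤ 2 * ‖v‖ := by
      refine (abs_real_inner_le_norm _ _).trans (mul_le_mul_of_nonneg_right ?_ (norm_nonneg v))
      refine (norm_add_le _ _).trans ?_
      rw [mem_sphere_zero_iff_norm.1 hx, mem_sphere_zero_iff_norm.1 (hy i)]; norm_num
    have h5 : |⟪y i - x, v⟫| ≤ η / 4 * ‖v‖ :=
      (abs_real_inner_le_norm _ _).trans (mul_le_mul_of_nonneg_right hi2.le (norm_nonneg v))
    calc _ ≤ 2 * ‖v‖ * (η / 4 * ‖v‖) := mul_le_mul h4 h5 (abs_nonneg _) (by positivity)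
      _ = _ := by ring
  rw [sub_apply, inner_sub_left] at h2
  rw [curvMap_apply, curvMap_apply, inner_add_right, inner_add_right, real_inner_smul_right,
    real_inner_smul_right, real_inner_comm x v, real_inner_comm (y i) v,
    real_inner_comm (fderiv ℝ (_root_.gradient (_root_.suppFun K)) x v) v,
    real_inner_comm (fderiv ℝ (_root_.gradient (_root_.suppFun (A i))) (y i) v) v]
  have h6 := abs_le.1 h2
  have h7 := abs_le.1 h3
  nlinarith

end

section

variable {n : ℕ} {q p T : ℝ} {f : Eucl n → ℝ} {K : ℝ → Set (Eucl n)} {W : Eucl n → ℝ}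

namespace FlowSolution

lemma eventually_lt_flowRHS (F : FlowSolution q p T f K) (t₀ : Set.Ico (0 : ℝ) T)
    (hW : IsSmoothHom W)
    (hWlt : ∀ x ∈ Metric.sphere (0 : Eucl n) 1, W x < flowRHS q p f (K t₀) x) :
    ∀ᶠ t : Set.Ico (0 : ℝ) T in 𝓝 t₀, ∀ x ∈ Metric.sphere (0 : Eucl n) 1,
      (∀ z ∈ Metric.sphere (0 : Eucl n) 1,
        suppFun (K t) x - suppFun (K t₀) x - ((t : ℝ) - t₀) * W x ≤
          suppFun (K t) z - suppFun (K t₀) z - ((t : ℝ) - t₀) * W z) →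
      W x < flowRHS q p f (K t) x := by
  obtain ⟨R, hR, hKR⟩ := F.exists_bound
  have hS := F.suppTendsto hR hKR t₀
  have hθ := hS.tendsto_theta F.dim_pos F.one_lt F.nonneg F.continuous F.pos
  refine (isCompact_sphere _ _).eventually_forall_of_ultrafilter fun U hU y hy x hx hyx => ?_
  have hx0 := sphere_ne_zero hx
  have h := hS.mono hU
  have hb := h.lim.isBody
  have hs : Tendsto (fun t : Set.Ico (0 : ℝ) T => (t : ℝ) - t₀) U (𝓝 0) := by
    have : Tendsto (fun t : Set.Ico (0 : ℝ) T => (t : ℝ) - t₀) (𝓝 t₀) (𝓝 ((t₀ : ℝ) - t₀)) :=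
      (continuous_subtype_val.sub continuous_const).tendsto t₀
    rw [sub_self] at this
    exact this.mono_left hU
  have hD := h.lim.2.2.2.2.2 x hx
  set N : ℝ := theta q p f (K t₀) * suppFun (K t₀) x ^ p * f x with hN
  set V : ℝ := Vtilde q (K t₀) (gradient (suppFun (K t₀)) x) with hV
  have hVpos : 0 < V := Vtilde_pos F.dim_pos F.one_lt hb _
  have hWx := hWlt x hx
  have hrw : ∀ (A : Set (Eucl n)) (z : Eucl n), flowRHS q p f A z =
      -(theta q p f A * suppFun A z ^ p * f z * (curvDet (suppFun A) z)⁻¹ /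
        Vtilde q A (gradient (suppFun A) z)) + suppFun A z := fun A z => by
    rw [flowRHS]; ring
  rw [hrw, ← hN, ← hV] at hWx
  obtain ⟨c, hcW, hc0, hcD⟩ : ∃ c : ℝ, W x < -(N * c⁻¹ / V) + suppFun (K t₀) x ∧
      c ∈ Set.Ioo 0 (curvDet (suppFun (K t₀)) x) := by
    have h1 : ContinuousAt (fun c : ℝ => -(N * c⁻¹ / V) + suppFun (K t₀) x)
        (curvDet (suppFun (K t₀)) x) :=
      (((continuousAt_const.mul (continuousAt_inv₀ hD.ne')).div_const V).neg).add continuousAt_const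
    have h2 := (h1.tendsto.mono_left (nhdsWithin_le_nhds (s := Set.Iio (curvDet (suppFun (K t₀)) x)))).eventually
      (lt_mem_nhds hWx)
    exact (h2.and (Ioo_mem_nhdsLT hD)).exists
  have hgrad := h.gradient hx0 hyx
  have hVlim : Tendsto (fun t : Set.Ico (0 : ℝ) T =>
      Vtilde q (K t) (gradient (suppFun (K t)) (y t))) U (𝓝 V) := by
    have h1 : Tendsto (fun P : Set.Ico (0 : ℝ) T × Eucl n => Vtilde q (K P.1) P.2)
        (𝓝 t₀ ×ˢ 𝓝 (gradient (suppFun (K t₀)) x)) (𝓝 V) :=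
      hS.tendsto_Vtilde_prod F.dim_pos F.one_lt (gradient (suppFun (K t₀)) x)
    have h2 : Tendsto (fun t : Set.Ico (0 : ℝ) T => (t, gradient (suppFun (K t)) (y t))) U
        (𝓝 t₀ ×ˢ 𝓝 (gradient (suppFun (K t₀)) x)) := by
      have h3 : Tendsto (fun t : Set.Ico (0 : ℝ) T => t) U (𝓝 t₀) := tendsto_id.mono_left hU
      exact h3.prodMk hgrad
    exact Tendsto.comp (f := fun t : Set.Ico (0 : ℝ) T => (t, gradient (suppFun (K t)) (y t))) h1 h2
  have hNlim : Tendsto (fun t : Set.Ico (0 : ℝ) T =>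
      theta q p f (K t) * suppFun (K t) (y t) ^ p * f (y t)) U (𝓝 N) :=
    ((hθ.mono_left hU).mul ((h.suppFun hyx).rpow_const (Or.inr F.nonneg))).mul
      ((F.continuous.tendsto x).comp hyx)
  have hWlim : Tendsto (fun t => W (y t)) U (𝓝 (W x)) :=
    (hW.differentiableAt hx0).continuousAt.tendsto.comp hyx
  have hlt := hWlim.eventually_lt
    ((((hNlim.mul_const c⁻¹).div hVlim hVpos.ne').neg).add (h.suppFun hyx)) hcW
  filter_upwards [hlt, h.eventually_lt_curvDet hW hy hx hyx hs hcD] with t ht1 ht2 hmin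
  have hcd := ht2 hmin
  have hbt := (F.smooth t t.2).isBody
  refine ht1.trans_le ?_
  rw [hrw]
  have h1 : 0 ≤ theta q p f (K t) * suppFun (K t) (y t) ^ p * f (y t) :=
    mul_nonneg (mul_nonneg (theta_nonneg F.dim_pos F.one_lt F.continuous F.pos hbt)
      (Real.rpow_nonneg (hbt.suppFun_nonneg _) p)) (F.pos _ (hy t)).le
  have h2 := Vtilde_nonneg (q := q) (K t) (gradient (suppFun (K t)) (y t))
  have h3 : (curvDet (suppFun (K t)) (y t))⁻¹ ≤ c⁻¹ := inv_anti₀ hc0 hcd.le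
  exact add_le_add (neg_le_neg
    (div_le_div_of_nonneg_right (mul_le_mul_of_nonneg_left h3 h1) h2)) le_rfl

/-- Smooth lower barriers for the flow. -/
lemma eventually_barrier (F : FlowSolution q p T f K) {t₀ : ℝ} (ht₀ : t₀ ∈ Set.Ico 0 T)
    (hW : IsSmoothHom W)
    (hWlt : ∀ x ∈ Metric.sphere (0 : Eucl n) 1, W x < flowRHS q p f (K t₀) x) :
    ∀ᶠ t in 𝓝[>] t₀, ∀ x ∈ Metric.sphere (0 : Eucl n) 1,
      suppFun (K t₀) x + (t - t₀) * W x ≤ suppFun (K t) x := by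
  obtain ⟨R, hR, hKR⟩ := F.exists_bound
  have hev := F.eventually_lt_flowRHS ⟨t₀, ht₀⟩ hW hWlt
  rw [Metric.eventually_nhds_iff] at hev
  obtain ⟨δ, hδ, hev⟩ := hev
  have hmem : Set.Ioo t₀ (min T (t₀ + δ)) ∈ 𝓝[>] t₀ :=
    Ioo_mem_nhdsGT (lt_min ht₀.2 (by linarith))
  filter_upwards [hmem] with t ht x hx
  by_contra! hlt
  have htT : t < T := ht.2.trans_le (min_le_left _ _)
  have htδ : t < t₀ + δ := ht.2.trans_le (min_le_right _ _)
  set φ : ℝ × Eucl n → ℝ := fun P =>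
    suppFun (K P.1) P.2 - suppFun (K t₀) P.2 - (P.1 - t₀) * W P.2 with hφ
  have hsub : ∀ s ∈ Set.Icc t₀ t, s ∈ Set.Ico 0 T := fun s hs =>
    ⟨ht₀.1.trans hs.1, hs.2.trans_lt htT⟩
  have hcont : ContinuousOn φ (Set.Icc t₀ t ×ˢ Metric.sphere (0 : Eucl n) 1) := by
    rintro ⟨s, z⟩ ⟨hs, hz⟩
    have h1 : ContinuousWithinAt (fun P : ℝ × Eucl n => suppFun (K P.1) P.2)
        (Set.Ico 0 T ×ˢ Set.univ) (s, z) := by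
      have hS := F.suppTendsto hR hKR ⟨s, hsub s hs⟩
      have h2 := (hS.comp (m := 𝓝 (⟨s, hsub s hs⟩ : Set.Ico (0 : ℝ) T) ×ˢ 𝓝 z)
        (u := Prod.fst) tendsto_fst).suppFun (y := Prod.snd) (x := z) tendsto_snd
      rw [ContinuousWithinAt, nhdsWithin_prod_eq, nhdsWithin_univ,
        nhdsWithin_eq_map_subtype_coe (hsub s hs), ← Filter.map_id (f := 𝓝 z),
        Filter.prod_map_map_eq, Filter.tendsto_map'_iff]
      exact h2
    have h3 : ContinuousAt (fun P : ℝ × Eucl n => suppFun (K t₀) P.2) (s, z) :=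
      ((F.smooth t₀ ht₀).isBody.continuous_suppFun.comp continuous_snd).continuousAt
    have h4 : ContinuousAt (fun P : ℝ × Eucl n => (P.1 - t₀) * W P.2) (s, z) :=
      (continuous_fst.sub continuous_const).continuousAt.mul
        (ContinuousAt.comp (f := Prod.snd) (x := (s, z))
          (hW.differentiableAt (sphere_ne_zero hz)).continuousAt continuous_snd.continuousAt)
    exact (((h1.mono (Set.prod_mono (fun r hr => hsub r hr) (Set.subset_univ _))).sub
      h3.continuousWithinAt).sub h4.continuousWithinAt)
  obtain ⟨⟨t₁, x₁⟩, ⟨ht₁, hx₁⟩, hmin⟩ := (isCompact_Icc.prod (isCompact_sphere _ _)).exists_isMinOn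
    ⟨(t, x), ⟨⟨ht.1.le, le_rfl⟩, hx⟩⟩ hcont
  have hneg : φ (t₁, x₁) < 0 := by
    refine (isMinOn_iff.1 hmin (t, x) ⟨⟨ht.1.le, le_rfl⟩, hx⟩).trans_lt ?_
    simp only [hφ]
    linarith
  have ht01 : t₀ < t₁ := by
    refine ht₁.1.lt_of_ne ?_
    rintro rfl
    simp [hφ] at hneg
  have hWφ := hev (y := ⟨t₁, hsub t₁ ht₁⟩) (by
    rw [Subtype.dist_eq, Real.dist_eq, abs_of_pos (by simpa using ht01)]
    have := ht₁.2
    simp only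
    linarith) x₁ hx₁ fun z hz => isMinOn_iff.1 hmin (t₁, z) ⟨ht₁, hz⟩
  have hd : HasDerivWithinAt (fun s => φ (s, x₁)) (flowRHS q p f (K t₁) x₁ - 1 * W x₁)
      (Set.Iio t₁ ∩ Set.Ici t₀) t₁ := by
    have h1 : HasDerivWithinAt (fun s => suppFun (K s) x₁) (flowRHS q p f (K t₁) x₁)
        (Set.Iio t₁ ∩ Set.Ici t₀) t₁ :=
      (F.flow t₁ (hsub t₁ ht₁) x₁ hx₁).mono fun s hs =>
        hsub s ⟨hs.2, hs.1.le.trans ht₁.2⟩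
    have h2 : HasDerivAt (fun s : ℝ => (s - t₀) * W x₁) (1 * W x₁) t₁ :=
      ((hasDerivAt_id t₁).sub_const t₀).mul_const _
    exact (h1.sub_const (suppFun (K t₀) x₁)).fun_sub h2.hasDerivWithinAt
  rw [hasDerivWithinAt_iff_tendsto_slope' (by simp), nhdsWithin_inter_of_mem'
    (mem_nhdsWithin_of_mem_nhds (Ici_mem_nhds ht01))] at hd
  have hle : flowRHS q p f (K t₁) x₁ - 1 * W x₁ ≤ 0 := by
    refine le_of_tendsto hd ?_
    filter_upwards [Ioo_mem_nhdsLT ht01] with s hs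
    rw [slope_def_field]
    have := isMinOn_iff.1 hmin (s, x₁) ⟨⟨hs.1.le, hs.2.le.trans ht₁.2⟩, hx₁⟩
    exact div_nonpos_of_nonneg_of_nonpos (by linarith) (by linarith [hs.2])
  simp only at hWφ
  linarith

lemma continuousOn_flowRHS (F : FlowSolution q p T f K) {t : ℝ} (ht : t ∈ Set.Ico 0 T) :
    ContinuousOn (flowRHS q p f (K t)) (Metric.sphere 0 1) := by
  have h := F.smooth t ht
  have hsub : Metric.sphere (0 : Eucl n) 1 ⊆ {0}ᶜ := fun x hx => sphere_ne_zero hx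
  have h1 := h.isBody.continuous_suppFun.continuousOn (s := Metric.sphere (0 : Eucl n) 1)
  refine ContinuousOn.add (ContinuousOn.div (((continuousOn_const.mul
    (h1.rpow_const fun x hx => Or.inr F.nonneg)).mul
    ((h.isSmoothHom.continuousOn_curvDet.mono hsub).inv₀ fun x hx => (h.2.2.2.2.2 x hx).ne')).mul
    F.continuous.continuousOn) ((continuous_Vtilde F.dim_pos F.one_lt h.isBody).comp_continuousOn
    (h.isSmoothHom.continuousOn_gradient.mono hsub)) fun x hx =>
      (Vtilde_pos F.dim_pos F.one_lt h.isBody _).ne') h1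

/-- Near the speed of the flow there is a smooth strict lower barrier. -/
lemma exists_barrier (F : FlowSolution q p T f K) {t₀ : ℝ} (ht₀ : t₀ ∈ Set.Ico 0 T) {ε : ℝ}
    (hε : 0 < ε) : ∃ W : Eucl n → ℝ, IsSmoothHom W ∧
      (∀ x ∈ Metric.sphere (0 : Eucl n) 1, flowRHS q p f (K t₀) x - ε ≤ W x) ∧
      ∀ᶠ t in 𝓝[>] t₀, ∀ x ∈ Metric.sphere (0 : Eucl n) 1,
        suppFun (K t₀) x + (t - t₀) * W x ≤ suppFun (K t) x := by
  obtain ⟨W, hW, hWa⟩ := IsSmoothHom.exists_approx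
    ((F.continuousOn_flowRHS ht₀).sub (continuousOn_const (c := ε / 2))) (half_pos hε)
  refine ⟨W, hW, fun x hx => ?_, F.eventually_barrier ht₀ hW fun x hx => ?_⟩
  · have h : |W x - (flowRHS q p f (K t₀) x - ε / 2)| < ε / 2 := hWa x hx
    linarith [(abs_lt.1 h).1]
  · have h : |W x - (flowRHS q p f (K t₀) x - ε / 2)| < ε / 2 := hWa x hx
    linarith [(abs_lt.1 h).2]

end FlowSolution

end

section

variable {n : ℕ} {q p T : ℝ} {f : Eucl n → ℝ}

lemma integrable_sphMeas {g : Eucl n → ℝ} (hg : ContinuousOn g (Metric.sphere 0 1)) :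
    Integrable (fun x : Metric.sphere (0 : Eucl n) 1 => g x) (sphMeas n) :=
  (continuousOn_iff_continuous_domRestrict.1 hg).integrable_of_hasCompactSupport
    (HasCompactSupport.of_compactSpace _)

namespace IsSmoothBody

variable {K : Set (Eucl n)}

lemma continuousOn_Vtilde_gradient (hn : 0 < n) (hq : 1 < q) (h : IsSmoothBody K) :
    ContinuousOn (fun x => Vtilde q K (gradient (suppFun K) x)) (Metric.sphere 0 1) :=
  (continuous_Vtilde hn hq h.isBody).comp_continuousOn
    (h.isSmoothHom.continuousOn_gradient.mono fun _ hx => sphere_ne_zero hx)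

lemma continuousOn_curvDet_sphere (h : IsSmoothBody K) :
    ContinuousOn (curvDet (suppFun K)) (Metric.sphere 0 1) :=
  h.isSmoothHom.continuousOn_curvDet.mono fun _ hx => sphere_ne_zero hx

lemma integral_radFun_pow_mul_Vtilde (hn : 0 < n) (hq : 1 < q) (h : IsSmoothBody K)
    {w : Eucl n → ℝ} (hw : ContinuousOn w (Metric.sphere 0 1)) :
    ∫ ξ, radFun K (ξ : Eucl n) ^ n * (w (normalAt K ξ) / suppFun K (normalAt K ξ)) *
        Vtilde q K (radFun K (ξ : Eucl n) • (ξ : Eucl n)) ∂(sphMeas n) =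
      ∫ x, w (x : Eucl n) * (Vtilde q K (gradient (suppFun K) x) * curvDet (suppFun K) x)
        ∂(sphMeas n) := by
  have hpos : ∀ x ∈ Metric.sphere (0 : Eucl n) 1, suppFun K x ≠ 0 := fun x hx =>
    (h.isBody.suppFun_pos (sphere_ne_zero hx)).ne'
  have key := h.integral_radFun_pow_normalAt hn
    (Φ := fun x => w x / suppFun K x * Vtilde q K (gradient (suppFun K) x))
    ((hw.div h.isBody.continuous_suppFun.continuousOn hpos).mul
      (h.continuousOn_Vtilde_gradient hn hq))
  calc _ = _ := integral_congr_ae (Eventually.of_forall fun ξ => by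
        have h0 := sphere_ne_zero ξ.2
        rw [h.gradient_normalAt h0, h.isBody.radFun_eq h0]
        ring)
    _ = _ := key
    _ = _ := integral_congr_ae (Eventually.of_forall fun x => by
        have h0 := hpos x x.2
        field_simp)

lemma integral_radFun_pow_eq (hn : 0 < n) (hq : 1 < q) (h : IsSmoothBody K) :
    ∫ ξ, Vtilde q K (radFun K (ξ : Eucl n) • (ξ : Eucl n)) * radFun K (ξ : Eucl n) ^ n
        ∂(sphMeas n) =
      ∫ x, suppFun K (x : Eucl n) *
        (Vtilde q K (gradient (suppFun K) x) * curvDet (suppFun K) x) ∂(sphMeas n) := by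
  rw [← h.integral_radFun_pow_mul_Vtilde hn hq h.isBody.continuous_suppFun.continuousOn]
  refine integral_congr_ae (Eventually.of_forall fun ξ => ?_)
  have h0 := h.isBody.suppFun_pos (sphere_ne_zero (h.normalAt_mem (sphere_ne_zero ξ.2)))
  simp only
  rw [div_self h0.ne']
  ring

/-- The first variation of the chord energy in a direction not much below the speed of the
flow is almost nonnegative. -/
lemma neg_mul_le_integral (hn : 0 < n) (hq : 1 < q) (hp : 0 ≤ p) (h : IsSmoothBody K)
    (hf : Continuous f) (hfpos : ∀ x ∈ Metric.sphere (0 : Eucl n) 1, 0 < f x) {w : Eucl n → ℝ}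
    (hw : ContinuousOn w (Metric.sphere 0 1)) {ε : ℝ}
    (hle : ∀ x ∈ Metric.sphere (0 : Eucl n) 1, flowRHS q p f K x - ε ≤ w x) :
    -(ε * ∫ x, Vtilde q K (gradient (suppFun K) x) * curvDet (suppFun K) (x : Eucl n)
        ∂(sphMeas n)) ≤
      ∫ ξ, radFun K (ξ : Eucl n) ^ n * (w (normalAt K ξ) / suppFun K (normalAt K ξ)) *
        Vtilde q K (radFun K (ξ : Eucl n) • (ξ : Eucl n)) ∂(sphMeas n) := by
  rw [h.integral_radFun_pow_mul_Vtilde hn hq hw]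
  have hb := h.isBody
  have cV := h.continuousOn_Vtilde_gradient hn hq
  have cD := h.continuousOn_curvDet_sphere
  have cVD : ContinuousOn (fun x => Vtilde q K (gradient (suppFun K) x) * curvDet (suppFun K) x)
    (Metric.sphere 0 1) := cV.mul cD
  have cH := hb.continuous_suppFun.continuousOn (s := Metric.sphere (0 : Eucl n) 1)
  have i1 := integrable_sphMeas cVD
  have i2 : Integrable (fun x : Metric.sphere (0 : Eucl n) 1 => suppFun K (x : Eucl n) *
      (Vtilde q K (gradient (suppFun K) x) * curvDet (suppFun K) x)) (sphMeas n) :=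
    integrable_sphMeas (cH.mul cVD)
  have i3 : Integrable (fun x : Metric.sphere (0 : Eucl n) 1 =>
      suppFun K (x : Eucl n) ^ p * f (x : Eucl n)) (sphMeas n) :=
    integrable_sphMeas (g := fun x => suppFun K x ^ p * f x)
      ((cH.rpow_const fun x hx => Or.inr hp).mul hf.continuousOn)
  have i3' := i3.const_mul (-(theta q p f K))
  have i5 : Integrable (fun x : Metric.sphere (0 : Eucl n) 1 =>
      -(theta q p f K) * (suppFun K (x : Eucl n) ^ p * f (x : Eucl n)) +
      suppFun K (x : Eucl n) * (Vtilde q K (gradient (suppFun K) x) * curvDet (suppFun K) x))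
      (sphMeas n) := i3'.add i2
  have i4 : Integrable (fun x : Metric.sphere (0 : Eucl n) 1 => w (x : Eucl n) *
      (Vtilde q K (gradient (suppFun K) x) * curvDet (suppFun K) x)) (sphMeas n) :=
    integrable_sphMeas (hw.mul cVD)
  have hth := theta_mul_integral_le (p := p) hn hq hf hfpos hb
  rw [h.integral_radFun_pow_eq hn hq] at hth
  have hmono : ∫ x, (-(theta q p f K) * (suppFun K (x : Eucl n) ^ p * f (x : Eucl n)) +
      suppFun K (x : Eucl n) * (Vtilde q K (gradient (suppFun K) x) * curvDet (suppFun K) x)) -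
      ε * (Vtilde q K (gradient (suppFun K) x) * curvDet (suppFun K) x) ∂(sphMeas n) ≤
      ∫ x, w (x : Eucl n) * (Vtilde q K (gradient (suppFun K) x) * curvDet (suppFun K) x)
        ∂(sphMeas n) := by
    refine integral_mono (i5.sub (i1.const_mul ε)) i4 fun x => ?_
    have hD := h.2.2.2.2.2 x x.2
    have hV := Vtilde_pos (q := q) hn hq hb (gradient (suppFun K) x)
    have h1 := mul_le_mul_of_nonneg_right (hle x x.2) (mul_pos hV hD).le
    refine le_trans (le_of_eq ?_) h1
    rw [flowRHS]
    field_simp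
  rw [integral_sub i5 (i1.const_mul ε), integral_add i3' i2, integral_const_mul, integral_const_mul] at hmono
  linarith

end IsSmoothBody

namespace FlowSolution

open IsSmoothBody (normalAt)

variable {K : ℝ → Set (Eucl n)}

lemma eventually_lt_slope_chordEnergy (F : FlowSolution q p T f K) {t₀ : ℝ}
    (ht₀ : t₀ ∈ Set.Ico 0 T) {c : ℝ} (hc : c < 0) :
    ∀ᶠ t in 𝓝[>] t₀, c < (chordEnergy q (K t) - chordEnergy q (K t₀)) / (t - t₀) := by
  have hn := F.dim_pos
  have hq := F.one_lt
  have h := F.smooth t₀ ht₀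
  have hb := h.isBody
  obtain ⟨R, hR, hKR⟩ := F.exists_bound
  set C₁ := ∫ x, Vtilde q (K t₀) (gradient (suppFun (K t₀)) x) *
    curvDet (suppFun (K t₀)) (x : Eucl n) ∂(sphMeas n) with hC₁
  set M₀ := ∫ ξ, Vtilde q (K t₀) (radFun (K t₀) (ξ : Eucl n) • (ξ : Eucl n)) *
    radFun (K t₀) (ξ : Eucl n) ^ n ∂(sphMeas n) with hM₀
  have hC₁0 : 0 ≤ C₁ := integral_nonneg fun x =>
    mul_nonneg (Vtilde_nonneg _ _) (h.2.2.2.2.2 x x.2).le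
  have hM₀0 : 0 ≤ M₀ := integral_nonneg fun ξ => mul_nonneg (Vtilde_nonneg _ _)
    (pow_nonneg (hb.radFun_pos (sphere_ne_zero ξ.2)).le n)
  set ε := -c / (4 * (C₁ + M₀ + 1)) with hε
  have hε0 : 0 < ε := div_pos (by linarith) (by linarith)
  have hεc : c < -2 * ε * (C₁ + M₀) := by
    have : ε * (4 * (C₁ + M₀ + 1)) = -c := div_mul_cancel₀ _ (by linarith)
    nlinarith
  obtain ⟨W, hW, hWle, hWb⟩ := F.exists_barrier ht₀ hε0
  have hWc : ContinuousOn W (Metric.sphere 0 1) := fun x hx =>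
    (hW.differentiableAt (sphere_ne_zero hx)).continuousAt.continuousWithinAt
  have hpos : ∀ x ∈ Metric.sphere (0 : Eucl n) 1, suppFun (K t₀) x ≠ 0 := fun x hx =>
    (hb.suppFun_pos (sphere_ne_zero hx)).ne'
  set v : Eucl n → ℝ := fun x => W x / suppFun (K t₀) x with hv
  have hvc : ContinuousOn v (Metric.sphere 0 1) := hWc.div hb.continuous_suppFun.continuousOn hpos
  set u : Eucl n → ℝ := fun z => v (normalAt (K t₀) z) - ε with hu
  have hum : Measurable u := (h.measurable_comp_normalAt hvc).sub_const ε
  have huhom : ∀ c : ℝ, 0 < c → ∀ z, u (c • z) = u z := fun c hc z => by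
    simp only [hu, h.normalAt_smul hc]
  obtain ⟨M, hM⟩ : ∃ M, ∀ z, |u z| ≤ M := by
    obtain ⟨M, hM⟩ := (isCompact_sphere (0 : Eucl n) 1).exists_bound_of_continuousOn hvc
    refine ⟨max (M + ε) |u 0|, fun z => ?_⟩
    rcases eq_or_ne z 0 with rfl | hz
    · exact le_max_right _ _
    · refine le_max_of_le_left ((abs_sub _ _).trans ?_)
      rw [abs_of_pos hε0]
      exact add_le_add_left (hM _ (h.normalAt_mem hz)) ε
  have hlim := tendsto_slope_chordEnergy_starPert hn hq hb hum huhom hM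
  have hI : c < ∫ ξ, 2 * (radFun (K t₀) (ξ : Eucl n) ^ n * u ξ *
      Vtilde q (K t₀) (radFun (K t₀) (ξ : Eucl n) • (ξ : Eucl n))) ∂(sphMeas n) := by
    have hvar := h.neg_mul_le_integral hn hq F.nonneg F.continuous F.pos hWc hWle
    have iA : Integrable (fun ξ : Metric.sphere (0 : Eucl n) 1 =>
        radFun (K t₀) (ξ : Eucl n) ^ n * (W (normalAt (K t₀) ξ) / suppFun (K t₀) (normalAt (K t₀) ξ)) *
        Vtilde q (K t₀) (radFun (K t₀) (ξ : Eucl n) • (ξ : Eucl n))) (sphMeas n) := by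
      have hsub : Metric.sphere (0 : Eucl n) 1 ⊆ {0}ᶜ := fun x hx => sphere_ne_zero hx
      have cr := hb.continuousOn_radFun.mono hsub
      exact integrable_sphMeas (((cr.pow n).mul (hvc.comp (h.continuousOn_normalAt.mono hsub)
        fun z hz => h.normalAt_mem (sphere_ne_zero hz))).mul
        ((continuous_Vtilde hn hq hb).comp_continuousOn (cr.smul continuousOn_id)))
    have iB : Integrable (fun ξ : Metric.sphere (0 : Eucl n) 1 =>
        Vtilde q (K t₀) (radFun (K t₀) (ξ : Eucl n) • (ξ : Eucl n)) *
        radFun (K t₀) (ξ : Eucl n) ^ n) (sphMeas n) :=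
      (hb.continuous_chord_integrand hn hq).integrable_of_hasCompactSupport
        (HasCompactSupport.of_compactSpace _)
    have : ∫ ξ, 2 * (radFun (K t₀) (ξ : Eucl n) ^ n * u ξ *
        Vtilde q (K t₀) (radFun (K t₀) (ξ : Eucl n) • (ξ : Eucl n))) ∂(sphMeas n) =
        2 * ((∫ ξ, radFun (K t₀) (ξ : Eucl n) ^ n *
          (W (normalAt (K t₀) ξ) / suppFun (K t₀) (normalAt (K t₀) ξ)) *
          Vtilde q (K t₀) (radFun (K t₀) (ξ : Eucl n) • (ξ : Eucl n)) ∂(sphMeas n)) - ε * M₀) := by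
      rw [integral_const_mul, hM₀, ← integral_const_mul ε, ← integral_sub iA (iB.const_mul ε)]
      congr 2
      funext ξ
      simp only [hu, hv]
      ring
    rw [this]
    linarith
  have hmap : Tendsto (fun t : ℝ => t - t₀) (𝓝[>] t₀) (𝓝[>] 0) := by
    refine tendsto_nhdsWithin_iff.2 ⟨?_, ?_⟩
    · have : Tendsto (fun t : ℝ => t - t₀) (𝓝 t₀) (𝓝 (t₀ - t₀)) :=
        (continuous_id.sub continuous_const).tendsto t₀
      rw [sub_self] at this
      exact this.mono_left nhdsWithin_le_nhds
    · filter_upwards [self_mem_nhdsWithin] with t ht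
      exact sub_pos.2 (Set.mem_Ioi.1 ht)
  filter_upwards [hmap.eventually (hlim.eventually (lt_mem_nhds hI)),
    hmap.eventually (h.eventually_starPert_subset hvc hε0), hWb,
    Ioo_mem_nhdsGT ht₀.2] with t h1 h2 h3 ht
  have htI : t ∈ Set.Ico 0 T := ⟨ht₀.1.trans ht.1.le, ht.2⟩
  have hbt := (F.smooth t htI).isBody
  refine h1.trans_le (div_le_div_of_nonneg_right (sub_le_sub_right
    (chordEnergy_mono hn hq (measurableSet_starPert hb hum _) hbt.measurableSet (hKR t htI)
      (h2 (K t) hbt fun x hx => ?_)) _) (sub_nonneg.2 ht.1.le))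
  refine le_trans (le_of_eq ?_) (h3 x hx)
  have := hpos x hx
  simp only [hv]
  field_simp

lemma continuousOn_chordEnergy (F : FlowSolution q p T f K) :
    ContinuousOn (fun t => chordEnergy q (K t)) (Set.Ico 0 T) := by
  obtain ⟨R, hR, hKR⟩ := F.exists_bound
  rw [continuousOn_iff_continuous_domRestrict, continuous_iff_continuousAt]
  intro t₀
  have hS := F.suppTendsto hR hKR t₀
  exact tendsto_chordEnergy (A := fun t : Set.Ico (0 : ℝ) T => K t) F.dim_pos F.one_lt
    (fun t => (F.smooth t t.2).isBody.measurableSet) hS.lim.isBody hS.bodyTendsto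

/-- The chord energy does not decrease along the flow. -/
lemma chordEnergy_zero_le (F : FlowSolution q p T f K) {t : ℝ} (ht : t ∈ Set.Ico 0 T) :
    chordEnergy q (K 0) ≤ chordEnergy q (K t) := by
  have hsub : Set.Icc 0 t ⊆ Set.Ico 0 T := fun s hs => ⟨hs.1, hs.2.trans_lt ht.2⟩
  have key := image_le_of_liminf_slope_right_le_deriv_boundary
    (f := fun s => -chordEnergy q (K s)) (a := 0) (b := t)
    (B := fun _ => -chordEnergy q (K 0)) (B' := fun _ => 0)
    (F.continuousOn_chordEnergy.mono hsub).neg le_rfl continuousOn_const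
    (fun s _ => hasDerivWithinAt_const _ _ _) (fun s hs r hr => by
      refine Eventually.frequently ?_
      filter_upwards [F.eventually_lt_slope_chordEnergy (hsub ⟨hs.1, hs.2.le⟩)
        (neg_neg_of_pos hr)] with z hz
      rw [slope_def_field]
      have : (-chordEnergy q (K z) - -chordEnergy q (K s)) / (z - s) =
        -((chordEnergy q (K z) - chordEnergy q (K s)) / (z - s)) := by ring
      rw [this]
      linarith) (x := t) ⟨ht.1, le_rfl⟩
  exact neg_le_neg_iff.1 key

end FlowSolution

lemma chordEnergy_pos (hn : 0 < n) (hq : 1 < q) {K : Set (Eucl n)} (hK : IsBody K) :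
    0 < chordEnergy q K := by
  obtain ⟨R, hR0, hR⟩ := hK.exists_radius
  rw [chordEnergy, setIntegral_pos_iff_support_of_nonneg_ae
    (Eventually.of_forall fun y => Vtilde_nonneg _ _)
    (integrableOn_Vtilde hn hq hK.measurableSet hK.measurableSet hR hR)]
  rw [Set.inter_eq_right.2 fun y _ => Function.mem_support.2 (Vtilde_pos hn hq hK y).ne']
  exact hK.volume_pos

end

section

variable {n : ℕ} {q p T : ℝ} {f : Eucl n → ℝ}

/-- Thin slabs have uniformly small volume inside a ball. -/
lemma exists_volume_slab_lt (hn : 0 < n) (R : ℝ) {ε : ℝ} (hε : 0 < ε) :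
    ∃ δ : ℝ, 0 < δ ∧ ∀ x ∈ Metric.sphere (0 : Eucl n) 1,
      volume.real (Metric.closedBall (0 : Eucl n) R ∩ {z | |⟪x, z⟫| ≤ δ}) < ε := by
  have : Nonempty (Fin n) := ⟨⟨0, hn⟩⟩
  obtain ⟨x₀, hx₀⟩ : (Metric.sphere (0 : Eucl n) 1).Nonempty :=
    NormedSpace.sphere_nonempty.2 zero_le_one
  set s : ℝ → Set (Eucl n) := fun δ => Metric.closedBall 0 R ∩ {z | |⟪x₀, z⟫| ≤ δ} with hs
  have hsm : ∀ δ, MeasurableSet (s δ) := fun δ =>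
    measurableSet_closedBall.inter (measurableSet_le (by fun_prop) measurable_const)
  have hfin : ∀ δ, volume (s δ) ≠ ⊤ := fun δ =>
    ((measure_mono Set.inter_subset_left).trans_lt measure_closedBall_lt_top).ne
  have hnull : volume (⋂ δ > (0 : ℝ), s δ) = 0 := by
    refine measure_mono_null (t := ((innerSL ℝ x₀).ker : Set (Eucl n))) (fun z hz => ?_)
      (Measure.addHaar_submodule volume _ fun htop => ?_)
    · have h1 : |⟪x₀, z⟫| ≤ 0 := le_of_forall_pos_le_add fun δ hδ => by
        have := (Set.mem_iInter₂.1 hz δ hδ).2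
        rw [zero_add]
        exact this
      simpa using h1
    · have h1 : x₀ ∈ (innerSL ℝ x₀).ker := htop ▸ Submodule.mem_top
      simp [mem_sphere_zero_iff_norm.1 hx₀] at h1
  have hlim := tendsto_measure_biInter_gt (μ := volume) (s := s) (a := 0)
    (fun δ _ => (hsm δ).nullMeasurableSet)
    (fun i j _ hij => Set.inter_subset_inter_right _ fun z hz => le_trans hz hij)
    ⟨1, one_pos, hfin 1⟩
  rw [hnull] at hlim
  obtain ⟨δ, h1, hδ⟩ := ((hlim.eventually (gt_mem_nhds (ENNReal.ofReal_pos.2 hε))).and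
    self_mem_nhdsWithin).exists
  refine ⟨δ, hδ, fun x hx => ?_⟩
  obtain ⟨L, hL⟩ := exists_linearIsometryEquiv_map hx hx₀
  have hpre : Metric.closedBall (0 : Eucl n) R ∩ {z | |⟪x, z⟫| ≤ δ} = L ⁻¹' s δ := by
    ext z
    simp only [hs, Set.mem_inter_iff, Set.mem_preimage, mem_closedBall_zero_iff, L.norm_map,
      Set.mem_ofPred_eq]
    rw [← hL, L.inner_map_map]
  rw [hpre, measureReal_def, L.measurePreserving.measure_preimage (hsm δ).nullMeasurableSet]
  exact (ENNReal.toReal_lt_of_lt_ofReal h1)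

namespace FlowSolution

variable {K : ℝ → Set (Eucl n)}

/-- The support functions are uniformly bounded below along the flow. -/
lemma exists_le_suppFun (F : FlowSolution q p T f K) :
    ∃ r : ℝ, 0 < r ∧ ∀ t ∈ Set.Ico 0 T, ∀ x ∈ Metric.sphere (0 : Eucl n) 1,
      r ≤ suppFun (K t) x := by
  obtain ⟨R, hR, hKR⟩ := F.exists_bound
  obtain ⟨C, hC0, hC⟩ := exists_Vtilde_le (n := n) (q := q) F.dim_pos F.one_lt R
  have hJ := chordEnergy_pos (q := q) F.dim_pos F.one_lt (F.smooth 0 ⟨le_rfl, F.time_pos⟩).isBody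
  obtain ⟨δ, hδ, hslab⟩ := exists_volume_slab_lt F.dim_pos R (div_pos hJ hC0)
  refine ⟨δ, hδ, fun t ht x hx => ?_⟩
  by_contra! hlt
  have h := F.smooth t ht
  have hsub : K t ⊆ Metric.closedBall (0 : Eucl n) R ∩ {z | |⟪x, z⟫| ≤ δ} := fun z hz => by
    refine ⟨hKR t ht hz, abs_le.2 ⟨?_, (h.isBody.inner_le x hz).trans hlt.le⟩⟩
    have := h.isBody.inner_le x (h.2.2.2.1 z hz)
    rw [inner_neg_right] at this
    linarith
  have hvol : volume.real (K t) < chordEnergy q (K 0) / C :=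
    (measureReal_mono hsub ((measure_mono Set.inter_subset_left).trans_lt
      measure_closedBall_lt_top).ne).trans_lt (hslab x hx)
  have hfin : volume (K t) < ⊤ := h.1.measure_lt_top
  have h1 : chordEnergy q (K t) ≤ C * volume.real (K t) :=
    (Real.le_norm_self _).trans (norm_setIntegral_le_of_norm_le_const hfin fun y hy => by
      rw [Real.norm_of_nonneg (Vtilde_nonneg _ _)]
      exact hC _ h.isBody.measurableSet (hKR t ht) y (hKR t ht hy))
  have h2 := F.chordEnergy_zero_le ht
  have h3 := (lt_div_iff₀ hC0).1 hvol
  linarith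

end FlowSolution

lemma IsSmoothBody.norm_gradient_suppFun_sub_le {K : Set (Eucl n)} (h : IsSmoothBody K) {R : ℝ}
    (hR : K ⊆ Metric.closedBall 0 R) {x : Eucl n} (hx : x ∈ Metric.sphere (0 : Eucl n) 1) :
    ‖gradient (suppFun K) x - suppFun K x • x‖ ≤ 2 * R := by
  have hxn := mem_sphere_zero_iff_norm.1 hx
  have h1 := mem_closedBall_zero_iff.1 (hR (h.gradient_mem (sphere_ne_zero hx)).1)
  have h2 := h.isBody.suppFun_le_norm hR x
  rw [hxn, mul_one] at h2
  refine (norm_sub_le _ _).trans ?_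
  rw [norm_smul, hxn, mul_one, Real.norm_of_nonneg (h.isBody.suppFun_nonneg _)]
  linarith

lemma IsBody.norm_gradient_radFun_le {K : Set (Eucl n)} (hK : IsBody K) {r R : ℝ} (hr : 0 < r)
    (hR0 : 0 < R) (hrK : ∀ x ∈ Metric.sphere (0 : Eucl n) 1, r ≤ suppFun K x)
    (hR : K ⊆ Metric.closedBall 0 R) {ξ : Eucl n} (hξ : ξ ∈ Metric.sphere (0 : Eucl n) 1) :
    ‖gradient (radFun K) ξ‖ ≤ 2 * R ^ 2 / r := by
  have hξn := mem_sphere_zero_iff_norm.1 hξ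
  have hball : Metric.ball (0 : Eucl n) r.toNNReal ⊆ K := fun z hz =>
    hK.mem_of_forall_inner_le fun x hx => by
      have h1 := real_inner_le_norm x z
      rw [mem_sphere_zero_iff_norm.1 hx, one_mul] at h1
      have h2 := mem_ball_zero_iff.1 hz
      rw [Real.coe_toNNReal r hr.le] at h2
      linarith [hrK x hx]
  have hlip := hK.convex.lipschitzWith_gauge (r := r.toNNReal) (Real.toNNReal_pos.2 hr) hball
  have hnorm : ‖gradient (radFun K) ξ‖ = ‖fderiv ℝ (radFun K) ξ‖ := by
    rw [gradient, LinearIsometryEquiv.norm_map]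
  rw [hnorm]
  refine norm_fderiv_le_of_lip' ℝ (by positivity) ?_
  have hev : ∀ᶠ z in 𝓝 ξ, 1 / 2 < ‖z‖ :=
    (continuous_norm.tendsto ξ).eventually (lt_mem_nhds (by rw [hξn]; norm_num))
  filter_upwards [hev] with z hz
  have hz0 : z ≠ 0 := norm_pos_iff.1 (by linarith)
  have hξ0 := sphere_ne_zero hξ
  have g1 := hK.gauge_pos hz0
  have g2 := hK.gauge_pos hξ0
  have n1 := hK.norm_le_mul_gauge hR z
  have n2 := hK.norm_le_mul_gauge hR ξ
  rw [hξn] at n2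
  have hd := hlip.dist_le_mul z ξ
  rw [Real.dist_eq, dist_eq_norm, NNReal.coe_inv, Real.coe_toNNReal r hr.le, abs_sub_comm] at hd
  rw [hK.radFun_eq hz0, hK.radFun_eq hξ0, inv_sub_inv g1.ne' g2.ne', norm_div, Real.norm_eq_abs,
    Real.norm_of_nonneg (mul_pos g1 g2).le, div_le_iff₀ (mul_pos g1 g2)]
  have h1 : 1 ≤ 2 * R ^ 2 * (gauge K z * gauge K ξ) := by
    have h2 : 1 / 2 ≤ R * gauge K z := by linarith
    nlinarith [mul_le_mul h2 n2 zero_le_one (by positivity)]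
  calc |gauge K ξ - gauge K z| ≤ r⁻¹ * ‖z - ξ‖ * 1 := by rw [mul_one]; exact hd
    _ ≤ r⁻¹ * ‖z - ξ‖ * (2 * R ^ 2 * (gauge K z * gauge K ξ)) :=
      mul_le_mul_of_nonneg_left h1 (by positivity)
    _ = _ := by ring

lemma FlowSolution.exists_c1_bound {K : ℝ → Set (Eucl n)} (F : FlowSolution q p T f K) :
    ∃ C : ℝ, 0 < C ∧ ∀ t ∈ Set.Ico (0 : ℝ) T, ∀ x ∈ Metric.sphere (0 : Eucl n) 1,
      ‖gradient (suppFun (K t)) x - suppFun (K t) x • x‖ ≤ C ∧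
      ‖gradient (radFun (K t)) x + radFun (K t) x • x‖ ≤ C := by
  obtain ⟨R, hR, hKR⟩ := F.exists_bound
  obtain ⟨r, hr, hrK⟩ := F.exists_le_suppFun
  refine ⟨2 * R ^ 2 / r + 2 * R, by positivity, fun t ht x hx => ⟨?_, ?_⟩⟩
  · refine ((F.smooth t ht).norm_gradient_suppFun_sub_le (hKR t ht) hx).trans ?_
    have : 0 ≤ 2 * R ^ 2 / r := by positivity
    linarith
  · have hb := (F.smooth t ht).isBody
    have h1 := hb.norm_gradient_radFun_le hr hR (hrK t ht) (hKR t ht) hx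
    have h2 := hb.radFun_le (hKR t ht) hx
    refine (norm_add_le _ _).trans (add_le_add h1 ?_)
    rw [norm_smul, mem_sphere_zero_iff_norm.1 hx, mul_one,
      Real.norm_of_nonneg (hb.radFun_pos (sphere_ne_zero hx)).le]
    linarith

end

/-- Lemma 4.3: uniform `C¹` bounds along the flow.  The covariant
spherical gradient of `h` at `x ∈ S^{n-1}` is the tangential part
`gradient (suppFun (K t)) x - h x • x` of the ambient gradient of the `1`-homogeneous
extension, and the covariant gradient of `ρ` is
`gradient (radFun (K t)) ξ + ρ ξ • ξ` (the extension `radFun` being `(-1)`-homogeneous). -/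
theorem c1_estimates_along_flow
    (n : ℕ) (q p : ℝ) (hq : 1 < q) (hp : 0 ≤ p) (T : ℝ) (hT : 0 < T)
    (f : Eucl n → ℝ) (hf : ContDiff ℝ (⊤ : ℕ∞) f)
    (hfpos : ∀ x ∈ Metric.sphere (0 : Eucl n) 1, 0 < f x)
    (hfeven : ∀ x : Eucl n, f (-x) = f x)
    (K : ℝ → Set (Eucl n))
    (hsmooth : ∀ t ∈ Set.Ico (0 : ℝ) T, IsSmoothBody (K t))
    (hflow : IsGaussChordFlow q p f (Set.Ico 0 T) K) :
    ∃ C : ℝ, 0 < C ∧ ∀ t ∈ Set.Ico (0 : ℝ) T, ∀ x ∈ Metric.sphere (0 : Eucl n) 1,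
      ‖gradient (suppFun (K t)) x - suppFun (K t) x • x‖ ≤ C ∧
      ‖gradient (radFun (K t)) x + radFun (K t) x • x‖ ≤ C := by
  rcases Nat.eq_zero_or_pos n with rfl | hn
  · refine ⟨1, one_pos, fun t _ x hx => absurd (Subsingleton.elim x 0) (sphere_ne_zero hx)⟩
  · exact FlowSolution.exists_c1_bound
      ⟨hn, hq, hp, hT, hf.continuous, hfpos, hsmooth, hflow⟩
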